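/- Let T be the torus, let α be an essential simple closed curve in T, and let β and γ be essential simple closed curves in the isotopy class [α]. Then the crossing number defined via the annular (cyclic) cover corresponding to [α] is symmetric: C_β(γ) = C_γ(β). -/

import Mathlib

noncomputable section

open Set

/-- The circle, as `ℝ / ℤ`. -/
abbrev Circle1 := AddCircle (1 : ℝ)

/-- `c` is a simple closed curve in `S`: the image of a continuous injection of the circle. -/
def IsSCC {S : Type} [TopologicalSpace S] (c : Set S) : Prop :=
  ∃ f : C(Circle1, S), Function.Injective f ∧ Set.range f = c

/-- A simple closed curve is essential if no parametrization of it is null-homotopic. -/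
def IsEssentialSCC {S : Type} [TopologicalSpace S] (c : Set S) : Prop :=
  IsSCC c ∧ ∀ f : C(Circle1, S), Set.range f = c →
    ¬ ∃ x : S, f.Homotopic (ContinuousMap.const Circle1 x)

/-- A simple closed curve is nonperipheral (with respect to the boundary `Bd`) if no
parametrization of it is freely homotopic to a loop contained in `Bd`. -/
def IsNonperipheralSCC {S : Type} [TopologicalSpace S] (Bd c : Set S) : Prop :=
  ∀ f : C(Circle1, S), Set.range f = c →
    ¬ ∃ g : C(Circle1, S), Set.range g ⊆ Bd ∧ f.Homotopic g

/-- An essential nonperipheral simple closed curve in the interior of the surface. -/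
def IsEssentialCurve {S : Type} [TopologicalSpace S] (Bd : Set S) (c : Set S) : Prop :=
  IsSCC c ∧ IsEssentialSCC c ∧ IsNonperipheralSCC Bd c ∧ Disjoint c Bd

/-- Two simple closed curves are isotopic (equivalently, for essential simple closed curves
on a surface, freely homotopic): some injective parametrizations are freely homotopic. -/
def CurvesIsotopic {S : Type} [TopologicalSpace S] (c d : Set S) : Prop :=
  ∃ f g : C(Circle1, S), Function.Injective f ∧ Function.Injective g ∧
    Set.range f = c ∧ Set.range g = d ∧ f.Homotopic g

/-- Identification relation defining the Möbius band as a quotient of the square. -/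
def MobiusRel (p q : unitInterval × unitInterval) : Prop :=
  p = q ∨ ((p.1 : ℝ) = 0 ∧ (q.1 : ℝ) = 1 ∧ (p.2 : ℝ) + (q.2 : ℝ) = 1)

/-- The Möbius band. -/
def MobiusBand : Type := Quot MobiusRel

instance : TopologicalSpace MobiusBand :=
  inferInstanceAs (TopologicalSpace (Quot MobiusRel))

/-- `S` is a compact connected orientable surface of genus `g` with `b` boundary components,
with boundary `Bd`.  Orientability is expressed as the nonexistence of an embedded Möbius
band, and the genus as the maximal number of disjoint simple closed curves with connected
complement. -/
def IsOrientedSurface (g b : ℕ) (S : Type) [TopologicalSpace S] (Bd : Set S) : Prop :=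
  CompactSpace S ∧ ConnectedSpace S ∧ T2Space S ∧ SecondCountableTopology S ∧
  IsClosed Bd ∧
  (∀ x : S, x ∉ Bd → ∃ U : Set S, IsOpen U ∧ x ∈ U ∧ Nonempty (U ≃ₜ (ℝ × ℝ))) ∧
  (∀ x ∈ Bd, ∃ U : Set S, IsOpen U ∧ x ∈ U ∧
      Nonempty (U ≃ₜ ({p : ℝ × ℝ | 0 ≤ p.2} : Set (ℝ × ℝ)))) ∧
  Nat.card (ConnectedComponents ↥Bd) = b ∧
  (¬ ∃ e : C(MobiusBand, S), Function.Injective e) ∧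
  (∃ F : Fin g → Set S, (∀ i, IsSCC (F i) ∧ Disjoint (F i) Bd) ∧
      Pairwise (Function.onFun Disjoint F) ∧ IsConnected (⋃ i, F i)ᶜ) ∧
  ¬ (∃ F : Fin (g + 1) → Set S, (∀ i, IsSCC (F i) ∧ Disjoint (F i) Bd) ∧
      Pairwise (Function.onFun Disjoint F) ∧ IsConnected (⋃ i, F i)ᶜ)

/-- Vertices of the fine curve graph: essential nonperipheral simple closed curves. -/
def CurveVert (S : Type) [TopologicalSpace S] (Bd : Set S) : Type :=
  {c : Set S // IsEssentialCurve Bd c}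

/-- The fine curve graph: edges connect (distinct) disjoint curves. -/
def fineCurveGraph (S : Type) [TopologicalSpace S] (Bd : Set S) :
    SimpleGraph (CurveVert S Bd) :=
  SimpleGraph.fromRel fun c d => Disjoint c.val d.val

/-- Isotopy, as a relation on vertices of the fine curve graph. -/
def isotopyRel (S : Type) [TopologicalSpace S] (Bd : Set S) :
    CurveVert S Bd → CurveVert S Bd → Prop :=
  fun c d => CurvesIsotopic c.val d.val

/-- Isotopy classes of essential nonperipheral simple closed curves. -/
def CurveClass (S : Type) [TopologicalSpace S] (Bd : Set S) : Type :=
  Quot (isotopyRel S Bd)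

/-- The (usual) curve graph: vertices are isotopy classes, edges connect classes
admitting disjoint representatives. -/
def curveGraph (S : Type) [TopologicalSpace S] (Bd : Set S) :
    SimpleGraph (CurveClass S Bd) :=
  SimpleGraph.fromRel fun x y => ∃ c d : CurveVert S Bd,
    Quot.mk _ c = x ∧ Quot.mk _ d = y ∧ Disjoint c.val d.val

/-- The star of a vertex of a graph: the vertex together with all its neighbors. -/
def graphStar {V : Type} (G : SimpleGraph V) (v : V) : Set V :=
  insert v (G.neighborSet v)

/-- `c00`: real sequences which are eventually `0`. -/
def c00 : Type := {f : ℕ → ℝ // ∀ᶠ n in Filter.atTop, f n = 0}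

/-- The `ℓ^∞` (supremum) distance on `c00`. -/
def c00Dist (f g : c00) : ℝ := ⨆ n, |f.val n - g.val n|

/-- `f : X → Y` is a quasi-isometric embedding with respect to the given distance
functions: `(1/K) d(x,x') - L ≤ d(f x, f x') ≤ K d(x,x') + L` for all `x, x'`. -/
def IsQIEmbedding {X Y : Type} (dX : X → X → ℝ) (dY : Y → Y → ℝ) (f : X → Y) : Prop :=
  ∃ K L : ℝ, 0 < K ∧ 0 ≤ L ∧ ∀ x x' : X,
    dX x x' / K - L ≤ dY (f x) (f x') ∧ dY (f x) (f x') ≤ K * dX x x' + L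

/-- Gromov hyperbolicity of a distance function, via the four-point condition
(equivalent, for geodesic spaces, to the thin-triangles condition). -/
def GromovHyperbolicDist {X : Type} (d : X → X → ℝ) : Prop :=
  ∃ δ : ℝ, 0 ≤ δ ∧ ∀ x y z w : X,
    d x y + d z w ≤ max (d x z + d y w) (d x w + d y z) + 2 * δ

/-- The `ℓ^∞` distance on `ℤ^N`. -/
def zNDist (N : ℕ) (u v : Fin N → ℤ) : ℝ :=
  ((Finset.univ.sup fun i => (u i - v i).natAbs : ℕ) : ℝ)
open scoped Classical

/-- An annular (cyclic) cover of the surface `S`: a covering map whose total space is an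
open annulus. -/
structure AnnCover (S : Type) [TopologicalSpace S] : Type 1 where
  /-- The total space of the cover. -/
  Tot : Type
  /-- The topology on the total space. -/
  top : TopologicalSpace Tot
  /-- The covering map. -/
  p : Tot → S
  cov : IsCoveringMap p
  annulus : Nonempty (Tot ≃ₜ (Circle1 × ℝ))

attribute [instance] AnnCover.top

/-- Elevations of a curve `δ` in the cover `C`: connected components of `p ⁻¹(δ)`. -/
def Elev {S : Type} [TopologicalSpace S] (C : AnnCover S) (δ : Set S) : Type :=
  {A : Set C.Tot // ∃ x ∈ C.p ⁻¹' δ, A = connectedComponentIn (C.p ⁻¹' δ) x}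

/-- Data exhibiting the compact elevation of a curve `δ` in the cover `C` (witnessing that
the cover corresponds to the homotopy class of `δ`: `δ` lifts bijectively to its compact
elevation), together with a choice of positive side of the compact elevation. -/
structure CurveLift {S : Type} [TopologicalSpace S] (C : AnnCover S) (δ : Set S) where
  /-- A point of the compact elevation. -/
  x0 : C.Tot
  mem : C.p x0 ∈ δ
  compact : IsCompact (connectedComponentIn (C.p ⁻¹' δ) x0)
  bij : Set.BijOn C.p (connectedComponentIn (C.p ⁻¹' δ) x0) δ
  /-- A point on the chosen positive side of the compact elevation. -/
  pos : C.Tot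
  pos_notin : pos ∉ connectedComponentIn (C.p ⁻¹' δ) x0

/-- The compact elevation, as a subset of the total space. -/
def hatSet {S : Type} [TopologicalSpace S] {C : AnnCover S} {δ : Set S}
    (D : CurveLift C δ) : Set C.Tot :=
  connectedComponentIn (C.p ⁻¹' δ) D.x0

/-- The compact elevation, as an elevation. -/
def hatElev {S : Type} [TopologicalSpace S] {C : AnnCover S} {δ : Set S}
    (D : CurveLift C δ) : Elev C δ :=
  ⟨hatSet D, D.x0, D.mem, rfl⟩

/-- The tree of elevations of `δ`: two elevations are adjacent exactly when they lie in
the closure of a common connected component of the complement of `p ⁻¹(δ)`. -/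
def elevTree {S : Type} [TopologicalSpace S] (C : AnnCover S) (δ : Set S) :
    SimpleGraph (Elev C δ) :=
  SimpleGraph.fromRel fun A B => ∃ x ∈ (C.p ⁻¹' δ)ᶜ,
    A.val ⊆ closure (connectedComponentIn (C.p ⁻¹' δ)ᶜ x) ∧
    B.val ⊆ closure (connectedComponentIn (C.p ⁻¹' δ)ᶜ x)

/-- The signed level of an elevation: its distance to the compact elevation in the tree of
elevations, with positive sign exactly for elevations on the chosen positive side. -/
def level {S : Type} [TopologicalSpace S] {C : AnnCover S} {δ : Set S}
    (D : CurveLift C δ) (A : Elev C δ) : ℤ :=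
  if A.val ⊆ connectedComponentIn (hatSet D)ᶜ D.pos
  then ((elevTree C δ).dist (hatElev D) A : ℤ)
  else -(((elevTree C δ).dist (hatElev D) A : ℕ) : ℤ)

/-- The set of levels of `δ` met by a subset `T` of the cover. -/
def levelsMet {S : Type} [TopologicalSpace S] {C : AnnCover S} {δ : Set S}
    (D : CurveLift C δ) (T : Set C.Tot) : Set ℤ :=
  {k | ∃ A : Elev C δ, level D A = k ∧ (A.val ∩ T).Nonempty}

/-- The `γ`-crossing number of `β`: the number of levels of `γ` intersected by the compact
elevation of `β` (and `0` when `β = γ`). -/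
def crossing {S : Type} [TopologicalSpace S] {C : AnnCover S} {γc βc : Set S}
    (D : CurveLift C γc) (E : CurveLift C βc) : ℕ :=
  if βc = γc then 0 else (levelsMet D (hatSet E)).ncard

/-- A simple closed curve is separating if its complement is disconnected. -/
def IsSeparating {S : Type} [TopologicalSpace S] (c : Set S) : Prop :=
  ¬ IsPreconnected cᶜ
/-- Vertices of the single-isotopy-class fine curve graph: essential simple closed curves
isotopic to `αc` (on a closed surface). -/
def SingleVert (S : Type) [TopologicalSpace S] (αc : Set S) : Type :=
  {c : Set S // IsEssentialCurve ∅ c ∧ CurvesIsotopic c αc}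

/-- The single-isotopy-class fine curve graph `C†_α(S)`: edges connect (distinct)
disjoint curves isotopic to `αc`. -/
def singleFineGraph (S : Type) [TopologicalSpace S] (αc : Set S) :
    SimpleGraph (SingleVert S αc) :=
  SimpleGraph.fromRel fun c d => Disjoint c.val d.val

open Topology Filter

theorem exists_log_of_simplyConnected {X : Type*} [TopologicalSpace X] [SimplyConnectedSpace X]
    [LocallyPathConnectedSpace X] (f : X → ℂ) (hf : Continuous f) (h0 : ∀ x, f x ≠ 0) :
    ∃ g : X → ℂ, Continuous g ∧ ∀ x, Complex.exp (g x) = f x := by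
  obtain ⟨x0⟩ : Nonempty X := inferInstance
  rcases Complex.isCoveringMapOn_exp.existsUnique_continuousMap_lifts (⟨f, hf⟩ : C(X, ℂ))
    (Complex.exp_log (h0 x0)) (fun x ↦ h0 x) with ⟨g, ⟨-, hg⟩, -⟩
  exact ⟨g, g.continuous, fun x ↦ congr_fun hg x⟩

theorem logs_differ_const {X : Type*} [TopologicalSpace X] {S : Set X} (hS : IsPreconnected S)
    {f g : X → ℂ} (hf : ContinuousOn f S) (hg : ContinuousOn g S)
    (h : ∀ x ∈ S, Complex.exp (f x) = Complex.exp (g x)) {a b : X} (ha : a ∈ S) (hb : b ∈ S) :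
    f a - g a = f b - g b := by
  refine Complex.isCoveringMap_exp.constOn_of_comp (g := fun x ↦ f x - g x) hS
    (hf.sub hg) ?_ ha hb
  intro x hx y hy
  apply Subtype.ext
  simp [Complex.exp_sub, h x hx, h y hy]

theorem isPreconnected_inter_of_union_eq_univ {O₁ O₂ : Set ℂ} (h₁ : IsOpen O₁) (h₂ : IsOpen O₂)
    (c₁ : IsPreconnected O₁) (c₂ : IsPreconnected O₂) (hu : O₁ ∪ O₂ = univ) :
    IsPreconnected (O₁ ∩ O₂) := by
  intro u v hu' hv' hsub ⟨a, haO, hau⟩ ⟨b, hbO, hbv⟩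
  by_contra hne
  rw [not_nonempty_iff_eq_empty] at hne
  have hdisj : ∀ x, x ∈ O₁ → x ∈ O₂ → x ∈ u → x ∈ v → False := fun x p q r s ↦ by
    have : x ∈ O₁ ∩ O₂ ∩ (u ∩ v) := ⟨⟨p, q⟩, r, s⟩
    rw [hne] at this; exact this
  obtain ⟨w, hw0, hw1, -⟩ := exists_continuous_zero_one_of_isClosed h₂.isClosed_compl
    h₁.isClosed_compl (by
      rw [Set.disjoint_left]; intro x hx hx'
      have : x ∈ O₁ ∪ O₂ := hu ▸ mem_univ x
      rcases this with h | h
      · exact hx' h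
      · exact hx h)
  set V₁ := O₁ ∩ O₂ ∩ u with hV₁
  have oV₁ : IsOpen V₁ := (h₁.inter h₂).inter hu'
  have oV₂ : IsOpen (O₁ ∩ O₂ ∩ v) := (h₁.inter h₂).inter hv'
  have key : ∀ (k : ℂ → ℂ), Continuous k → ∀ x, (x ∉ O₁ ∩ O₂ → k x = 0) →
      ContinuousAt (fun y ↦ if y ∈ V₁ then k y else 0) x := by
    intro k hk x hx
    by_cases hx1 : x ∈ V₁
    · refine hk.continuousAt.congr ?_
      filter_upwards [oV₁.mem_nhds hx1] with y hy
      simp [hy]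
    by_cases hx2 : x ∈ O₁ ∩ O₂
    · have hxv : x ∈ v := (hsub hx2).resolve_left fun h ↦ hx1 ⟨hx2, h⟩
      refine (continuousAt_const (y := (0 : ℂ))).congr ?_
      filter_upwards [oV₂.mem_nhds ⟨hx2, hxv⟩] with y hy
      rw [if_neg]
      exact fun h ↦ hdisj y hy.1.1 hy.1.2 h.2 hy.2
    · have := hx hx2
      rw [ContinuousAt, if_neg hx1]
      refine squeeze_zero_norm (a := fun y ↦ ‖k y‖) (fun y ↦ ?_) ?_
      · split_ifs
        · exact le_rfl
        · simp
      · have := (hk.norm.tendsto x); simpa [hx hx2] using this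
  have hwc : Continuous fun y ↦ ((w y : ℝ) : ℂ) := by fun_prop
  have hout : ∀ x, x ∉ O₁ ∩ O₂ → Complex.exp (2 * Real.pi * Complex.I * (w x : ℝ)) - 1 = 0 := by
    intro x hx
    have : w x = 0 ∨ w x = 1 := by
      by_cases h : x ∈ O₂
      · exact Or.inr (hw1 fun h' ↦ hx ⟨h', h⟩)
      · exact Or.inl (hw0 h)
    rcases this with h | h <;> simp [h]
  set h : ℂ → ℂ := fun y ↦ 1 + if y ∈ V₁ then
    (Complex.exp (2 * Real.pi * Complex.I * (w y : ℝ)) - 1) else 0 with hh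
  have hc : Continuous h := by
    rw [continuous_iff_continuousAt]
    intro x
    refine continuousAt_const.add (key _ ?_ x (hout x))
    fun_prop
  have hne0 : ∀ x, h x ≠ 0 := by
    intro x; simp only [hh]; split_ifs <;> simp [Complex.exp_ne_zero]
  obtain ⟨ψ, hψ, hψe⟩ := exists_log_of_simplyConnected h hc hne0
  have haV : a ∈ V₁ := ⟨haO, hau⟩
  have hbV : b ∉ V₁ := fun hb' ↦ hdisj b hbO.1 hbO.2 hb'.2 hbv
  have e1 := logs_differ_const c₁ (f := ψ)
    (g := fun y ↦ if y ∈ V₁ then 2 * Real.pi * Complex.I * (w y : ℝ) else 0)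
    hψ.continuousOn (fun x hx ↦ (key _ (by fun_prop) x (fun hx2 ↦ by
      have : w x = 0 := hw0 fun h ↦ hx2 ⟨hx, h⟩
      simp [this])).continuousWithinAt)
    (fun x _ ↦ by rw [hψe, hh]; dsimp only; split_ifs <;> simp) haO.1 hbO.1
  have e2 := logs_differ_const c₂ (f := ψ)
    (g := fun y ↦ if y ∈ V₁ then 2 * Real.pi * Complex.I * ((w y : ℝ) - 1) else 0)
    hψ.continuousOn (fun x hx ↦ (key _ (by fun_prop) x (fun hx2 ↦ by
      have : w x = 1 := hw1 fun h ↦ hx2 ⟨h, hx⟩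
      simp [this])).continuousWithinAt)
    (fun x _ ↦ by
      rw [hψe, hh]; dsimp only; split_ifs
      · rw [mul_sub, Complex.exp_sub, mul_one, Complex.exp_two_pi_mul_I]; simp
      · simp) haO.2 hbO.2
  simp only [if_pos haV, if_neg hbV] at e1 e2
  have : (2 * Real.pi * Complex.I : ℂ) = 0 := by linear_combination e2 - e1
  simp [Real.pi_ne_zero] at this

/-- `f` has a continuous logarithm on `K`. -/
def HasLogOn {X : Type*} [TopologicalSpace X] (f : X → ℂ) (K : Set X) : Prop :=
  ∃ g : X → ℂ, ContinuousOn g K ∧ ∀ x ∈ K, Complex.exp (g x) = f x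

theorem HasLogOn.mono {X : Type*} [TopologicalSpace X] {f : X → ℂ} {K L : Set X}
    (h : HasLogOn f L) (hKL : K ⊆ L) : HasLogOn f K :=
  let ⟨g, hg, he⟩ := h
  ⟨g, hg.mono hKL, fun x hx ↦ he x (hKL hx)⟩

theorem HasLogOn.mul {X : Type*} [TopologicalSpace X] {f₁ f₂ f : X → ℂ} {K : Set X}
    (h₁ : HasLogOn f₁ K) (h₂ : HasLogOn f₂ K) (hf : ∀ x ∈ K, f x = f₁ x * f₂ x) :
    HasLogOn f K := by
  obtain ⟨g₁, c₁, e₁⟩ := h₁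
  obtain ⟨g₂, c₂, e₂⟩ := h₂
  exact ⟨fun x ↦ g₁ x + g₂ x, c₁.add c₂, fun x hx ↦ by rw
    [Complex.exp_add, e₁ x hx, e₂ x hx, hf x hx]⟩

theorem hasLogOn_of_slitPlane {X : Type*} [TopologicalSpace X] {f : X → ℂ} {K : Set X}
    (hf : ContinuousOn f K) (h : ∀ x ∈ K, f x ∈ Complex.slitPlane) : HasLogOn f K :=
  ⟨fun x ↦ Complex.log (f x), hf.clog h,
    fun x hx ↦ Complex.exp_log (Complex.slitPlane_ne_zero (h x hx))⟩

theorem hasLogOn_const {X : Type*} [TopologicalSpace X] {c : ℂ} (hc : c ≠ 0) (K : Set X) :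
    HasLogOn (fun _ : X ↦ c) K :=
  ⟨fun _ ↦ Complex.log c, continuousOn_const, fun _ _ ↦ Complex.exp_log hc⟩

theorem one_add_mem_slitPlane {z : ℂ} (hz : ‖z‖ < 1) : 1 + z ∈ Complex.slitPlane :=
  Complex.mem_slitPlane_of_norm_lt_one hz

theorem hasLogOn_sub_of_dist {K : Set ℂ} {a a' : ℂ} (h : ∀ z ∈ K, ‖a - a'‖ < ‖z - a‖)
    (ha : HasLogOn (fun z ↦ z - a) K) : HasLogOn (fun z ↦ z - a') K := by
  have h0 : ∀ z ∈ K, z - a ≠ 0 := fun z hz ↦ norm_pos_iff.1 ((norm_nonneg _).trans_lt (h z hz))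
  refine ha.mul (f₂ := fun z ↦ 1 + (a - a') / (z - a)) (hasLogOn_of_slitPlane ?_ ?_) ?_
  · exact continuousOn_const.add (continuousOn_const.div (by fun_prop) h0)
  · intro z hz
    apply one_add_mem_slitPlane
    rw [norm_div, div_lt_one (norm_pos_iff.2 (h0 z hz))]
    exact h z hz
  · intro z hz
    have := h0 z hz
    field_simp
    ring

theorem hasLogOn_sub_of_preconnected {K C : Set ℂ} (hK : IsCompact K) (hC : IsPreconnected C)
    (hd : Disjoint C K) {a b : ℂ} (ha : a ∈ C) (hb : b ∈ C)
    (h : HasLogOn (fun z ↦ z - a) K) : HasLogOn (fun z ↦ z - b) K := by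
  have loc : ∀ c ∈ C, ∃ ε > 0, ∀ z ∈ K, 2 * ε < ‖z - c‖ := by
    intro c hc
    have : Kᶜ ∈ 𝓝 c := hK.isClosed.isOpen_compl.mem_nhds (Set.disjoint_left.1 hd hc)
    obtain ⟨ε, hε, hb⟩ := Metric.mem_nhds_iff.1 this
    refine ⟨ε / 3, by positivity, fun z hz ↦ ?_⟩
    by_contra! hlt
    refine hb (show z ∈ Metric.ball c ε from ?_) hz
    rw [Metric.mem_ball, dist_eq_norm]; linarith
  have key : ∀ c ∈ C, ∀ᶠ d in 𝓝 c, (HasLogOn (fun z ↦ z - c) K ↔ HasLogOn (fun z ↦ z - d) K) := by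
    intro c hc
    obtain ⟨ε, hε, he⟩ := loc c hc
    filter_upwards [Metric.ball_mem_nhds c hε] with d hd'
    rw [Metric.mem_ball, dist_eq_norm] at hd'
    constructor
    · refine hasLogOn_sub_of_dist fun z hz ↦ ?_
      have := he z hz
      rw [norm_sub_rev]; linarith
    · refine hasLogOn_sub_of_dist fun z hz ↦ ?_
      have := he z hz
      have h3 : ‖z - c‖ ≤ ‖z - d‖ + ‖d - c‖ := by
        simpa using norm_add_le (z - d) (d - c)
      linarith
  have := hC.induction₂ (fun x y ↦ HasLogOn (fun z ↦ z - x) K ↔ HasLogOn (fun z ↦ z - y) K)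
    (fun x hx ↦ (key x hx).filter_mono nhdsWithin_le_nhds) (fun x y z _ _ _ ↦ Iff.trans)
    (fun x y _ _ ↦ Iff.symm) ha hb
  exact this.1 h

theorem hasLogOn_sub_far {K : Set ℂ} {a : ℂ} (h : ∀ z ∈ K, ‖z‖ < ‖a‖) :
    HasLogOn (fun z ↦ z - a) K := by
  by_cases ha : a = 0
  · exact ⟨fun _ ↦ 0, continuousOn_const, fun z hz ↦ by
      have := h z hz; rw [ha] at this; simp at this; linarith [norm_nonneg z]⟩
  refine (hasLogOn_const (neg_ne_zero.2 ha) K).mul (f₂ := fun z ↦ 1 + -z / a)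
    (hasLogOn_of_slitPlane (by fun_prop) ?_) ?_
  · intro z hz
    apply one_add_mem_slitPlane
    rw [norm_div, norm_neg, div_lt_one (norm_pos_iff.2 ha)]
    exact h z hz
  · intro z _
    field_simp
    ring

theorem eilenberg_separation {K V : Set ℂ} (hK : IsCompact K) (hV : IsOpen V)
    (hVb : Bornology.IsBounded V) (hVK : frontier V ⊆ K) {a x : ℂ} (ha : a ∈ V)
    (hx : x ∉ closure V) {m k : ℤ} (hlog : HasLogOn (fun z ↦ (z - a) ^ m * (z - x) ^ k) K) :
    m = 0 := by
  obtain ⟨g, hg, hge⟩ := hlog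
  obtain ⟨G, hG⟩ := ContinuousMap.exists_restrict_eq hK.isClosed
    (⟨K.domRestrict g, continuousOn_iff_continuous_domRestrict.1 hg⟩ : C(K, ℂ))
  have hGK : ∀ z ∈ K, G z = g z := fun z hz ↦ congr_fun (congrArg DFunLike.coe hG) ⟨z, hz⟩
  set h : ℂ → ℂ := fun z ↦ if z ∈ closure V then Complex.exp (G z) * (z - x) ^ (-k)
    else (z - a) ^ m with hh
  have hfr : ∀ z ∈ frontier (closure V), Complex.exp (G z) * (z - x) ^ (-k) = (z - a) ^ m := by
    intro z hz
    have hz' : z ∈ frontier V := frontier_closure_subset hz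
    have hzx : z - x ≠ 0 := sub_ne_zero.2 fun e ↦ hx (e ▸ frontier_subset_closure hz')
    rw [hGK z (hVK hz'), hge z (hVK hz'), mul_assoc, ← zpow_add₀ hzx]
    simp
  have hc : Continuous h := by
    refine continuous_if hfr ?_ ?_
    · refine ContinuousOn.mul (by fun_prop) (ContinuousOn.zpow₀ (by fun_prop) _ ?_)
      intro z hz
      replace hz : z ∈ closure (closure V) := hz
      rw [closure_closure] at hz
      exact Or.inl (sub_ne_zero.2 fun e ↦ hx (e ▸ hz))
    · refine ContinuousOn.zpow₀ (by fun_prop) _ ?_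
      intro z hz
      refine Or.inl (sub_ne_zero.2 fun e ↦ ?_)
      subst e
      have h1 : {z | z ∉ closure V} ⊆ Vᶜ := fun y hy hy' ↦ hy (subset_closure hy')
      have h2 := closure_mono h1 hz
      rw [hV.isClosed_compl.closure_eq] at h2
      exact h2 ha
  have h0 : ∀ z, h z ≠ 0 := by
    intro z
    simp only [hh]
    split_ifs with hz
    · refine mul_ne_zero (Complex.exp_ne_zero _) (zpow_ne_zero _
        (sub_ne_zero.2 fun e ↦ hx (e ▸ hz)))
    · exact zpow_ne_zero _ (sub_ne_zero.2 fun e ↦ hz (e ▸ subset_closure ha))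
  obtain ⟨ψ, hψ, hψe⟩ := exists_log_of_simplyConnected h hc h0
  obtain ⟨R₀, hR₀⟩ := hVb.closure.exists_norm_le
  obtain ⟨R, hR1, hR2, hR3⟩ : ∃ R : ℝ, R₀ < R ∧ ‖a‖ < R ∧ 0 < R :=
    ⟨max (max R₀ ‖a‖) 0 + 1, by linarith [le_max_left (max R₀ ‖a‖) 0, le_max_left R₀ ‖a‖],
      by linarith [le_max_left (max R₀ ‖a‖) 0, le_max_right R₀ ‖a‖],
      by linarith [le_max_right (max R₀ ‖a‖) 0]⟩
  have hRne : (R : ℂ) ≠ 0 := by exact_mod_cast hR3.ne'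
  let c : ℝ → ℂ := fun θ ↦ R * Complex.exp (θ * Complex.I)
  have hcn : ∀ θ, ‖c θ‖ = R := fun θ ↦ by
    simp [c, Complex.norm_exp_ofReal_mul_I, abs_of_pos hR3]
  have hc0 : ∀ θ, c θ ≠ 0 := fun θ ↦ by simp [c, hRne]
  have hcc : Continuous c := by fun_prop
  have hslit : ∀ θ, 1 + -(a / c θ) ∈ Complex.slitPlane := by
    intro θ
    apply one_add_mem_slitPlane
    rw [norm_neg, norm_div, hcn, div_lt_one hR3]; exact hR2
  have e1 := logs_differ_const (S := (univ : Set ℝ)) isPreconnected_univ (f := fun θ ↦ ψ (c θ))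
    (g := fun θ ↦ m * (Real.log R + θ * Complex.I + Complex.log (1 + -(a / c θ))))
    (by fun_prop) (by
      refine Continuous.continuousOn ?_
      refine continuous_const.mul (Continuous.add (by fun_prop) ?_)
      exact Continuous.clog (continuous_const.add (continuous_const.div hcc hc0).neg) hslit)
    (by
      intro θ _
      rw [hψe, Complex.exp_int_mul, Complex.exp_add, Complex.exp_add,
        Complex.exp_log (Complex.slitPlane_ne_zero (hslit θ)), ← Complex.ofReal_exp,
        Real.exp_log hR3]
      have : c θ ∉ closure V := fun hz ↦ by have := hR₀ _ hz; rw [hcn] at this; linarith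
      simp only [hh, if_neg this]
      congr 1
      have := hc0 θ
      change c θ - a = c θ * _
      field_simp
      ring)
    (mem_univ 0) (mem_univ (2 * Real.pi))
  have hcp : c (2 * Real.pi) = c 0 := by simp [c]
  simp only [hcp] at e1
  have : (m : ℂ) * (2 * Real.pi * Complex.I) = 0 := by
    push_cast at e1; linear_combination e1
  simpa [Real.pi_ne_zero] using this

theorem frontier_connectedComponentIn_subset {X : Type*} [TopologicalSpace X]
    [LocallyConnectedSpace X] {U : Set X} (hU : IsOpen U) (x : X) :
    frontier (connectedComponentIn U x) ⊆ Uᶜ := by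
  intro y hy hyU
  have ho : IsOpen (connectedComponentIn U y) := hU.connectedComponentIn
  obtain ⟨z, hz1, hz2⟩ := mem_closure_iff.1 hy.1 _ ho (mem_connectedComponentIn hyU)
  rw [connectedComponentIn_eq hz2, ← connectedComponentIn_eq hz1] at hy
  rw [ho.frontier_eq] at hy
  exact hy.2 (mem_connectedComponentIn hyU)

theorem not_hasLogOn_of_frontier {K V : Set ℂ} (hK : IsCompact K) (hV : IsOpen V)
    (hVb : Bornology.IsBounded V) (hVK : frontier V ⊆ K) {a : ℂ} (ha : a ∈ V) :
    ¬ HasLogOn (fun z ↦ z - a) K := by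
  intro h
  obtain ⟨R, hR⟩ := hVb.closure.exists_norm_le
  have : ((|R| + 1 : ℝ) : ℂ) ∉ closure V := fun h ↦ by
    have h1 := hR _ h
    rw [Complex.norm_real, Real.norm_of_nonneg (by positivity)] at h1
    linarith [le_abs_self R]
  have := eilenberg_separation (m := 1) (k := 0) hK hV hVb hVK ha this (by simpa using h)
  exact one_ne_zero this

theorem Topology.IsEmbedding.continuousOn_invFun {X Y : Type*} [TopologicalSpace X]
    [TopologicalSpace Y] [Nonempty X] {f : X → Y} (hf : IsEmbedding f) :
    ContinuousOn (Function.invFun f) (range f) := by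
  rw [hf.isInducing.continuousOn_iff]
  refine continuousOn_id.congr ?_
  rintro _ ⟨x, rfl⟩
  exact congrArg f (Function.leftInverse_invFun hf.injective x)

theorem Topology.IsEmbedding.hasLogOn_image {X Y : Type*} [TopologicalSpace X]
    [TopologicalSpace Y] [Nonempty X] {f : X → Y} (hf : IsEmbedding f) {F : Y → ℂ} {S : Set X}
    (h : HasLogOn (F ∘ f) S) : HasLogOn F (f '' S) := by
  obtain ⟨g, hg, he⟩ := h
  refine ⟨g ∘ Function.invFun f, hg.comp (hf.continuousOn_invFun.mono (image_subset_range _ _)) ?_,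
    ?_⟩
  · rintro _ ⟨x, hx, rfl⟩
    rwa [Function.leftInverse_invFun hf.injective]
  · rintro _ ⟨x, hx, rfl⟩
    simp only [Function.comp, Function.leftInverse_invFun hf.injective x]
    exact he x hx

theorem circle_exists_degree {F : Circle1 → ℂ} (hF : Continuous F) (h0 : ∀ t, F t ≠ 0) :
    ∃ (g : ℝ → ℂ) (n : ℤ), Continuous g ∧ (∀ t : ℝ, Complex.exp (g t) = F t) ∧
      ∀ t, g (t + 1) = g t + n * (2 * Real.pi * Complex.I) := by
  obtain ⟨g, hg, he⟩ := exists_log_of_simplyConnected (fun t : ℝ ↦ F t)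
    (hF.comp (AddCircle.continuous_mk' _)) (fun t ↦ h0 t)
  have hper : ∀ t : ℝ, Complex.exp (g (t + 1)) = Complex.exp (g t) := fun t ↦ by
    rw [he, he, AddCircle.coe_add_period]
  obtain ⟨n, hn⟩ := Complex.exp_eq_exp_iff_exists_int.1 (hper 0)
  refine ⟨g, n, hg, he, fun t ↦ ?_⟩
  have := logs_differ_const (S := (univ : Set ℝ)) isPreconnected_univ
    (f := fun t ↦ g (t + 1)) (g := g) (by fun_prop) hg.continuousOn (fun t _ ↦ hper t)
    (mem_univ t) (mem_univ 0)
  linear_combination this + hn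

theorem circle_hasLogOn_of_periodic {F : Circle1 → ℂ} {g : ℝ → ℂ} (hg : Continuous g)
    (he : ∀ t : ℝ, Complex.exp (g t) = F t) (hp : ∀ t, g (t + 1) = g t) : HasLogOn F univ := by
  have hp' : Function.Periodic g 1 := hp
  refine ⟨hp'.lift, ?_, ?_⟩
  · refine Continuous.continuousOn ?_
    exact continuous_quot_lift _ hg
  · intro t _
    induction t using QuotientAddGroup.induction_on with | H t => ?_
    exact he t

theorem circle_hasLogOn_compl_singleton {F : Circle1 → ℂ} (hF : Continuous F)
    (h0 : ∀ t, F t ≠ 0) (t₀ : Circle1) : HasLogOn F {t₀}ᶜ := by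
  obtain ⟨g, hg, he⟩ := exists_log_of_simplyConnected (fun t : ℝ ↦ F t)
    (hF.comp (AddCircle.continuous_mk' _)) (fun t ↦ h0 t)
  induction t₀ using QuotientAddGroup.induction_on with | H t₀ => ?_
  refine ⟨fun t ↦ g (AddCircle.equivIco 1 t₀ t), ?_, ?_⟩
  · intro t ht
    refine ContinuousAt.continuousWithinAt ?_
    exact hg.continuousAt.comp
      (continuous_subtype_val.continuousAt.comp (AddCircle.continuousAt_equivIco 1 t₀ ht))
  · intro t _
    rw [he]
    congr 1
    exact (AddCircle.equivIco 1 t₀).symm_apply_apply t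

theorem isPreconnected_norm_ge {R : ℝ} (hR : 0 < R) : IsPreconnected {z : ℂ | R ≤ ‖z‖} := by
  have : {z : ℂ | R ≤ ‖z‖} = Complex.exp '' {z | Real.log R ≤ z.re} := by
    ext z
    constructor
    · intro hz
      have hz' : R ≤ ‖z‖ := hz
      refine ⟨Complex.log z, ?_, Complex.exp_log (norm_pos_iff.1 (hR.trans_le hz'))⟩
      rw [mem_ofPred_eq, Complex.log_re]
      exact Real.log_le_log hR hz'
    · rintro ⟨w, hw, rfl⟩
      rw [mem_ofPred_eq, Complex.norm_exp]
      rwa [mem_ofPred_eq, Real.log_le_iff_le_exp hR] at hw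
  rw [this]
  exact (convex_halfSpace_re_ge _).isPreconnected.image _ Complex.continuous_exp.continuousOn

/-- The Jordan curve theorem for a simple closed curve winding around the origin. -/
theorem jordan_essential {f : Circle1 → ℂ} (hf : Continuous f) (hi : Function.Injective f)
    (h0 : ∀ t, f t ≠ 0) (hess : ¬ HasLogOn f univ) :
    ∃ In Out : Set ℂ, IsOpen In ∧ IsOpen Out ∧ IsPreconnected In ∧ IsPreconnected Out ∧
      Disjoint In Out ∧ In ∪ Out = (range f)ᶜ ∧ 0 ∈ In ∧ Bornology.IsBounded In ∧
      (∃ R > 0, ∀ z : ℂ, R ≤ ‖z‖ → z ∈ Out) ∧ range f ⊆ closure In ∧ range f ⊆ closure Out := by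
  have hemb : IsEmbedding f := (hf.isClosedEmbedding hi).isEmbedding
  have hJc : IsCompact (range f) := isCompact_range hf
  have hUo : IsOpen (range f)ᶜ := hJc.isClosed.isOpen_compl
  have hJlog : ¬ HasLogOn (fun z ↦ z - 0) (range f) := by
    rintro ⟨g, hg, he⟩
    refine hess ⟨g ∘ f, hg.comp hf.continuousOn (fun t _ ↦ mem_range_self t), fun t _ ↦ ?_⟩
    simpa using he (f t) (mem_range_self t)
  obtain ⟨R, hR0, hR⟩ : ∃ R > 0, ∀ z ∈ range f, ‖z‖ < R := by
    obtain ⟨R, hR⟩ := hJc.isBounded.exists_norm_le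
    exact ⟨|R| + 1, by positivity, fun z hz ↦ by linarith [hR z hz, le_abs_self R]⟩
  have hRn : ‖(R : ℂ)‖ = R := by rw [Complex.norm_real, Real.norm_of_nonneg hR0.le]
  have hRJ : (R : ℂ) ∈ (range f)ᶜ := fun h ↦ by have := hR _ h; rw [hRn] at this; linarith
  have h0J : (0 : ℂ) ∈ (range f)ᶜ := by rintro ⟨t, ht⟩; exact h0 t ht
  set In := connectedComponentIn (range f)ᶜ 0 with hIn
  set Out := connectedComponentIn (range f)ᶜ (R : ℂ) with hOut
  have oIn : IsOpen In := hUo.connectedComponentIn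
  have oOut : IsOpen Out := hUo.connectedComponentIn
  have h0In : (0 : ℂ) ∈ In := mem_connectedComponentIn h0J
  have hfar : ∀ z : ℂ, R ≤ ‖z‖ → z ∈ Out := by
    have hsub : {z : ℂ | R ≤ ‖z‖} ⊆ Out :=
      (isPreconnected_norm_ge hR0).subset_connectedComponentIn hRn.ge
        (fun z hz h ↦ absurd (hR z h) (not_lt.2 hz))
    exact fun z hz ↦ hsub hz
  have h0Out : (0 : ℂ) ∉ Out := by
    intro h
    refine hJlog (hasLogOn_sub_of_preconnected hJc isPreconnected_connectedComponentIn
      (disjoint_compl_left.mono_left (connectedComponentIn_subset _ _))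
      (mem_connectedComponentIn hRJ) h (hasLogOn_sub_far ?_))
    rw [hRn]; exact hR
  have hdisj : Disjoint In Out := by
    rw [Set.disjoint_left]
    intro x hx hx'
    apply h0Out
    rw [hOut, connectedComponentIn_eq hx', ← connectedComponentIn_eq hx]
    exact h0In
  have hbd : ∀ V : Set ℂ, Disjoint V Out → Bornology.IsBounded V := by
    intro V hV
    refine (Metric.isBounded_ball (x := (0 : ℂ)) (r := R)).subset fun z hz ↦ ?_
    rw [mem_ball_zero_iff]
    by_contra! h
    exact Set.disjoint_left.1 hV hz (hfar z h)
  have hunion : In ∪ Out = (range f)ᶜ := by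
    refine Subset.antisymm (union_subset (connectedComponentIn_subset _ _)
      (connectedComponentIn_subset _ _)) fun x hx ↦ ?_
    by_contra hcon
    rw [mem_union, not_or] at hcon
    set V := connectedComponentIn (range f)ᶜ x with hV
    have hxV : x ∈ V := mem_connectedComponentIn hx
    have hVO : Disjoint V Out := by
      rw [Set.disjoint_left]
      intro y hy hy'
      apply hcon.2
      rw [hOut, connectedComponentIn_eq hy', ← connectedComponentIn_eq hy]
      exact hxV
    have h0V : (0 : ℂ) ∉ closure V := by
      intro h
      obtain ⟨y, hy, hy'⟩ := mem_closure_iff.1 h In oIn h0In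
      apply hcon.1
      rw [hIn, connectedComponentIn_eq hy, ← connectedComponentIn_eq hy']
      exact hxV
    have hfr : frontier V ⊆ range f := by
      simpa using frontier_connectedComponentIn_subset hUo x
    have hx0 : ∀ t, f t - x ≠ 0 := fun t h ↦ hx ⟨t, sub_eq_zero.1 h⟩
    obtain ⟨g₀, n₀, c₀, e₀, p₀⟩ := circle_exists_degree hf h0
    obtain ⟨g₁, n₁, c₁, e₁, p₁⟩ := circle_exists_degree (F := fun t ↦ f t - x) (by fun_prop) hx0
    have hn₀ : n₀ ≠ 0 := by
      rintro rfl
      exact hess (circle_hasLogOn_of_periodic c₀ e₀ (by simpa using p₀))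
    have hlog : HasLogOn (fun z ↦ (z - x) ^ n₀ * (z - 0) ^ (-n₁)) (range f) := by
      rw [← image_univ]
      refine hemb.hasLogOn_image ?_
      refine circle_hasLogOn_of_periodic (g := fun t ↦ n₀ * g₁ t + (-n₁ : ℤ) * g₀ t) (by fun_prop)
        ?_ ?_
      · intro t
        rw [Complex.exp_add, Complex.exp_int_mul, Complex.exp_int_mul, e₀, e₁]
        simp
      · intro t
        rw [p₀, p₁]
        push_cast
        ring
    exact hn₀ (eilenberg_separation hJc hUo.connectedComponentIn (hbd _ hVO) hfr hxV h0V hlog)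
  have hfrIn : frontier In ⊆ range f := by
    simpa using frontier_connectedComponentIn_subset hUo 0
  have hfrOut : frontier Out ⊆ range f := by
    simpa using frontier_connectedComponentIn_subset hUo (R : ℂ)
  have hlogarc : ∀ t, HasLogOn (fun z ↦ z - 0) (range f \ {f t}) := by
    intro t
    refine (hemb.hasLogOn_image (F := fun z ↦ z - 0) (S := {t}ᶜ) ?_).mono ?_
    · simpa [Function.comp_def] using circle_hasLogOn_compl_singleton hf h0 t
    · rintro _ ⟨⟨s, rfl⟩, hs⟩
      exact ⟨s, fun e ↦ hs (by rw [mem_singleton_iff.1 e]; rfl), rfl⟩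
  refine ⟨In, Out, oIn, oOut, isPreconnected_connectedComponentIn,
    isPreconnected_connectedComponentIn, hdisj, hunion, h0In, hbd In hdisj, ⟨R, hR0, hfar⟩, ?_, ?_⟩
  · rintro _ ⟨t, rfl⟩
    by_contra hcon
    have hK : IsCompact (frontier In) := hJc.of_isClosed_subset isClosed_frontier hfrIn
    refine not_hasLogOn_of_frontier hK oIn (hbd In hdisj) Subset.rfl h0In ((hlogarc t).mono ?_)
    intro z hz
    exact ⟨hfrIn hz, fun e ↦ hcon (mem_singleton_iff.1 e ▸ frontier_subset_closure hz)⟩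
  · rintro _ ⟨t, rfl⟩
    by_contra hcon
    have hfr : frontier (closure Out)ᶜ ⊆ frontier Out := by
      rw [frontier_compl]; exact frontier_closure_subset
    have hK : IsCompact (frontier (closure Out)ᶜ) :=
      hJc.of_isClosed_subset isClosed_frontier (hfr.trans hfrOut)
    refine not_hasLogOn_of_frontier hK isClosed_closure.isOpen_compl
      (hbd _ (disjoint_compl_left.mono_right subset_closure)) Subset.rfl (a := 0) ?_
      ((hlogarc t).mono ?_)
    · intro h
      obtain ⟨y, hy, hy'⟩ := mem_closure_iff.1 h In oIn h0In
      exact Set.disjoint_left.1 hdisj hy hy'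
    · intro z hz
      exact ⟨hfrOut (hfr hz), fun e ↦ hcon (mem_singleton_iff.1 e ▸
        frontier_subset_closure (hfr hz))⟩

/-- Every connected set lying over `V` is mapped injectively. -/
def LiftInj {A T : Type*} [TopologicalSpace A] (p : A → T) (V : Set T) : Prop :=
  ∀ C : Set A, IsPreconnected C → C ⊆ p ⁻¹' V → InjOn p C

theorem LiftInj.mono {A T : Type*} [TopologicalSpace A] {p : A → T} {V W : Set T}
    (h : LiftInj p W) (hVW : V ⊆ W) : LiftInj p V :=
  fun C hC hCV ↦ h C hC (hCV.trans (preimage_mono hVW))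

theorem exists_liftInj_nhds {A T : Type*} [TopologicalSpace A] [TopologicalSpace T] {p : A → T}
    (hp : IsCoveringMap p) (x : T) : ∃ N : Set T, IsOpen N ∧ x ∈ N ∧ LiftInj p N ∧
      ∀ w, p w ∈ N → ∃ s : T → A, ContinuousOn s N ∧ s (p w) = w ∧ ∀ y ∈ N, p (s y) = y := by
  by_cases hne : Nonempty (p ⁻¹' {x})
  · have : DiscreteTopology (p ⁻¹' {x}) := (hp x).discreteTopology_fiber
    let e := (hp x).toTrivialization
    have hx : x ∈ e.baseSet := (hp x).mem_toTrivialization_baseSet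
    refine ⟨e.baseSet, e.open_baseSet, hx, ?_, ?_⟩
    · intro C hC hCV a ha b hb hab
      have hsrc : C ⊆ e.source := fun c hc ↦ e.mem_source.2 (hCV hc)
      have h2 : (e a).2 = (e b).2 := by
        refine hC.constant (f := fun c ↦ (e c).2) ?_ ha hb
        exact continuous_snd.comp_continuousOn (e.continuousOn_toFun.mono hsrc)
      refine e.injOn (hsrc ha) (hsrc hb) (Prod.ext ?_ h2)
      exact (e.coe_fst (hsrc ha)).trans (hab.trans (e.coe_fst (hsrc hb)).symm)
    · intro w hw
      refine ⟨fun y ↦ e.toOpenPartialHomeomorph.symm (y, (e w).2), ?_, ?_, ?_⟩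
      · refine e.toOpenPartialHomeomorph.continuousOn_symm.comp (by fun_prop) ?_
        intro y hy
        exact e.mem_target.2 hy
      · have : (p w, (e w).2) = e w := Prod.ext (e.coe_fst (e.mem_source.2 hw)).symm rfl
        dsimp only
        rw [this]
        exact e.toOpenPartialHomeomorph.left_inv (e.mem_source.2 hw)
      · intro y hy
        exact e.proj_symm_apply (e.mem_target.2 hy)
  · have : IsEmpty (p ⁻¹' {x}) := not_nonempty_iff.1 hne
    obtain ⟨_, U, hxU, hU, _, H, hH⟩ := hp x
    have hemp : ∀ a, p a ∉ U := fun a ha ↦ IsEmpty.false (α := p ⁻¹' {x}) (H ⟨a, ha⟩).2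
    exact ⟨U, hU, hxU, fun C _ hCV a ha ↦ absurd (hCV ha) (hemp a), fun w hw ↦ absurd hw (hemp w)⟩

theorem exists_sheet {A T : Type*} [TopologicalSpace A] [TopologicalSpace T]
    [LocallyConnectedSpace T] {p : A → T} (hp : IsCoveringMap p) {V : Set T} (hV : IsOpen V)
    {y : T} (hy : y ∈ V) : ∃ N : Set T, IsOpen N ∧ y ∈ N ∧ N ⊆ V ∧ IsPreconnected N ∧
      ∀ w, p w ∈ N → ∃ S : Set A, IsPreconnected S ∧ w ∈ S ∧ p '' S = N := by
  obtain ⟨N₀, oN₀, hyN, -, hs⟩ := exists_liftInj_nhds hp y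
  have oN : IsOpen (N₀ ∩ V) := oN₀.inter hV
  refine ⟨connectedComponentIn (N₀ ∩ V) y, oN.connectedComponentIn,
    mem_connectedComponentIn ⟨hyN, hy⟩, (connectedComponentIn_subset _ _).trans inter_subset_right,
    isPreconnected_connectedComponentIn, fun w hw ↦ ?_⟩
  have hsub : connectedComponentIn (N₀ ∩ V) y ⊆ N₀ :=
    (connectedComponentIn_subset _ _).trans inter_subset_left
  obtain ⟨s, cs, sw, ps⟩ := hs w (hsub hw)
  refine ⟨s '' connectedComponentIn (N₀ ∩ V) y,
    isPreconnected_connectedComponentIn.image _ (cs.mono hsub), ⟨_, hw, sw⟩, ?_⟩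
  rw [image_image]
  ext z
  constructor
  · rintro ⟨u, hu, rfl⟩; simpa [ps u (hsub hu)] using hu
  · intro hz; exact ⟨z, hz, ps z (hsub hz)⟩

/-- Components of the preimage of a connected open set map onto it. -/
theorem image_connectedComponentIn_preimage {A T : Type*} [TopologicalSpace A]
    [TopologicalSpace T] [LocallyConnectedSpace T] [LocallyConnectedSpace A] {p : A → T}
    (hp : IsCoveringMap p) {V : Set T} (hV : IsOpen V) (cV : IsPreconnected V) {x : A}
    (hx : p x ∈ V) : p '' connectedComponentIn (p ⁻¹' V) x = V := by
  set W := connectedComponentIn (p ⁻¹' V) x with hW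
  have hxW : x ∈ W := mem_connectedComponentIn hx
  have oW : IsOpen W := (hV.preimage hp.continuous).connectedComponentIn
  have hWV : p '' W ⊆ V := image_subset_iff.2 (connectedComponentIn_subset _ _)
  refine hWV.antisymm ?_
  refine cV.subset_of_closure_inter_subset (hp.isOpenMap W oW) ⟨p x, hx, x, hxW, rfl⟩ ?_
  rintro y ⟨hy, hyV⟩
  obtain ⟨N, oN, hyN, hNV, -, hs⟩ := exists_sheet hp hV hyV
  obtain ⟨_, hN, w, hw, rfl⟩ := mem_closure_iff.1 hy N oN hyN
  obtain ⟨S, cS, hwS, hSN⟩ := hs w hN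
  have : S ⊆ W := by
    rw [hW, connectedComponentIn_eq hw]
    refine cS.subset_connectedComponentIn hwS fun z hz ↦ hNV ?_
    rw [← hSN]; exact mem_image_of_mem p hz
  rw [← hSN] at hyN
  exact image_mono this hyN

theorem continuousOn_invFunOn {A T : Type*} [Nonempty A] [TopologicalSpace A] [TopologicalSpace T]
    {p : A → T} (hp : IsOpenMap p) {O : Set A} (hO : IsOpen O) (hi : InjOn p O) :
    ContinuousOn (Function.invFunOn p O) (p '' O) := by
  rintro _ ⟨x, hx, rfl⟩
  have hinv : ∀ z ∈ O, Function.invFunOn p O (p z) = z := fun z hz ↦ hi.leftInvOn_invFunOn hz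
  rw [ContinuousWithinAt, hinv x hx]
  intro N hN
  obtain ⟨M, hMN, oM, hxM⟩ := mem_nhds_iff.1 hN
  refine mem_map.2 (mem_nhdsWithin_of_mem_nhds ?_)
  refine mem_of_superset ((hp _ (oM.inter hO)).mem_nhds ⟨x, ⟨hxM, hx⟩, rfl⟩) ?_
  rintro _ ⟨z, ⟨hzM, hzO⟩, rfl⟩
  rw [mem_preimage, hinv z hzO]
  exact hMN hzM

theorem subset_of_sheet {A T : Type*} [TopologicalSpace A] [TopologicalSpace T] {p : A → T}
    (hp : IsCoveringMap p) {O : Set A} (hO : IsOpen O) (hi : InjOn p O) {C : Set A}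
    (hC : IsPreconnected C) (hCO : MapsTo p C (p '' O)) (hne : (C ∩ O).Nonempty) : C ⊆ O := by
  obtain ⟨w, hwC, hwO⟩ := hne
  have : Nonempty A := ⟨w⟩
  have hinv : ∀ z ∈ O, Function.invFunOn p O (p z) = z := fun z hz ↦ hi.leftInvOn_invFunOn hz
  have := hp.eqOn_of_comp_eqOn hC (g₁ := id) (g₂ := fun x ↦ Function.invFunOn p O (p x))
    continuousOn_id ((continuousOn_invFunOn hp.isOpenMap hO hi).comp hp.continuous.continuousOn hCO)
    (fun x hx ↦ (Function.invFunOn_eq (hCO hx)).symm) hwC (hinv w hwO).symm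
  intro x hx
  have h1 := this hx
  rw [id] at h1
  rw [h1]
  exact Function.invFunOn_mem (hCO hx)

theorem injOn_union_of_sheets {A T : Type*} [TopologicalSpace A] [TopologicalSpace T] {p : A → T}
    (hp : IsCoveringMap p) {O₁ O₂ : Set A} (h₁ : IsOpen O₁) (h₂ : IsOpen O₂) (i₁ : InjOn p O₁)
    (i₂ : InjOn p O₂) (hc : IsPreconnected (p '' O₁ ∩ p '' O₂)) (hne : (O₁ ∩ O₂).Nonempty) :
    InjOn p (O₁ ∪ O₂) := by
  obtain ⟨w, hw₁, hw₂⟩ := hne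
  have : Nonempty A := ⟨w⟩
  have hinv : ∀ z ∈ O₂, Function.invFunOn p O₂ (p z) = z := fun z hz ↦ i₂.leftInvOn_invFunOn hz
  have hsub : Function.invFunOn p O₂ '' (p '' O₁ ∩ p '' O₂) ⊆ O₁ := by
    refine subset_of_sheet hp h₁ i₁ (hc.image _
      ((continuousOn_invFunOn hp.isOpenMap h₂ i₂).mono inter_subset_right)) ?_ ?_
    · rintro _ ⟨y, ⟨hy1, hy2⟩, rfl⟩
      rwa [Function.invFunOn_eq hy2]
    · exact ⟨w, ⟨p w, ⟨⟨w, hw₁, rfl⟩, ⟨w, hw₂, rfl⟩⟩, hinv w hw₂⟩, hw₁⟩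
  have key : ∀ x ∈ O₁, ∀ y ∈ O₂, p x = p y → x = y := fun x hx y hy hxy ↦
    i₁ hx (hsub ⟨p y, ⟨⟨x, hx, hxy⟩, ⟨y, hy, rfl⟩⟩, hinv y hy⟩) hxy
  rintro x (hx | hx) y (hy | hy) hxy
  · exact i₁ hx hy hxy
  · exact key x hx y hy hxy
  · exact (key y hy x hx hxy.symm).symm
  · exact i₂ hx hy hxy

theorem isPreconnected_diff_of_ring {X : Type*} [TopologicalSpace X] {U H B : Set X}
    (hU : IsPreconnected U) (hB : IsOpen B) (hBU : B ⊆ U) (hHB : H ⊆ B) (ho : IsOpen (U \ H))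
    (hc : IsPreconnected (B \ H)) : IsPreconnected (U \ H) := by
  have key : ∀ u v : Set X, IsOpen u → IsOpen v → U \ H ⊆ u ∪ v → B \ H ⊆ u →
      ((U \ H) ∩ u).Nonempty → ((U \ H) ∩ v).Nonempty → ((U \ H) ∩ (u ∩ v)).Nonempty := by
    intro u v hu hv hsub hBu hu1 hv1
    obtain ⟨z, hzU, hz1, hz2⟩ := hU ((U \ H) ∩ u ∪ B) ((U \ H) ∩ v) ((ho.inter hu).union hB)
      (ho.inter hv) (by
        intro z hz
        by_cases hzH : z ∈ H
        · exact Or.inl (Or.inr (hHB hzH))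
        · rcases hsub ⟨hz, hzH⟩ with h | h
          · exact Or.inl (Or.inl ⟨⟨hz, hzH⟩, h⟩)
          · exact Or.inr ⟨⟨hz, hzH⟩, h⟩)
      (hu1.imp fun z hz ↦ ⟨hz.1.1, Or.inl hz⟩) (hv1.imp fun z hz ↦ ⟨hz.1.1, hz⟩)
    rcases hz1 with hz1 | hz1
    · exact ⟨z, hz2.1, hz1.2, hz2.2⟩
    · exact ⟨z, hz2.1, hBu ⟨hz1, hz2.1.2⟩, hz2.2⟩
  intro u v hu hv hsub hu1 hv1
  by_contra hcon
  have hsub' : B \ H ⊆ u ∪ v := (sdiff_subset_sdiff_left hBU).trans hsub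
  rcases isPreconnected_iff_subset_of_disjoint.1 hc u v hu hv hsub' (by
    rw [← not_nonempty_iff_eq_empty]
    exact fun h ↦ hcon (h.mono (inter_subset_inter_left _ (sdiff_subset_sdiff_left hBU)))) with h |
      h
  · exact hcon (key u v hu hv hsub h hu1 hv1)
  · rw [inter_comm u v] at hcon
    exact hcon (key v u hv hu (by rwa [union_comm]) h hv1 hu1)

theorem isPreconnected_biUnion_chain {X Y : Type*} [TopologicalSpace X] [TopologicalSpace Y]
    {e : Set Y} (he : IsPreconnected e) {C : Y → Set X} (hC : ∀ t ∈ e, IsPreconnected (C t))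
    (hn : ∀ t ∈ e, ∀ᶠ s in 𝓝[e] t, (C t ∩ C s).Nonempty) : IsPreconnected (⋃ t ∈ e, C t) := by
  refine IsPreconnected.biUnion_of_reflTransGen hC fun s hs t ht ↦ ?_
  let R : Y → Y → Prop := fun i j ↦ Relation.ReflTransGen
    (fun i j ↦ (C i ∩ C j).Nonempty ∧ i ∈ e) i j ∧ Relation.ReflTransGen
    (fun i j ↦ (C i ∩ C j).Nonempty ∧ i ∈ e) j i
  have : R s t := by
    refine he.induction₂ R ?_ ?_ ?_ hs ht
    · intro x hx
      filter_upwards [hn x hx, self_mem_nhdsWithin] with y hy hye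
      exact ⟨.single ⟨hy, hx⟩, .single ⟨by rwa [inter_comm], hye⟩⟩
    · intro x y z _ _ _ h1 h2
      exact ⟨h1.1.trans h2.1, h2.2.trans h1.2⟩
    · intro x y _ _ h
      exact ⟨h.2, h.1⟩
  exact this.1

/-- A connected set of reals has a thin connected neighbourhood whose two halves are connected. -/
theorem exists_strip {e : Set ℝ} (he : IsPreconnected e) {W : Set ℂ} (hW : IsOpen W)
    (heW : ∀ t ∈ e, (t : ℂ) ∈ W) : ∃ N : Set ℂ, IsOpen N ∧ N ⊆ W ∧ (∀ t ∈ e, (t : ℂ) ∈ N) ∧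
      IsPreconnected N ∧ IsPreconnected (N ∩ {z | 0 < z.im}) ∧
      IsPreconnected (N ∩ {z | z.im < 0}) ∧ IsPreconnected (N ∩ {z | z.im = 0}) ∧
      ∀ t ∈ e, ∃ r > 0, Metric.ball (t : ℂ) r ⊆ N := by
  have : ∀ t : ℝ, ∃ r : ℝ, 0 < r ∧ (t ∈ e → Metric.ball (t : ℂ) r ⊆ W) := by
    intro t
    by_cases ht : t ∈ e
    · obtain ⟨r, hr, hb⟩ := Metric.isOpen_iff.1 hW _ (heW t ht)
      exact ⟨r, hr, fun _ ↦ hb⟩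
    · exact ⟨1, one_pos, fun h ↦ absurd h ht⟩
  choose r hr hrW using this
  have near : ∀ t ∈ e, ∀ᶠ s : ℝ in 𝓝[e] t, (s : ℂ) ∈ Metric.ball (t : ℂ) (r t) := by
    intro t _
    refine nhdsWithin_le_nhds ?_
    exact (Complex.continuous_ofReal.tendsto t) (Metric.ball_mem_nhds _ (hr t))
  have half : ∀ t s : ℝ, (s : ℂ) ∈ Metric.ball (t : ℂ) (r t) → ∀ σ : ℝ, ∃ ε > 0,
      (s + (σ * ε : ℝ) * Complex.I : ℂ) ∈ Metric.ball (t : ℂ) (r t) ∧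
      (s + (σ * ε : ℝ) * Complex.I : ℂ) ∈ Metric.ball (s : ℂ) (r s) := by
    intro t s hs σ
    have hc : Continuous fun ε : ℝ ↦ (s + (σ * ε : ℝ) * Complex.I : ℂ) := by fun_prop
    have h1 : ∀ᶠ ε in 𝓝[>] (0:ℝ), (s + (σ * ε : ℝ) * Complex.I : ℂ) ∈ Metric.ball (t : ℂ) (r t) :=
      nhdsWithin_le_nhds (hc.tendsto' 0 s (by simp) (Metric.isOpen_ball.mem_nhds hs))
    have h2 : ∀ᶠ ε in 𝓝[>] (0:ℝ), (s + (σ * ε : ℝ) * Complex.I : ℂ) ∈ Metric.ball (s : ℂ) (r s) :=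
      nhdsWithin_le_nhds (hc.tendsto' 0 s (by simp) (Metric.ball_mem_nhds _ (hr s)))
    obtain ⟨ε, h⟩ := (h1.and (h2.and self_mem_nhdsWithin)).exists
    exact ⟨ε, h.2.2, h.1, h.2.1⟩
  have part : ∀ (P : Set ℂ), Convex ℝ P →
      (∃ σ : ℝ, ∀ s ε : ℝ, 0 < ε → (s + (σ * ε : ℝ) * Complex.I : ℂ) ∈ P) →
      IsPreconnected ((⋃ t ∈ e, Metric.ball (t : ℂ) (r t)) ∩ P) := by
    rintro P hP ⟨σ, hσ⟩
    rw [iUnion₂_inter]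
    refine isPreconnected_biUnion_chain he
      (fun t _ ↦ ((convex_ball _ _).inter hP).isPreconnected) fun t ht ↦ ?_
    filter_upwards [near t ht] with s hs
    obtain ⟨ε, hε, h1, h2⟩ := half t s hs σ
    exact ⟨_, ⟨h1, hσ s ε hε⟩, h2, hσ s ε hε⟩
  refine ⟨⋃ t ∈ e, Metric.ball (t : ℂ) (r t), isOpen_biUnion fun _ _ ↦ Metric.isOpen_ball,
    iUnion₂_subset fun t ht ↦ hrW t ht,
    fun t ht ↦ mem_iUnion₂_of_mem ht (Metric.mem_ball_self (hr t)), ?_, ?_, ?_, ?_,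
    fun t ht ↦ ⟨r t, hr t, subset_iUnion₂_of_subset t ht Subset.rfl⟩⟩
  · simpa using part univ convex_univ ⟨0, by simp⟩
  · exact part _ (convex_halfSpace_im_gt 0) ⟨1, fun s ε hε ↦ by simpa using hε⟩
  · exact part _ (convex_halfSpace_im_lt 0) ⟨-1, fun s ε hε ↦ by simpa using hε⟩
  · refine part _ ?_ ⟨0, fun s ε hε ↦ by simp⟩
    exact (convex_hyperplane (𝕜 := ℝ) (f := Complex.im) Complex.imLm.isLinear (r := 0))

/-- Removing a half-open segment whose missing end point lies on the outside does not
disconnect. -/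
theorem isPreconnected_diff_leaf_unit {T : Type*} [TopologicalSpace T] {O : Set T} (hO : IsOpen O)
    (cO : IsPreconnected O) {φ : ℂ → T} (hφ : IsOpenEmbedding φ) (h0 : φ 0 ∉ O)
    (hI : ∀ t ∈ Ioc (0 : ℝ) 1, φ t ∈ O)
    (hcl : IsClosed (φ '' ((fun t : ℝ ↦ (t : ℂ)) '' Icc 0 1))) :
    IsPreconnected (O \ φ '' ((fun t : ℝ ↦ (t : ℂ)) '' Icc 0 1)) := by
  set J := φ '' ((fun t : ℝ ↦ (t : ℂ)) '' Icc 0 1) with hJ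
  set W : Set ℂ := φ ⁻¹' O ∩ {z | 0 < z.re} with hW
  have oW : IsOpen W := (hO.preimage hφ.continuous).inter (isOpen_lt continuous_const
    Complex.continuous_re)
  have oW' : IsOpen (W ∩ {z | z.re < 1}) :=
    oW.inter (isOpen_lt Complex.continuous_re continuous_const)
  obtain ⟨r, hr, hrW⟩ := Metric.isOpen_iff.1 oW (1 : ℂ)
    ⟨by simpa using hI 1 ⟨one_pos, le_rfl⟩, by simp⟩
  obtain ⟨N, oN, hNW, heN, -, cN1, cN2, -, -⟩ := exists_strip (e := Ioo (0 : ℝ) 1)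
    isPreconnected_Ioo oW' (fun t ht ↦ ⟨⟨hI t ⟨ht.1, ht.2.le⟩, by simpa using ht.1⟩, by simpa using
      ht.2⟩)
  set S : Set ℂ := Metric.ball 1 r \ {z | z.im = 0 ∧ z.re ≤ 1} with hS
  -- the slit disc at the free end
  have cS : IsPreconnected S := by
    have : StarConvex ℝ (1 + (r / 2 : ℝ) : ℂ) S := by
      intro z hz a b ha hb hab
      refine ⟨(convex_ball (1 : ℂ) r) (by simp [abs_of_pos hr, hr]) hz.1 ha hb hab, ?_⟩
      rintro ⟨him, hre⟩
      have h2 := hz.2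
      simp only [mem_ofPred_eq, not_and, not_le] at h2
      simp at him hre
      rcases him with rfl | him
      · simp at hab; subst hab; simp at hre; linarith
      · have := h2 him
        rcases ha.eq_or_lt with rfl | ha
        · simp at hab; subst hab; simp at hre; linarith
        · nlinarith [mul_pos ha hr, mul_nonneg hb (sub_nonneg.2 this.le)]
    exact this.isPathConnected ⟨by simp [abs_of_pos hr, hr], fun h ↦ by
      have := h.2; simp at this; linarith⟩ |>.isConnected.isPreconnected
  have memS : ∀ σ : ℝ, σ ≠ 0 → ∃ z ∈ N ∩ S, 0 < σ * z.im := by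
    intro σ hσ
    have hc : Continuous fun t : ℝ ↦ ((1 - t : ℝ) : ℂ) := by fun_prop
    obtain ⟨t, ht1, ht2, ht0⟩ : ∃ t : ℝ, ((1 - t : ℝ) : ℂ) ∈ Metric.ball 1 r ∧ t < 1 ∧ 0 < t := by
      have h1 : ∀ᶠ t in 𝓝[>] (0:ℝ), ((1 - t : ℝ) : ℂ) ∈ Metric.ball 1 r :=
        nhdsWithin_le_nhds (hc.tendsto' 0 1 (by simp) (Metric.ball_mem_nhds _ hr))
      have h2 : ∀ᶠ t in 𝓝[>] (0:ℝ), t < 1 := nhdsWithin_le_nhds (gt_mem_nhds one_pos)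
      obtain ⟨t, h⟩ := (h1.and (h2.and self_mem_nhdsWithin)).exists
      exact ⟨t, h.1, h.2.1, h.2.2⟩
    have hN' : ((1 - t : ℝ) : ℂ) ∈ N ∩ Metric.ball 1 r := ⟨heN _ ⟨by linarith, by linarith⟩, ht1⟩
    have hc2 : Continuous fun ε : ℝ ↦ (((1 - t : ℝ) : ℂ) + (σ * ε : ℝ) * Complex.I : ℂ) := by
      fun_prop
    have h3 : ∀ᶠ ε in 𝓝[>] (0:ℝ), (((1 - t : ℝ) : ℂ) + (σ * ε : ℝ) * Complex.I : ℂ) ∈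
        N ∩ Metric.ball 1 r :=
      nhdsWithin_le_nhds (hc2.tendsto' 0 _ (by simp) ((oN.inter Metric.isOpen_ball).mem_nhds hN'))
    obtain ⟨ε, hε, hε0⟩ := (h3.and self_mem_nhdsWithin).exists
    have hε0 : 0 < ε := hε0
    refine ⟨_, ⟨hε.1, hε.2, ?_⟩, ?_⟩
    · rintro ⟨h, -⟩
      simp [hσ, hε0.ne'] at h
    · have := mul_pos (mul_self_pos.2 hσ) hε0
      simpa [mul_assoc] using this
  set M : Set ℂ := N ∪ Metric.ball 1 r with hM
  have hMW : M ⊆ W := union_subset (hNW.trans inter_subset_left) hrW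
  have hMJ : φ '' M \ J = φ '' (((N ∩ {z | 0 < z.im}) ∪ S) ∪ ((N ∩ {z | z.im < 0}) ∪ S)) := by
    rw [hJ, ← image_sdiff hφ.injective]
    congr 1
    ext z
    constructor
    · rintro ⟨hz, hzJ⟩
      have hz0 : 0 < z.re := (hMW hz).2
      have hne : z.im = 0 → 1 < z.re := by
        intro him
        by_contra! hle
        exact hzJ ⟨z.re, ⟨hz0.le, hle⟩, Complex.ext (by simp) (by simp [him])⟩
      rcases hz with hz | hz
      · rcases lt_trichotomy z.im 0 with h | h | h
        · exact Or.inr (Or.inl ⟨hz, h⟩)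
        · have := (hNW hz).2
          exact absurd this (not_lt.2 (hne h).le)
        · exact Or.inl (Or.inl ⟨hz, h⟩)
      · exact Or.inl (Or.inr ⟨hz, fun h ↦ absurd h.2 (not_le.2 (hne h.1))⟩)
    · have hJim : ∀ z ∈ (fun t : ℝ ↦ (t : ℂ)) '' Icc (0 : ℝ) 1, z.im = 0 ∧ z.re ≤ 1 := by
        rintro _ ⟨t, ht, rfl⟩
        simpa using ht.2
      rintro ((⟨h1, h2⟩ | h) | (⟨h1, h2⟩ | h))
      · exact ⟨Or.inl h1, fun hz ↦ h2.ne' (hJim z hz).1⟩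
      · exact ⟨Or.inr h.1, fun hz ↦ h.2 (hJim z hz)⟩
      · exact ⟨Or.inl h1, fun hz ↦ h2.ne (hJim z hz).1⟩
      · exact ⟨Or.inr h.1, fun hz ↦ h.2 (hJim z hz)⟩
  have hdiff : O \ J = O \ (J ∩ O) := by ext; simp
  have hMO : φ '' M ⊆ O := image_subset_iff.2 fun z hz ↦ (hMW hz).1
  have hd2 : φ '' M \ (J ∩ O) = φ '' M \ J := by
    ext z
    simp only [Set.mem_sdiff, mem_inter_iff, not_and]
    exact ⟨fun h ↦ ⟨h.1, fun hz ↦ h.2 hz (hMO h.1)⟩, fun h ↦ ⟨h.1, fun hz ↦ absurd hz h.2⟩⟩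
  obtain ⟨z₁, hz₁, hz₁'⟩ := memS 1 one_ne_zero
  obtain ⟨z₂, hz₂, hz₂'⟩ := memS (-1) (by norm_num)
  rw [hdiff]
  refine isPreconnected_diff_of_ring cO (hφ.isOpenMap M (oN.union Metric.isOpen_ball)) hMO ?_
    (hdiff ▸ hO.sdiff hcl) ?_
  · rintro _ ⟨⟨_, ⟨t, ht, rfl⟩, rfl⟩, hO'⟩
    refine mem_image_of_mem φ ?_
    rcases eq_or_lt_of_le ht.2 with h | h
    · right; simp [h, hr]
    · left
      refine heN t ⟨lt_of_le_of_ne ht.1 fun h ↦ h0 ?_, h⟩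
      rw [← h] at hO'
      simpa using hO'
  · rw [hd2, hMJ]
    refine IsPreconnected.image ?_ _ hφ.continuous.continuousOn
    refine IsPreconnected.union z₁ (Or.inr hz₁.2) (Or.inr hz₁.2) ?_ ?_
    · exact IsPreconnected.union z₁ ⟨hz₁.1, by simpa using hz₁'⟩ hz₁.2 cN1 cS
    · exact IsPreconnected.union z₂ ⟨hz₂.1, by simpa using hz₂'⟩ hz₂.2 cN2 cS

section Arcs

variable {T : Type*} [TopologicalSpace T]

theorem isPreconnected_diff_leaf [T2Space T] {O : Set T} (hO : IsOpen O) (cO : IsPreconnected O)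
    {φ : ℂ → T} (hφ : IsOpenEmbedding φ) {u v : ℂ} (huv : u ≠ v) (h0 : φ u ∉ O)
    (hI : ∀ z ∈ segment ℝ u v, z ≠ u → φ z ∈ O) : IsPreconnected (O \ φ '' segment ℝ u v) := by
  have hvu : v - u ≠ 0 := sub_ne_zero.2 huv.symm
  let e : ℂ ≃ₜ ℂ := (Homeomorph.mulLeft₀ (v - u) hvu).trans (Homeomorph.addLeft u)
  have he : ∀ z, e z = u + (v - u) * z := fun z ↦ rfl
  have hseg : segment ℝ u v = e '' ((fun t : ℝ ↦ (t : ℂ)) '' Icc 0 1) := by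
    rw [segment_eq_image', image_image]
    refine image_congr fun t _ ↦ ?_
    simp [he, mul_comm]
  have hcl : IsClosed ((φ ∘ e) '' ((fun t : ℝ ↦ (t : ℂ)) '' Icc 0 1)) :=
    ((isCompact_Icc.image Complex.continuous_ofReal).image
      (hφ.continuous.comp e.continuous)).isClosed
  have := isPreconnected_diff_leaf_unit hO cO (hφ.comp e.isOpenEmbedding) (by simpa [he] using h0)
    (fun t ht ↦ hI _ (hseg ▸ mem_image_of_mem e (mem_image_of_mem _ ⟨ht.1.le, ht.2⟩)) (by
      simp [he, hvu, ht.1.ne'])) hcl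
  rwa [image_comp, ← hseg] at this

theorem isPreconnected_diff_point [T1Space T] {O : Set T} (hO : IsOpen O) (cO : IsPreconnected O)
    {φ : ℂ → T} (hφ : IsOpenEmbedding φ) (u : ℂ) : IsPreconnected (O \ {φ u}) := by
  by_cases hu : φ u ∈ O
  · obtain ⟨r, hr, hb⟩ := Metric.isOpen_iff.1 (hO.preimage hφ.continuous) u hu
    refine isPreconnected_diff_of_ring cO (hφ.isOpenMap _ Metric.isOpen_ball)
      (image_subset_iff.2 hb) (by simpa using ⟨u, by simp [hr], rfl⟩)
      (hO.sdiff isClosed_singleton) ?_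
    rw [← image_singleton, ← image_sdiff hφ.injective]
    refine IsPreconnected.image ?_ _ hφ.continuous.continuousOn
    have hd : Metric.ball u r \ {u} = (fun z ↦ u + Complex.exp z) '' {z | z.re < Real.log r} := by
      ext z
      simp only [Set.mem_sdiff, Metric.mem_ball, dist_eq_norm, mem_singleton_iff, mem_image,
        mem_ofPred_eq]
      constructor
      · rintro ⟨h1, h2⟩
        have h3 : z - u ≠ 0 := sub_ne_zero.2 h2
        refine ⟨Complex.log (z - u), ?_, by rw [Complex.exp_log h3]; ring⟩
        rw [Complex.log_re]
        exact Real.log_lt_log (norm_pos_iff.2 h3) h1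
      · rintro ⟨w, hw, rfl⟩
        refine ⟨?_, by simp [Complex.exp_ne_zero]⟩
        rw [add_sub_cancel_left, Complex.norm_exp]
        exact (Real.lt_log_iff_exp_lt hr).1 hw
    rw [hd]
    exact (convex_halfSpace_re_lt _).isPreconnected.image _ (by fun_prop)
  · rwa [sdiff_singleton_eq_self hu]

/-- `TameArc a x y`: the set `a` is a simple arc from `x` to `y` made of finitely many straight
segments in charts. -/
inductive TameArc : Set T → T → T → Prop
  | nil (φ : ℂ → T) (hφ : IsOpenEmbedding φ) (u : ℂ) : TameArc {φ u} (φ u) (φ u)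
  | cons {a : Set T} {x : T} (φ : ℂ → T) (hφ : IsOpenEmbedding φ) (u v : ℂ) (huv : u ≠ v)
      (ha : TameArc a x (φ u)) (hi : a ∩ φ '' segment ℝ u v ⊆ {φ u}) :
      TameArc (a ∪ φ '' segment ℝ u v) x (φ v)

namespace TameArc

variable {a b : Set T} {x y z : T}

theorem isCompact (h : TameArc a x y) : IsCompact a := by
  induction h with
  | nil => exact isCompact_singleton
  | cons φ hφ u v huv ha hi ih => 
    refine ih.union (IsCompact.image ?_ hφ.continuous)
    rw [segment_eq_image']
    exact isCompact_Icc.image (by fun_prop)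

theorem left_mem (h : TameArc a x y) : x ∈ a := by
  induction h with
  | nil => rfl
  | cons φ hφ u v huv ha hi ih => exact Or.inl ih

theorem right_mem (h : TameArc a x y) : y ∈ a := by
  cases h with
  | nil => rfl
  | cons φ hφ u v huv ha hi => exact Or.inr ⟨v, right_mem_segment ℝ u v, rfl⟩

theorem isPreconnected_diff [T2Space T] (h : TameArc a x y) {U : Set T} (hU : IsOpen U)
    (cU : IsPreconnected U) (haU : a ⊆ U) : IsPreconnected (U \ a) := by
  induction h with
  | nil φ hφ u => exact isPreconnected_diff_point hU cU hφ u
  | @cons a x φ hφ u v huv ha hi ih =>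
    rw [← sdiff_sdiff]
    refine isPreconnected_diff_leaf (hU.sdiff ha.isCompact.isClosed)
      (ih (subset_union_left.trans haU)) hφ huv (fun h ↦ h.2 ha.right_mem) fun z hz hzu ↦ ?_
    exact ⟨haU (Or.inr ⟨z, hz, rfl⟩), fun hza ↦ hzu (hφ.injective (hi ⟨hza, z, hz, rfl⟩))⟩

theorem segment (φ : ℂ → T) (hφ : IsOpenEmbedding φ) {u v : ℂ} (huv : u ≠ v) :
    TameArc (φ '' segment ℝ u v) (φ u) (φ v) := by
  have := TameArc.cons φ hφ u v huv (.nil φ hφ u) inter_subset_left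
  rwa [union_eq_right.2] at this
  simpa using ⟨u, left_mem_segment ℝ u v, rfl⟩

theorem append (h₁ : TameArc a x y) (h₂ : TameArc b y z) (hab : a ∩ b ⊆ {y}) :
    TameArc (a ∪ b) x z := by
  induction h₂ with
  | nil φ hφ u =>
    rwa [union_eq_left.2]
    simpa using h₁.right_mem
  | @cons b y φ hφ u v huv hb hi ih =>
    rw [← union_assoc]
    refine .cons φ hφ u v huv (ih h₁ fun w hw ↦ hab ⟨hw.1, Or.inl hw.2⟩) ?_
    rintro w ⟨hw | hw, hw'⟩
    · have : w = y := hab ⟨hw, Or.inr hw'⟩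
      exact hi ⟨this ▸ hb.left_mem, hw'⟩
    · exact hi ⟨hw, hw'⟩

theorem symm (h : TameArc a x y) : TameArc a y x := by
  induction h with
  | nil φ hφ u => exact .nil φ hφ u
  | @cons a x φ hφ u v huv ha hi ih =>
    rw [union_comm]
    refine append (y := φ u) ?_ ih (by rwa [inter_comm])
    rw [segment_symm]
    exact segment φ hφ huv.symm

/-- First point of a straight segment in a closed set. -/
theorem _root_.exists_first_mem_segment {F : Set ℂ} (hF : IsClosed F) {u v : ℂ}
    (h : (_root_.segment ℝ u v ∩ F).Nonempty) :
    ∃ w ∈ F, w ∈ _root_.segment ℝ u v ∧ _root_.segment ℝ u w ∩ F ⊆ {w} := by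
  let e : ℝ → ℂ := fun t ↦ u + t • (v - u)
  have he : Continuous e := by fun_prop
  have hc : IsCompact (Icc (0 : ℝ) 1 ∩ e ⁻¹' F) := isCompact_Icc.inter_right (hF.preimage he)
  have hne : (Icc (0 : ℝ) 1 ∩ e ⁻¹' F).Nonempty := by
    obtain ⟨w, hw, hwF⟩ := h
    rw [segment_eq_image'] at hw
    obtain ⟨t, ht, rfl⟩ := hw
    exact ⟨t, ht, hwF⟩
  obtain ⟨t, ⟨ht, htF⟩, hmin⟩ := hc.exists_isLeast hne
  refine ⟨e t, htF, by rw [segment_eq_image']; exact ⟨t, ht, rfl⟩, ?_⟩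
  rintro w ⟨hw, hwF⟩
  rw [segment_eq_image'] at hw
  obtain ⟨s, hs, rfl⟩ := hw
  have h1 : u + s • (e t - u) = e (s * t) := by simp [e, mul_assoc]
  simp only [h1] at hwF ⊢
  have h2 : t ≤ s * t := hmin ⟨⟨mul_nonneg hs.1 ht.1, mul_le_one₀ hs.2 ht.1 ht.2⟩, hwF⟩
  have h3 : s * t = t := le_antisymm (mul_le_of_le_one_left ht.1 hs.2) h2
  rw [h3]; rfl

theorem exists_truncate (h : TameArc a x y) {F : Set T} (hF : IsClosed F) (hne : (a ∩ F).Nonempty) :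
    ∃ a' y', TameArc a' x y' ∧ a' ⊆ a ∧ y' ∈ F ∧ a' ∩ F ⊆ {y'} := by
  induction h with
  | nil φ hφ u =>
    obtain ⟨w, rfl, hw⟩ := hne
    exact ⟨_, _, .nil φ hφ u, Subset.rfl, hw, inter_subset_left⟩
  | @cons a x φ hφ u v huv ha hi ih =>
    by_cases h : (a ∩ F).Nonempty
    · obtain ⟨a', y', h1, h2, h3⟩ := ih h
      exact ⟨a', y', h1, h2.trans subset_union_left, h3⟩
    · rw [not_nonempty_iff_eq_empty] at h
      have hne' : (_root_.segment ℝ u v ∩ φ ⁻¹' F).Nonempty := by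
        obtain ⟨w, hw | hw, hwF⟩ := hne
        · exact absurd (h ▸ ⟨hw, hwF⟩ : w ∈ (∅ : Set T)) (notMem_empty w)
        · obtain ⟨t, ht, rfl⟩ := hw
          exact ⟨t, ht, hwF⟩
      obtain ⟨w, hwF, hw, hw'⟩ := exists_first_mem_segment (hF.preimage hφ.continuous) hne'
      have hwu : u ≠ w := by
        rintro rfl
        exact absurd (h ▸ ⟨ha.right_mem, hwF⟩ : φ u ∈ (∅ : Set T)) (notMem_empty _)
      have hsub : _root_.segment ℝ u w ⊆ _root_.segment ℝ u v :=
        (convex_segment u v).segment_subset (left_mem_segment ℝ u v) hw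
      refine ⟨_, _, .cons φ hφ u w hwu ha ((inter_subset_inter_right _ (image_mono hsub)).trans hi),
        union_subset_union_right _ (image_mono hsub), hwF, ?_⟩
      rintro q ⟨hq | ⟨t, ht, rfl⟩, hqF⟩
      · exact absurd (h ▸ ⟨hq, hqF⟩ : q ∈ (∅ : Set T)) (notMem_empty q)
      · exact congrArg φ (hw' ⟨ht, hqF⟩)

/-- Inside a chart, an arc can be redirected to any point of a convex set around its end point. -/
theorem exists_redirect [T2Space T] (h : TameArc a x y) {φ : ℂ → T} (hφ : IsOpenEmbedding φ)
    {B : Set ℂ} (hB : Convex ℝ B) (hy : y ∈ φ '' B) (hz : z ∈ φ '' B) :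
    ∃ a', TameArc a' x z ∧ a' ⊆ a ∪ φ '' B := by
  obtain ⟨v, hv, rfl⟩ := hy
  obtain ⟨u, hu, rfl⟩ := hz
  obtain ⟨w, hwa, hw, hw'⟩ := exists_first_mem_segment (u := u) (v := v)
    (h.isCompact.isClosed.preimage hφ.continuous) ⟨v, right_mem_segment ℝ u v, h.right_mem⟩
  obtain ⟨a', y', h', ha', hy', -⟩ := h.exists_truncate (F := {φ w}) isClosed_singleton
    ⟨_, hwa, rfl⟩
  obtain rfl : y' = φ w := hy'
  by_cases hwu : w = u
  · subst hwu
    exact ⟨a', h', ha'.trans subset_union_left⟩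
  · refine ⟨_, .cons φ hφ w u hwu h' ?_, union_subset_union ha' (image_mono ?_)⟩
    · rintro q ⟨hq, t, ht, rfl⟩
      rw [segment_symm] at ht
      exact congrArg φ (hw' ⟨ht, ha' hq⟩)
    · exact hB.segment_subset (hB.segment_subset hu hv hw) hu

theorem _root_.exists_tameArc [T2Space T] {Ω : Set T} (hΩ : IsOpen Ω) (cΩ : IsPreconnected Ω)
    (hch : ∀ x ∈ Ω, ∃ φ : ℂ → T, IsOpenEmbedding φ ∧ φ 0 = x) (hx : x ∈ Ω) (hy : y ∈ Ω) :
    ∃ a, TameArc a x y ∧ a ⊆ Ω := by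
  have loc : ∀ q ∈ Ω, ∃ N ∈ 𝓝 q, ∀ s ∈ N, ∀ t ∈ N,
      (∃ a, TameArc a x s ∧ a ⊆ Ω) → ∃ a, TameArc a x t ∧ a ⊆ Ω := by
    intro q hq
    obtain ⟨φ, hφ, rfl⟩ := hch q hq
    obtain ⟨r, hr, hb⟩ := Metric.isOpen_iff.1 (hΩ.preimage hφ.continuous) 0 hq
    refine ⟨φ '' Metric.ball 0 r, (hφ.isOpenMap _ Metric.isOpen_ball).mem_nhds
      ⟨0, by simp [hr], rfl⟩, fun s hs t ht ⟨a, h, ha⟩ ↦ ?_⟩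
    obtain ⟨a', h', ha'⟩ := h.exists_redirect hφ (convex_ball 0 r) hs ht
    exact ⟨a', h', ha'.trans (union_subset ha (image_subset_iff.2 hb))⟩
  let R : T → T → Prop := fun s t ↦ (∃ a, TameArc a x s ∧ a ⊆ Ω) ↔ ∃ a, TameArc a x t ∧ a ⊆ Ω
  have : R x y := by
    refine cΩ.induction₂ R ?_ (fun _ _ _ _ _ _ h1 h2 ↦ h1.trans h2) (fun _ _ _ _ h ↦ h.symm) hx hy
    intro q hq
    obtain ⟨N, hN, h⟩ := loc q hq
    filter_upwards [nhdsWithin_le_nhds hN] with t ht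
    exact ⟨h q (mem_of_mem_nhds hN) t ht, h t ht q (mem_of_mem_nhds hN)⟩
  obtain ⟨φ, hφ, rfl⟩ := hch x hx
  exact this.1 ⟨_, .nil φ hφ 0, by simpa using hx⟩

theorem _root_.exists_join {f g : ℝ → T} (hf : ContinuousOn f (Icc 0 1))
    (hg : ContinuousOn g (Icc 0 1)) (hfg : f 1 = g 0) : ∃ k : ℝ → T, ContinuousOn k (Icc 0 1) ∧
      (∀ t ∈ Icc (0 : ℝ) (1 / 2), k t = f (2 * t)) ∧
      (∀ t ∈ Icc (1 / 2 : ℝ) 1, k t = g (2 * t - 1)) ∧ k '' Icc 0 1 = f '' Icc 0 1 ∪ g '' Icc 0 1 :=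
        by
  let k : ℝ → T := fun t ↦ if t ≤ 1 / 2 then f (2 * t) else g (2 * t - 1)
  have h1 : ∀ t ∈ Icc (0 : ℝ) (1 / 2), k t = f (2 * t) := fun t ht ↦ if_pos ht.2
  have h2 : ∀ t ∈ Icc (1 / 2 : ℝ) 1, k t = g (2 * t - 1) := by
    intro t ht
    rcases eq_or_lt_of_le ht.1 with h | h
    · subst h
      simp only [k, le_refl, if_true]
      norm_num [hfg]
    · exact if_neg (not_le.2 h)
  have hI : Icc (0 : ℝ) 1 = Icc 0 (1 / 2) ∪ Icc (1 / 2) 1 :=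
    (Icc_union_Icc_eq_Icc (by norm_num) (by norm_num)).symm
  refine ⟨k, ?_, h1, h2, ?_⟩
  · rw [hI]
    refine ContinuousOn.union_of_isClosed ?_ ?_ isClosed_Icc isClosed_Icc
    · refine ContinuousOn.congr ?_ h1
      exact hf.comp (by fun_prop) fun t ht ↦ ⟨by linarith [ht.1], by linarith [ht.2]⟩
    · refine ContinuousOn.congr ?_ h2
      exact hg.comp (by fun_prop) fun t ht ↦ ⟨by linarith [ht.1], by linarith [ht.2]⟩
  · rw [hI, image_union, image_congr h1, image_congr h2, ← hI]
    congr 1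
    · rw [← image_image f (fun t : ℝ ↦ 2 * t), image_mul_left_Icc (by norm_num) (by norm_num)]
      norm_num
    · have : (fun t : ℝ ↦ 2 * t - 1) '' Icc (1 / 2) 1 = Icc 0 1 := by
        rw [← image_image (fun t : ℝ ↦ t - 1) (fun t : ℝ ↦ 2 * t),
          image_mul_left_Icc (by norm_num) (by norm_num), image_sub_const_Icc]
        norm_num
      rw [← image_image g, this]

theorem _root_.exists_param_segment {φ : ℂ → T} (hφ : IsOpenEmbedding φ) {u v : ℂ} (huv : u ≠ v) :
    ∃ f : ℝ → T, ContinuousOn f (Icc 0 1) ∧ InjOn f (Icc 0 1) ∧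
      f '' Icc 0 1 = φ '' _root_.segment ℝ u v ∧ f 0 = φ u ∧ f 1 = φ v := by
  refine ⟨fun t ↦ φ (u + t • (v - u)), ?_, ?_, ?_, by simp, by simp⟩
  · exact (hφ.continuous.comp (by fun_prop)).continuousOn
  · intro s _ t _ h
    have h1 := hφ.injective h
    have h2 : v - u ≠ 0 := sub_ne_zero.2 huv.symm
    simpa [h2] using h1
  · rw [segment_eq_image', image_image]

theorem exists_param_aux (h : TameArc a x y) : a = {x} ∨ ∃ f : ℝ → T,
    ContinuousOn f (Icc 0 1) ∧ InjOn f (Icc 0 1) ∧ f '' Icc 0 1 = a ∧ f 0 = x ∧ f 1 = y := by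
  induction h with
  | nil => exact Or.inl rfl
  | @cons a x φ hφ u v huv ha hi ih =>
    right
    obtain ⟨g, hgc, hgi, hg, hg0, hg1⟩ := exists_param_segment hφ huv
    rcases ih with rfl | ⟨f, hfc, hfi, hf, hf0, hf1⟩
    · obtain rfl : φ u = x := ha.right_mem
      refine ⟨g, hgc, hgi, ?_, hg0, hg1⟩
      rw [hg, union_eq_right.2]
      simpa using ⟨u, left_mem_segment ℝ u v, rfl⟩
    · obtain ⟨k, hkc, hk1, hk2, hk⟩ := exists_join hfc hgc (hf1.trans hg0.symm)
      have key : ∀ s ∈ Icc (0 : ℝ) 1, ∀ t ∈ Icc (0 : ℝ) 1, f s = g t → s = 1 ∧ t = 0 := by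
        intro s hs t ht hst
        have : f s = φ u := hi ⟨hf ▸ ⟨s, hs, rfl⟩, hst ▸ hg ▸ ⟨t, ht, rfl⟩⟩
        exact ⟨hfi hs ⟨zero_le_one, le_rfl⟩ (this.trans hf1.symm),
          hgi ht ⟨le_rfl, zero_le_one⟩ (hst.symm.trans (this.trans hg0.symm))⟩
      refine ⟨k, hkc, ?_, by rw [hk, hf, hg], ?_, ?_⟩
      · intro s hs t ht hst
        rcases le_total s (1 / 2) with h1 | h1 <;> rcases le_total t (1 / 2) with h2 | h2
        · rw [hk1 s ⟨hs.1, h1⟩, hk1 t ⟨ht.1, h2⟩] at hst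
          have := hfi ⟨by linarith [hs.1], by linarith⟩ ⟨by linarith [ht.1], by linarith⟩ hst
          linarith
        · rw [hk1 s ⟨hs.1, h1⟩, hk2 t ⟨h2, ht.2⟩] at hst
          have := key _ ⟨by linarith [hs.1], by linarith⟩ _ ⟨by linarith, by linarith [ht.2]⟩ hst
          linarith
        · rw [hk2 s ⟨h1, hs.2⟩, hk1 t ⟨ht.1, h2⟩] at hst
          have := key _ ⟨by linarith [ht.1], by linarith⟩ _ ⟨by linarith, by linarith [hs.2]⟩
            hst.symm
          linarith
        · rw [hk2 s ⟨h1, hs.2⟩, hk2 t ⟨h2, ht.2⟩] at hst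
          have := hgi ⟨by linarith, by linarith [hs.2]⟩ ⟨by linarith, by linarith [ht.2]⟩ hst
          linarith
      · rw [hk1 0 (by norm_num)]; simpa using hf0
      · rw [hk2 1 (by norm_num)]; norm_num [hg1]

theorem exists_param (h : TameArc a x y) (hxy : x ≠ y) : ∃ f : ℝ → T, ContinuousOn f (Icc 0 1) ∧
    InjOn f (Icc 0 1) ∧ f '' Icc 0 1 = a ∧ f 0 = x ∧ f 1 = y := by
  refine h.exists_param_aux.resolve_left fun ha ↦ hxy ?_
  have := h.right_mem
  rw [ha] at this
  exact this.symm

end TameArc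

theorem exists_circle_param {f : ℝ → T} (hf : ContinuousOn f (Icc 0 1)) (h01 : f 0 = f 1)
    (hi : InjOn f (Ico 0 1)) : ∃ F : C(Circle1, T), Function.Injective F ∧
      range F = f '' Icc 0 1 := by
  let F : Circle1 → T := AddCircle.liftIco 1 0 f
  have hF : ∀ t ∈ Ico (0 : ℝ) 1, F t = f t := fun t ht ↦
    AddCircle.liftIco_coe_apply (by simpa using ht)
  have hsurj : ∀ q : Circle1, ∃ t ∈ Ico (0 : ℝ) 1, (t : Circle1) = q := by
    intro q
    obtain ⟨t, ht, h⟩ := AddCircle.coe_image_Ico_eq (1 : ℝ) 0 ▸ mem_univ q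
    exact ⟨t, by simpa using ht, h⟩
  refine ⟨⟨F, AddCircle.liftIco_continuous (by simpa using h01) (by simpa using hf)⟩, ?_, ?_⟩
  · intro q q' h
    obtain ⟨s, hs, rfl⟩ := hsurj q
    obtain ⟨t, ht, rfl⟩ := hsurj q'
    have h : F s = F t := h
    rw [hF s hs, hF t ht] at h
    rw [hi hs ht h]
  · ext w
    constructor
    · rintro ⟨q, rfl⟩
      obtain ⟨s, hs, rfl⟩ := hsurj q
      exact ⟨s, Ico_subset_Icc_self hs, (hF s hs).symm⟩
    · rintro ⟨t, ht, rfl⟩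
      rcases eq_or_lt_of_le ht.2 with h | h
      · refine ⟨((0 : ℝ) : Circle1), (hF 0 (by norm_num)).trans ?_⟩
        rw [h, h01]
      · exact ⟨t, hF t ⟨ht.1, h⟩⟩

theorem TameArc.exists_circle_param {a : Set T} {x y : T} (h : TameArc a x y) {φ : ℂ → T}
    (hφ : IsOpenEmbedding φ) {u v : ℂ} (huv : u ≠ v) (hu : φ u = y) (hv : φ v = x)
    (hi : a ∩ φ '' _root_.segment ℝ u v ⊆ {φ u, φ v}) :
    ∃ F : C(Circle1, T), Function.Injective F ∧ range F = a ∪ φ '' _root_.segment ℝ u v := by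
  obtain ⟨g, hgc, hgi, hg, hg0, hg1⟩ := exists_param_segment hφ huv
  obtain ⟨f, hfc, hfi, hf, hf0, hf1⟩ := h.exists_param (by
    rintro rfl; exact huv (hφ.injective (hu.trans hv.symm)))
  obtain ⟨k, hkc, hk1, hk2, hk⟩ := exists_join hfc hgc (by rw [hf1, hg0, hu])
  rw [← hf, ← hg, ← hk]
  have key : ∀ s ∈ Icc (0 : ℝ) 1, ∀ t ∈ Icc (0 : ℝ) 1, f s = g t →
      (s = 1 ∧ t = 0) ∨ t = 1 := by
    intro s hs t ht hst
    have hm : f s ∈ ({φ u, φ v} : Set T) := hi ⟨hf ▸ ⟨s, hs, rfl⟩, hst ▸ hg ▸ ⟨t, ht, rfl⟩⟩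
    rcases hm with h | h
    · exact Or.inl ⟨hfi hs ⟨zero_le_one, le_rfl⟩ (h.trans (by rw [hf1, hu])),
          hgi ht ⟨le_rfl, zero_le_one⟩ (hst.symm.trans (h.trans hg0.symm))⟩
    · exact Or.inr (hgi ht ⟨zero_le_one, le_rfl⟩ (hst.symm.trans (h.trans hg1.symm)))
  refine _root_.exists_circle_param hkc ?_ ?_
  · rw [hk1 0 (by norm_num), hk2 1 (by norm_num)]
    norm_num [hf0, hg1, hv]
  · intro s hs t ht hst
    have hs2 := hs.2
    have ht2 := ht.2
    rcases le_total s (1 / 2) with h1 | h1 <;> rcases le_total t (1 / 2) with h2 | h2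
    · rw [hk1 s ⟨hs.1, h1⟩, hk1 t ⟨ht.1, h2⟩] at hst
      have := hfi ⟨by linarith [hs.1], by linarith⟩ ⟨by linarith [ht.1], by linarith⟩ hst
      linarith
    · rw [hk1 s ⟨hs.1, h1⟩, hk2 t ⟨h2, ht.2.le⟩] at hst
      rcases key _ ⟨by linarith [hs.1], by linarith⟩ _ ⟨by linarith, by linarith [ht.2]⟩ hst
        with h | h <;> linarith
    · rw [hk2 s ⟨h1, hs.2.le⟩, hk1 t ⟨ht.1, h2⟩] at hst
      rcases key _ ⟨by linarith [ht.1], by linarith⟩ _ ⟨by linarith, by linarith [hs.2]⟩ hst.symm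
        with h | h <;> linarith
    · rw [hk2 s ⟨h1, hs.2.le⟩, hk2 t ⟨h2, ht.2.le⟩] at hst
      have := hgi ⟨by linarith, by linarith [hs.2]⟩ ⟨by linarith, by linarith [ht.2]⟩ hst
      linarith

end Arcs

theorem exists_arc_across {T : Type*} [TopologicalSpace T] [T2Space T] {Ω : Set T} (hΩ : IsOpen Ω)
    (cΩ : IsPreconnected Ω) (hch : ∀ x ∈ Ω, ∃ φ : ℂ → T, IsOpenEmbedding φ ∧ φ 0 = x)
    {φ : ℂ → T} (hφ : IsOpenEmbedding φ) (h1 : φ 1 ∉ Ω)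
    (hr : ∀ᶠ r : ℝ in 𝓝[≠] 1, φ r ∈ Ω) : ∃ (a : Set T) (s t : ℝ), 0 < s ∧ s < 1 ∧ 1 < t ∧
      TameArc a (φ t) (φ s) ∧ a ⊆ Ω ∧ (∀ r ∈ Icc s t, r ≠ 1 → φ r ∈ Ω) ∧
      ∀ r ∈ Ioo s t, φ r ∉ a := by
  obtain ⟨ε, hε, hb⟩ : ∃ ε > 0, ∀ r : ℝ, |r - 1| < ε → r ≠ 1 → φ r ∈ Ω := by
    rw [eventually_nhdsWithin_iff, Metric.eventually_nhds_iff] at hr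
    obtain ⟨ε, hε, h⟩ := hr
    exact ⟨ε, hε, fun r hr hr1 ↦ h (by rwa [Real.dist_eq]) hr1⟩
  obtain ⟨δ, hδ0, hδε, hδ1⟩ : ∃ δ > 0, δ < ε ∧ δ < 1 :=
    ⟨min ε 1 / 2, by positivity, by linarith [min_le_left ε 1, lt_min hε one_pos],
      by linarith [min_le_right ε 1]⟩
  have hIcc : ∀ r ∈ Icc (1 - δ) (1 + δ), r ≠ 1 → φ r ∈ Ω := fun r hr ↦
    hb r (by rw [abs_lt]; constructor <;> linarith [hr.1, hr.2])
  have hc : Continuous fun r : ℝ ↦ φ r := hφ.continuous.comp Complex.continuous_ofReal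
  have hcl : ∀ s t : ℝ, IsClosed ((fun r : ℝ ↦ φ r) '' Icc s t) := fun s t ↦
    (isCompact_Icc.image hc).isClosed
  obtain ⟨a₀, h₀, ha₀⟩ := exists_tameArc hΩ cΩ hch (x := φ (1 - δ : ℝ)) (y := φ (1 + δ : ℝ))
    (hIcc _ ⟨le_rfl, by linarith⟩ (by linarith)) (hIcc _ ⟨by linarith, le_rfl⟩ (by linarith))
  obtain ⟨a₁, _, h₁, ha₁, ⟨t, ht, rfl⟩, hi₁⟩ := h₀.exists_truncate (hcl 1 (1 + δ))
    ⟨_, h₀.right_mem, 1 + δ, ⟨by linarith, le_rfl⟩, rfl⟩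
  obtain ⟨a, _, h₂, ha, ⟨s, hs, rfl⟩, hi⟩ := h₁.symm.exists_truncate (hcl (1 - δ) 1)
    ⟨_, h₁.left_mem, 1 - δ, ⟨le_rfl, by linarith⟩, rfl⟩
  have haΩ : a ⊆ Ω := ha.trans (ha₁.trans ha₀)
  have hinj : ∀ r q : ℝ, φ r = φ q → r = q := fun r q h ↦ Complex.ofReal_injective (hφ.injective h)
  have hs1 : s ≠ 1 := by
    rintro rfl
    exact h1 (by simpa using haΩ h₂.right_mem)
  have ht1 : t ≠ 1 := by
    rintro rfl
    exact h1 (by simpa using haΩ h₂.left_mem)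
  refine ⟨a, s, t, by linarith [hs.1], lt_of_le_of_ne hs.2 hs1, lt_of_le_of_ne ht.1 ht1.symm, h₂,
    haΩ, fun r hr ↦ hIcc r ⟨hs.1.trans hr.1, hr.2.trans ht.2⟩, fun r hr hra ↦ ?_⟩
  rcases le_total r 1 with h | h
  · exact hr.1.ne' (hinj _ _ (hi ⟨hra, r, ⟨hs.1.trans hr.1.le, h⟩, rfl⟩))
  · exact hr.2.ne (hinj _ _ (hi₁ ⟨ha hra, r, ⟨h, hr.2.le.trans ht.2⟩, rfl⟩))

/-- If every simple closed curve separates `U`, a connected open subset of `V`, where `U \ V` is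
connected, cannot reach a point of a circle from both sides while avoiding the arc of the circle
through this point. -/
theorem no_crossing {T : Type*} [TopologicalSpace T] [T2Space T] {U V Ω : Set T} (hU : IsOpen U)
    (cU : IsPreconnected U)
    (sep : ∀ F : C(Circle1, T), Function.Injective F → range F ⊆ U → ¬ IsPreconnected (U \ range F))
    (hch : ∀ x ∈ U, ∃ φ : ℂ → T, IsOpenEmbedding φ ∧ φ 0 = x)
    (hVU : V ⊆ U) (hY : IsPreconnected (U \ V)) (hΩ : IsOpen Ω) (cΩ : IsPreconnected Ω)
    (hΩV : Ω ⊆ V) {φ : ℂ → T} (hφ : IsOpenEmbedding φ) (hφU : range φ ⊆ U) (hz : φ 1 ∈ V)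
    (he : Disjoint (connectedComponentIn (V ∩ φ '' Metric.sphere 0 1) (φ 1)) Ω)
    (hr : ∀ᶠ r : ℝ in 𝓝[≠] 1, φ r ∈ Ω) : False := by
  have hzS : φ 1 ∈ V ∩ φ '' Metric.sphere 0 1 := ⟨hz, 1, by simp, rfl⟩
  have h1 : φ 1 ∉ Ω := disjoint_left.1 he (mem_connectedComponentIn hzS)
  obtain ⟨a, s, t, hs0, hs1, ht1, ha, haΩ, hst, hno⟩ := exists_arc_across hΩ cΩ
    (fun x hx ↦ hch x (hVU (hΩV hx))) hφ h1 hr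
  have hsegre : segment ℝ (s : ℂ) t = (fun r : ℝ ↦ (r : ℂ)) '' Icc s t := by
    rw [← segment_eq_Icc (hs1.trans ht1).le]
    exact (image_segment ℝ (Complex.ofRealLI.toLinearMap.toAffineMap) s t).symm
  set I := φ '' segment ℝ (s : ℂ) t with hI
  have hIV : I ⊆ V := by
    rintro _ ⟨w, hw, rfl⟩
    rw [hsegre] at hw
    obtain ⟨r, hr, rfl⟩ := hw
    by_cases h : r = 1
    · subst h; simpa using hz
    · exact hΩV (hst r hr h)
  have hst' : (s : ℂ) ≠ t := fun h ↦ (hs1.trans ht1).ne (Complex.ofReal_injective h)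
  obtain ⟨F, hF, hFr⟩ := ha.exists_circle_param hφ hst' rfl rfl (by
    rintro _ ⟨hw, w, hw', rfl⟩
    rw [hsegre] at hw'
    obtain ⟨r, hr, rfl⟩ := hw'
    rcases eq_or_lt_of_le hr.1 with rfl | h
    · exact Or.inl rfl
    rcases eq_or_lt_of_le hr.2 with rfl | h'
    · exact Or.inr rfl
    exact absurd hw (hno r ⟨h, h'⟩))
  set c := a ∪ I with hc
  have hcV : c ⊆ V := union_subset (haΩ.trans hΩV) hIV
  have hccl : IsClosed c := by
    rw [← hFr]; exact (isCompact_range F.continuous).isClosed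
  have hsep := sep F hF (by rw [hFr]; exact hcV.trans hVU)
  rw [hFr] at hsep
  obtain ⟨O₁, O₂, hO₁, hO₂, hO, hn₁, hn₂, hd⟩ : ∃ O₁ O₂ : Set T, IsOpen O₁ ∧ IsOpen O₂ ∧
      U \ c = O₁ ∪ O₂ ∧ O₁.Nonempty ∧ O₂.Nonempty ∧ Disjoint O₁ O₂ := by
    rw [IsPreconnected] at hsep
    push Not at hsep
    obtain ⟨u, v, hu, hv, hsub, h1, h2, h3⟩ := hsep
    refine ⟨(U \ c) ∩ u, (U \ c) ∩ v, (hU.sdiff hccl).inter hu, (hU.sdiff hccl).inter hv, ?_, h1,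
      h2, ?_⟩
    · rw [← inter_union_distrib_left, inter_eq_left.2 hsub]
    · rw [disjoint_left]
      rintro x ⟨hx, hxu⟩ ⟨-, hxv⟩
      exact notMem_empty x (h3 ▸ ⟨hx, hxu, hxv⟩)
  have hc₁ : ∀ O, O = O₁ ∨ O = O₂ → O ⊆ U \ c := by
    rintro O (rfl | rfl)
    · exact hO ▸ subset_union_left
    · exact hO ▸ subset_union_right
  have dich : ∀ {C : Set T}, IsPreconnected C → C ⊆ U \ c → C ⊆ O₁ ∨ C ⊆ O₂ := fun hC hCc ↦
    hC.subset_or_subset hO₁ hO₂ hd (hO ▸ hCc)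
  have cUa : IsPreconnected (U \ a) := ha.isPreconnected_diff hU cU (haΩ.trans (hΩV.trans hVU))
  set W : Set ℂ := φ ⁻¹' aᶜ ∩ {z | s < z.re} ∩ {z | z.re < t} with hW
  have oW : IsOpen W := ((ha.isCompact.isClosed.isOpen_compl.preimage hφ.continuous).inter
    (isOpen_lt continuous_const Complex.continuous_re)).inter
    (isOpen_lt Complex.continuous_re continuous_const)
  obtain ⟨N, oN, hNW, heN, -, cN1, cN2, -, -⟩ := exists_strip (e := Ioo s t)
    isPreconnected_Ioo oW (fun r hr ↦ ⟨⟨hno r hr, by simpa using hr.1⟩, by simpa using hr.2⟩)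
  have hNc : ∀ z ∈ N, z.im ≠ 0 → φ z ∈ U \ c := by
    refine fun z hz him ↦ ⟨hφU ⟨z, rfl⟩, ?_⟩
    rintro (h | ⟨w, hw, hwz⟩)
    · exact (hNW hz).1.1 h
    · rw [hsegre] at hw
      obtain ⟨r, hr, rfl⟩ := hw
      rw [← hφ.injective hwz] at him
      exact him (by simp)
  have hN0 : ∀ z ∈ N, z.im = 0 → φ z ∈ c := fun z hz him ↦ Or.inr ⟨z, by
    rw [hsegre]
    exact ⟨z.re, ⟨(hNW hz).1.2.le, (hNW hz).2.le⟩, Complex.ext (by simp) (by simp [him])⟩, rfl⟩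
  have d1 : φ '' (N ∩ {z | 0 < z.im}) ⊆ O₁ ∨ φ '' (N ∩ {z | 0 < z.im}) ⊆ O₂ :=
    dich (cN1.image _ hφ.continuous.continuousOn) (by
      rintro _ ⟨z, ⟨hz, h⟩, rfl⟩; exact hNc z hz (ne_of_gt h))
  have d2 : φ '' (N ∩ {z | z.im < 0}) ⊆ O₁ ∨ φ '' (N ∩ {z | z.im < 0}) ⊆ O₂ :=
    dich (cN2.image _ hφ.continuous.continuousOn) (by
      rintro _ ⟨z, ⟨hz, h⟩, rfl⟩; exact hNc z hz (ne_of_lt h))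
  -- the two sides of the segment lie in different parts
  have key : ∀ O O', O ∪ O' = U \ c → Disjoint O O' → IsOpen O → IsOpen O' → O'.Nonempty →
      φ '' (N ∩ {z | 0 < z.im}) ⊆ O → φ '' (N ∩ {z | z.im < 0}) ⊆ O → False := by
    intro O O' hu hdis oO oO' hn h₁ h₂
    have hN' : φ '' N ⊆ O ∪ c := by
      rintro _ ⟨z, hz, rfl⟩
      rcases lt_trichotomy z.im 0 with h | h | h
      · exact Or.inl (h₂ ⟨z, ⟨hz, h⟩, rfl⟩)
      · exact Or.inr (hN0 z hz h)
      · exact Or.inl (h₁ ⟨z, ⟨hz, h⟩, rfl⟩)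
    have hO'c : O' ⊆ U \ c := hu ▸ subset_union_right
    have hOc : O ⊆ U \ c := hu ▸ subset_union_left
    have hdis' : Disjoint (O ∪ φ '' N) O' := by
      refine disjoint_union_left.2 ⟨hdis, ?_⟩
      refine Disjoint.mono_left hN' (disjoint_union_left.2 ⟨hdis, ?_⟩)
      exact disjoint_left.2 fun x hx hx' ↦ (hO'c hx').2 hx
    have hsub : U \ a ⊆ (O ∪ φ '' N) ∪ O' := by
      rintro x ⟨hxU, hxa⟩
      by_cases hxI : x ∈ I
      · obtain ⟨w, hw, rfl⟩ := hxI
        rw [hsegre] at hw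
        obtain ⟨r, hr, rfl⟩ := hw
        refine Or.inl (Or.inr ⟨r, heN r ⟨lt_of_le_of_ne hr.1 ?_, lt_of_le_of_ne hr.2 ?_⟩, rfl⟩)
        · rintro rfl; exact hxa ha.right_mem
        · rintro rfl; exact hxa ha.left_mem
      · have : x ∈ O ∪ O' := hu ▸ ⟨hxU, fun h ↦ h.elim hxa hxI⟩
        exact this.elim (fun h ↦ Or.inl (Or.inl h)) Or.inr
    have h1N : φ 1 ∈ φ '' N := ⟨1, by simpa using heN 1 ⟨hs1, ht1⟩, rfl⟩
    have h1a : φ 1 ∈ U \ a := ⟨hVU hz, fun h ↦ h1 (haΩ h)⟩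
    obtain ⟨y, hy⟩ := hn
    have hya : y ∈ U \ a := ⟨(hO'c hy).1, fun h ↦ (hO'c hy).2 (Or.inl h)⟩
    rcases cUa.subset_or_subset (oO.union (hφ.isOpenMap N oN)) oO' hdis' hsub with h | h
    · exact disjoint_left.1 hdis' (h hya) hy
    · exact disjoint_left.1 hdis' (Or.inr h1N) (h h1a)
  -- one side lies in a part contained in `V`
  have main : ∀ S : Set T, (S = O₁ ∨ S = O₂) → S ⊆ V → ∀ σ : ℝ, |σ| = 1 →
      φ '' (N ∩ {z | 0 < σ * z.im}) ⊆ S → False := by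
    intro S hS hSV σ hσ hside
    have hσ0 : σ ≠ 0 := by rintro rfl; simp at hσ
    let ω : ℝ → ℂ := fun θ ↦ Complex.exp ((σ * θ : ℝ) * Complex.I)
    have cω : Continuous ω := by fun_prop
    have hω0 : ω 0 = 1 := by simp [ω]
    have nω : ∀ θ, ‖ω θ‖ = 1 := fun θ ↦ Complex.norm_exp_ofReal_mul_I _
    have hωim : ∀ θ, (ω θ).im = Real.sin (σ * θ) := fun θ ↦ Complex.exp_ofReal_mul_I_im _
    have hωre : ∀ θ, (ω θ).re = Real.cos (σ * θ) := fun θ ↦ Complex.exp_ofReal_mul_I_re _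
    have hωinj : ∀ θ ∈ Ioo 0 (2 * Real.pi), ω θ ≠ 1 := by
      intro θ hθ h
      have : Real.cos (σ * θ) = 1 := by rw [← hωre, h]; simp
      rw [← Real.cos_abs, abs_mul, hσ, one_mul, abs_of_pos hθ.1] at this
      rw [Real.cos_eq_one_iff_of_lt_of_lt (by linarith [hθ.1, Real.pi_pos]) hθ.2] at this
      exact hθ.1.ne' this
    have hsurj : ∀ w : ℂ, ‖w‖ = 1 → w ≠ 1 → ∃ θ ∈ Ioo 0 (2 * Real.pi), ω θ = w := by
      intro w hw hw1
      have hσσ : σ * σ = 1 := by rw [← abs_mul_abs_self, hσ, one_mul]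
      have hwa : Complex.exp (w.arg * Complex.I) = w := by
        have := Complex.norm_mul_exp_arg_mul_I w
        rwa [hw, Complex.ofReal_one, one_mul] at this
      have harg : σ * w.arg ≠ 0 := by
        intro h
        rcases mul_eq_zero.1 h with h | h
        · exact hσ0 h
        · rw [h] at hwa; simp at hwa; exact hw1 hwa.symm
      have hab : |σ * w.arg| ≤ Real.pi := by
        rw [abs_mul, hσ, one_mul]; exact Complex.abs_arg_le_pi w
      rw [abs_le] at hab
      rcases lt_or_gt_of_ne harg with h | h
      · refine ⟨σ * w.arg + 2 * Real.pi, ⟨by linarith [Real.pi_pos], by linarith⟩, ?_⟩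
        have h2 : σ * (σ * w.arg + 2 * Real.pi) = w.arg + σ * (2 * Real.pi) := by
          rw [mul_add, ← mul_assoc, hσσ, one_mul]
        simp only [ω]
        rw [h2]
        rcases eq_or_eq_neg_of_abs_eq hσ with rfl | rfl
        · push_cast
          rw [one_mul, add_mul, Complex.exp_add, hwa, Complex.exp_two_pi_mul_I, mul_one]
        · push_cast
          rw [add_mul, Complex.exp_add, hwa, neg_one_mul, neg_mul, Complex.exp_neg,
            Complex.exp_two_pi_mul_I, inv_one, mul_one]
      · refine ⟨σ * w.arg, ⟨h, by linarith [Real.pi_pos]⟩, ?_⟩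
        simp only [ω]
        rw [← mul_assoc, hσσ, one_mul, hwa]
    -- the arc meets the circle
    obtain ⟨θ₁, hθ₁, hθ₁a⟩ : ∃ θ ∈ Ioo 0 (2 * Real.pi), φ (ω θ) ∈ a := by
      have : (a ∩ φ '' Metric.sphere 0 1).Nonempty := by
        by_contra hne
        rw [not_nonempty_iff_eq_empty] at hne
        have ca : IsPreconnected a := by
          obtain ⟨f, hf, -, rfl, -⟩ := ha.exists_param fun h ↦ hst' (hφ.injective h).symm
          exact isPreconnected_Icc.image _ hf
        have o2 : IsOpen (φ '' Metric.closedBall 0 1)ᶜ :=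
          ((isCompact_closedBall (0 : ℂ) 1).image hφ.continuous).isClosed.isOpen_compl
        rcases ca.subset_or_subset (hφ.isOpenMap _ Metric.isOpen_ball) o2
          (u := φ '' Metric.ball 0 1)
          (disjoint_left.2 fun x hx hx' ↦ hx' (image_mono Metric.ball_subset_closedBall hx)) (by
            intro x hx
            by_cases h : x ∈ φ '' Metric.closedBall 0 1
            · obtain ⟨w, hw, rfl⟩ := h
              refine Or.inl ⟨w, ?_, rfl⟩
              rcases eq_or_lt_of_le (Metric.mem_closedBall.1 hw) with h | h
              · exact absurd (hne ▸ ⟨hx, w, h, rfl⟩ : φ w ∈ (∅ : Set T)) (notMem_empty _)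
              · exact h
            · exact Or.inr h) with h | h
        · obtain ⟨w, hw, hwt⟩ := h ha.left_mem
          rw [hφ.injective hwt, mem_ball_zero_iff, Complex.norm_real, Real.norm_eq_abs,
            abs_of_pos (by linarith)] at hw
          linarith
        · refine h ha.right_mem ⟨s, ?_, rfl⟩
          rw [mem_closedBall_zero_iff, Complex.norm_real, Real.norm_eq_abs, abs_of_pos hs0]
          exact hs1.le
      obtain ⟨_, hwa, w, hw, rfl⟩ := this
      obtain ⟨θ, hθ, rfl⟩ := hsurj w (by simpa using hw) (by
        rintro rfl; exact h1 (haΩ hwa))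
      exact ⟨θ, hθ, hwa⟩
    have hcl : IsCompact (Icc 0 θ₁ ∩ (fun θ ↦ φ (ω θ)) ⁻¹' a) :=
      isCompact_Icc.inter_right (ha.isCompact.isClosed.preimage (hφ.continuous.comp cω))
    obtain ⟨θ₀, ⟨hθ₀, hθ₀a⟩, hmin⟩ := hcl.exists_isLeast ⟨θ₁, ⟨hθ₁.1.le, le_rfl⟩, hθ₁a⟩
    have hθ₀a : φ (ω θ₀) ∈ a := hθ₀a
    have hθ₀pos : 0 < θ₀ := lt_of_le_of_ne hθ₀.1 fun h ↦ by
      rw [← h, hω0] at hθ₀a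
      exact h1 (haΩ hθ₀a)
    have hθ₀2 : θ₀ < 2 * Real.pi := hθ₀.2.trans_lt hθ₁.2
    have harc : (fun θ ↦ φ (ω θ)) '' Ioo 0 θ₀ ⊆ U \ c := by
      rintro _ ⟨θ, hθ, rfl⟩
      refine ⟨hφU ⟨_, rfl⟩, ?_⟩
      rintro (h | ⟨w, hw, hwθ⟩)
      · exact absurd (hmin ⟨⟨hθ.1.le, hθ.2.le.trans hθ₀.2⟩, h⟩) (not_le.2 hθ.2)
      · rw [hsegre] at hw
        obtain ⟨r, hr, rfl⟩ := hw
        have h3 : (r : ℂ) = ω θ := hφ.injective hwθ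
        have h4 : ‖(r : ℂ)‖ = 1 := by rw [h3]; exact nω θ
        rw [Complex.norm_real, Real.norm_eq_abs, abs_of_pos (hs0.trans_le hr.1)] at h4
        rw [h4, Complex.ofReal_one] at h3
        exact hωinj θ ⟨hθ.1, hθ.2.trans hθ₀2⟩ h3.symm
    have carc : IsPreconnected ((fun θ ↦ φ (ω θ)) '' Ioo 0 θ₀) :=
      isPreconnected_Ioo.image _ (hφ.continuous.comp cω).continuousOn
    obtain ⟨θ₂, hθ₂, hθ₂S⟩ : ∃ θ ∈ Ioo 0 θ₀, φ (ω θ) ∈ S := by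
      have e1 : ∀ᶠ θ in 𝓝[>] (0:ℝ), ω θ ∈ N := nhdsWithin_le_nhds
        (cω.tendsto' 0 1 hω0 (oN.mem_nhds (by simpa using heN 1 ⟨hs1, ht1⟩)))
      have e2 : ∀ᶠ θ in 𝓝[>] (0:ℝ), θ < min θ₀ Real.pi :=
        nhdsWithin_le_nhds (gt_mem_nhds (lt_min hθ₀pos Real.pi_pos))
      obtain ⟨θ, h⟩ := (e1.and (e2.and self_mem_nhdsWithin)).exists
      have hθ0 : 0 < θ := h.2.2
      refine ⟨θ, ⟨hθ0, h.2.1.trans_le (min_le_left _ _)⟩, hside ⟨_, ⟨h.1, ?_⟩, rfl⟩⟩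
      have hs : 0 < Real.sin θ := Real.sin_pos_of_pos_of_lt_pi hθ0
        (h.2.1.trans_le (min_le_right _ _))
      simp only [mem_ofPred_eq, hωim]
      rcases eq_or_eq_neg_of_abs_eq hσ with rfl | rfl
      · simpa using hs
      · simpa using hs
    have harcS : (fun θ ↦ φ (ω θ)) '' Ioo 0 θ₀ ⊆ S := by
      have hm : (fun θ ↦ φ (ω θ)) θ₂ ∈ (fun θ ↦ φ (ω θ)) '' Ioo 0 θ₀ := mem_image_of_mem _ hθ₂
      rcases hS with rfl | rfl
      · exact (dich carc harc).resolve_right fun h ↦ disjoint_left.1 hd hθ₂S (h hm)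
      · exact (dich carc harc).resolve_left fun h ↦ disjoint_left.1 hd (h hm) hθ₂S
    have hfull : (fun θ ↦ φ (ω θ)) '' Icc 0 θ₀ ⊆ V ∩ φ '' Metric.sphere 0 1 := by
      rintro _ ⟨θ, hθ, rfl⟩
      refine ⟨?_, ω θ, by simp [nω], rfl⟩
      rcases eq_or_lt_of_le hθ.1 with rfl | h
      · simpa [hω0] using hz
      rcases eq_or_lt_of_le hθ.2 with rfl | h'
      · exact hΩV (haΩ hθ₀a)
      · exact hSV (harcS ⟨θ, ⟨h, h'⟩, rfl⟩)
    have := (isPreconnected_Icc.image _ (hφ.continuous.comp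
      cω).continuousOn).subset_connectedComponentIn
      (x := φ 1) ⟨0, ⟨le_rfl, hθ₀.1⟩, by simp [hω0]⟩ hfull
    exact disjoint_left.1 he (this ⟨θ₀, ⟨hθ₀.1, le_rfl⟩, rfl⟩) (haΩ hθ₀a)
  have hYc : U \ V ⊆ U \ c := sdiff_subset_sdiff_right hcV
  have fin : ∀ S, (S = O₁ ∨ S = O₂) → S ⊆ V →
      φ '' (N ∩ {z | 0 < z.im}) ⊆ S ∨ φ '' (N ∩ {z | z.im < 0}) ⊆ S → False := by
    rintro S hS hSV (h | h)
    · exact main S hS hSV 1 (by simp) (by simpa using h)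
    · exact main S hS hSV (-1) (by simp) (by simpa using h)
  have hSV : ∀ S S', (S = O₁ ∨ S = O₂) → Disjoint S S' → U \ V ⊆ S' → S ⊆ V := by
    intro S S' hS hdis hYS x hx
    by_contra hxV
    exact disjoint_left.1 hdis hx (hYS ⟨(hc₁ S hS hx).1, hxV⟩)
  have both : (φ '' (N ∩ {z | 0 < z.im}) ⊆ O₁ ∧ φ '' (N ∩ {z | z.im < 0}) ⊆ O₂) ∨
      (φ '' (N ∩ {z | 0 < z.im}) ⊆ O₂ ∧ φ '' (N ∩ {z | z.im < 0}) ⊆ O₁) := by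
    rcases d1 with h | h <;> rcases d2 with h' | h'
    · exact (key O₁ O₂ hO.symm hd hO₁ hO₂ hn₂ h h').elim
    · exact Or.inl ⟨h, h'⟩
    · exact Or.inr ⟨h, h'⟩
    · exact (key O₂ O₁ (by rw [union_comm, hO]) hd.symm hO₂ hO₁ hn₁ h h').elim
  rcases dich hY hYc with h | h
  · refine fin O₂ (Or.inr rfl) (hSV O₂ O₁ (Or.inr rfl) hd.symm h) ?_
    rcases both with h | h
    · exact Or.inr h.2
    · exact Or.inl h.1
  · refine fin O₁ (Or.inl rfl) (hSV O₁ O₂ (Or.inl rfl) hd h) ?_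
    rcases both with h | h
    · exact Or.inl h.1
    · exact Or.inr h.2

theorem IsCoveringMap.exists_lift_openEmbedding {A T : Type*} [TopologicalSpace A]
    [TopologicalSpace T] {p : A → T} (hp : IsCoveringMap p) {φ : ℂ → T} (hφ : IsOpenEmbedding φ)
    {z : ℂ} {w : A} (hw : p w = φ z) :
    ∃ ψ : ℂ → A, IsOpenEmbedding ψ ∧ ψ z = w ∧ ∀ x, p (ψ x) = φ x := by
  obtain ⟨ψ, ⟨h1, h2⟩, -⟩ := hp.existsUnique_continuousMap_lifts ⟨φ, hφ.continuous⟩ z w hw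
  have h2' : p ∘ ψ = φ := h2
  refine ⟨ψ, IsLocalHomeomorph.isOpenEmbedding_of_injective
    (IsLocalHomeomorph.of_comp (g := p) (h2' ▸ hφ.isLocalHomeomorph) hp.isLocalHomeomorph
      ψ.continuous) (fun a b hab ↦ ?_), h1, congr_fun h2⟩
  apply hφ.injective
  rw [← h2', Function.comp_apply, Function.comp_apply, hab]

theorem IsCoveringMap.liftInj_range {A T : Type*} [TopologicalSpace A] [TopologicalSpace T]
    {p : A → T} (hp : IsCoveringMap p) {φ : ℂ → T} (hφ : IsOpenEmbedding φ) :
    LiftInj p (range φ) := by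
  intro C hC hCV
  rcases C.eq_empty_or_nonempty with rfl | ⟨w, hw⟩
  · exact injOn_empty _
  obtain ⟨z, hz⟩ := hCV hw
  obtain ⟨ψ, hψ, rfl, hpψ⟩ := hp.exists_lift_openEmbedding hφ hz.symm
  have hi : InjOn p (range ψ) := by
    rintro _ ⟨a, rfl⟩ _ ⟨b, rfl⟩ hab
    rw [hpψ, hpψ] at hab
    rw [hφ.injective hab]
  refine hi.mono (subset_of_sheet hp hψ.isOpen_range hi hC (fun x hx ↦ ?_) ⟨_, hw, z, rfl⟩)
  obtain ⟨y, hy⟩ := hCV hx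
  exact ⟨ψ y, ⟨y, rfl⟩, by rw [hpψ, hy]⟩

/-- A neighbourhood of a component of an open part of the unit circle. -/
theorem exists_circle_strip {V : Set ℂ} (hV : IsOpen V) (h1 : (1 : ℂ) ∈ V) :
    ∃ N : Set ℂ, IsOpen N ∧ N ⊆ V ∧ (1 : ℂ) ∈ N ∧ IsPreconnected N ∧
      IsPreconnected (N ∩ {z | ‖z‖ < 1}) ∧ IsPreconnected (N ∩ {z | 1 < ‖z‖}) ∧
      connectedComponentIn (V ∩ Metric.sphere 0 1) 1 ⊆ N ∧
      IsPreconnected (N ∩ Metric.sphere 0 1) := by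
  have : LocallyConnectedSpace Circle :=
    ChartedSpace.locallyConnectedSpace (EuclideanSpace ℝ (Fin 1)) Circle
  set ω : ℂ → ℂ := fun z ↦ Complex.exp (z * Complex.I) with hω
  have cω : Continuous ω := by fun_prop
  have nω : ∀ z, ‖ω z‖ = Real.exp (-z.im) := fun z ↦ by simp [hω, Complex.norm_exp]
  have oω : IsOpenMap ω := by
    have : IsOpenMap fun z : ℂ ↦ z * Complex.I :=
      (Homeomorph.mulRight₀ Complex.I Complex.I_ne_zero).isOpenMap
    have h2 : IsOpenMap Complex.exp := isOpenMap_iff_nhds_le.2 fun z ↦ by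
      have := (Complex.hasStrictDerivAt_exp z).map_nhds_eq (Complex.exp_ne_zero z)
      rw [this]
    exact h2.comp this
  set Vc : Set Circle := {z | (z : ℂ) ∈ V} with hVc
  have oVc : IsOpen Vc := hV.preimage continuous_subtype_val
  set E := connectedComponentIn Vc 1 with hE
  have oE : IsOpen E := oVc.connectedComponentIn
  have h1E : (1 : Circle) ∈ E := mem_connectedComponentIn (by simpa [hVc] using h1)
  set e := connectedComponentIn (Circle.exp ⁻¹' E) 0
  have h0e : (0 : ℝ) ∈ e := mem_connectedComponentIn (by simpa using h1E)
  have hee : ∀ t ∈ e, Circle.exp t ∈ E := fun t ht ↦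
    (connectedComponentIn_subset _ _ ht : t ∈ Circle.exp ⁻¹' E)
  have himg : Circle.exp '' e = E :=
    image_connectedComponentIn_preimage Circle.isCoveringMap_exp oE
      isPreconnected_connectedComponentIn (by simpa using h1E)
  obtain ⟨N, oN, hNW, heN, cN, cN1, cN2, cN0, -⟩ := exists_strip (e := e)
    isPreconnected_connectedComponentIn (hV.preimage cω) (fun t ht ↦ by
      have := connectedComponentIn_subset _ _ (hee t ht)
      simpa [hVc, hω] using this)
  have hlt : ω '' (N ∩ {z | 0 < z.im}) = ω '' N ∩ {z | ‖z‖ < 1} := by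
    rw [← image_inter_preimage]
    congr 2; ext z; simp [nω]
  have hgt : ω '' (N ∩ {z | z.im < 0}) = ω '' N ∩ {z | 1 < ‖z‖} := by
    rw [← image_inter_preimage]
    congr 2; ext z; simp [nω]
  have heq : ω '' (N ∩ {z | z.im = 0}) = ω '' N ∩ Metric.sphere 0 1 := by
    rw [← image_inter_preimage]
    congr 2; ext z; simp [nω]
  refine ⟨ω '' N, oω _ oN, image_subset_iff.2 hNW, ⟨0, by simpa using heN 0 h0e, by simp [hω]⟩,
    cN.image _ cω.continuousOn, hlt ▸ cN1.image _ cω.continuousOn,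
    hgt ▸ cN2.image _ cω.continuousOn, ?_, heq ▸ cN0.image _ cω.continuousOn⟩
  intro z hz
  set K := connectedComponentIn (V ∩ Metric.sphere 0 1) 1 with hK
  have hKs : K ⊆ V ∩ Metric.sphere 0 1 := connectedComponentIn_subset _ _
  have hpre : IsPreconnected ((fun w : Circle ↦ (w : ℂ)) ⁻¹' K) := by
    have hr : K ⊆ range (fun w : Circle ↦ (w : ℂ)) := fun w hw ↦
      ⟨⟨w, (hKs hw).2⟩, rfl⟩
    refine (IsInducing.isPreconnected_image (f := fun w : Circle ↦ (w : ℂ)) IsInducing.subtypeVal).1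
      ?_
    rw [image_preimage_eq_of_subset hr]
    exact isPreconnected_connectedComponentIn
  have hsub : ((fun w : Circle ↦ (w : ℂ)) ⁻¹' K) ⊆ E :=
    hpre.subset_connectedComponentIn (mem_connectedComponentIn ⟨h1, by simp⟩)
      fun w hw ↦ (hKs hw).1
  have hzc : z ∈ Metric.sphere (0:ℂ) 1 := (hKs hz).2
  have : (⟨z, hzc⟩ : Circle) ∈ E := hsub hz
  rw [← himg] at this
  obtain ⟨t, ht, htz⟩ := this
  refine ⟨t, heN t ht, ?_⟩
  have := congr_arg (fun w : Circle ↦ (w : ℂ)) htz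
  simpa [hω] using this

/-- If every simple closed curve in `U` separates `U`, a component of a cover over `V` is injective
as soon as this is true for `V` cut along the boundary of a disc. -/
theorem injOn_of_cut_disc {A T : Type*} [TopologicalSpace A] [TopologicalSpace T] [T2Space T]
    [LocallyConnectedSpace T] [LocallyConnectedSpace A] {p : A → T} (hp : IsCoveringMap p)
    {U V : Set T} (hU : IsOpen U) (cU : IsPreconnected U)
    (sep : ∀ F : C(Circle1, T), Function.Injective F → range F ⊆ U → ¬ IsPreconnected (U \ range F))
    (hch : ∀ x ∈ U, ∃ φ : ℂ → T, IsOpenEmbedding φ ∧ φ 0 = x)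
    (hV : IsOpen V) (hVU : V ⊆ U) (hY : IsPreconnected (U \ V)) {φ : ℂ → T} (hφ : IsOpenEmbedding φ)
    (hφU : range φ ⊆ U) {m : A} (hm : p m ∈ V \ φ '' Metric.sphere 0 1)
    (hinj : InjOn p (connectedComponentIn (p ⁻¹' (V \ φ '' Metric.sphere 0 1)) m))
    (hoth : ∀ w ∈ V \ φ '' Metric.sphere 0 1,
      p m ∉ connectedComponentIn (V \ φ '' Metric.sphere 0 1) w →
      LiftInj p (connectedComponentIn (V \ φ '' Metric.sphere 0 1) w)) :
    InjOn p (connectedComponentIn (p ⁻¹' V) m) := by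
  set S := φ '' Metric.sphere 0 1 with hS
  have clS : IsClosed S := ((isCompact_sphere (0 : ℂ) 1).image hφ.continuous).isClosed
  have oVS : IsOpen (V \ S) := hV.sdiff clS
  have oP : ∀ x, IsOpen (connectedComponentIn (p ⁻¹' (V \ S)) x) := fun x ↦
    (oVS.preimage hp.continuous).connectedComponentIn
  have iP : ∀ x, p x ∈ V \ S → p '' connectedComponentIn (p ⁻¹' (V \ S)) x =
      connectedComponentIn (V \ S) (p x) := by
    intro x hx
    have hsub : connectedComponentIn (p ⁻¹' (V \ S)) x ⊆
        p ⁻¹' (connectedComponentIn (V \ S) (p x)) := image_subset_iff.1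
      ((isPreconnected_connectedComponentIn.image p
        hp.continuous.continuousOn).subset_connectedComponentIn
        ⟨x, mem_connectedComponentIn hx, rfl⟩ (image_subset_iff.2
          (connectedComponentIn_subset _ _)))
    have h1 := image_connectedComponentIn_preimage hp (x := x)
      (oVS.connectedComponentIn (x := p x)) isPreconnected_connectedComponentIn
      (mem_connectedComponentIn hx)
    refine (image_subset_iff.2 hsub).antisymm ?_
    rw [← h1]
    exact image_mono (connectedComponentIn_mono _ (preimage_mono (connectedComponentIn_subset _ _)))
  let sat : Set A → Prop := fun O ↦
    (∀ C, IsPreconnected C → C ⊆ p ⁻¹' (V \ S) → (C ∩ O).Nonempty → C ⊆ O) ∧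
    (∀ C, IsPreconnected C → C ⊆ p ⁻¹' (V ∩ S) → (C ∩ O).Nonempty → C ⊆ O)
  let fam : Set (Set A) := {O | IsOpen O ∧ IsPreconnected O ∧ m ∈ O ∧ O ⊆ p ⁻¹' V ∧ InjOn p O ∧ sat
    O}
  have satP : ∀ x, ∀ C, IsPreconnected C → C ⊆ p ⁻¹' (V \ S) →
      (C ∩ connectedComponentIn (p ⁻¹' (V \ S)) x).Nonempty →
      C ⊆ connectedComponentIn (p ⁻¹' (V \ S)) x := by
    rintro x C hC hCV ⟨y, hyC, hy⟩
    rw [connectedComponentIn_eq hy]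
    exact hC.subset_connectedComponentIn hyC hCV
  have hfam0 : connectedComponentIn (p ⁻¹' (V \ S)) m ∈ fam := by
    refine ⟨oP m, isPreconnected_connectedComponentIn, mem_connectedComponentIn hm,
      (connectedComponentIn_subset _ _).trans (preimage_mono sdiff_subset), hinj, satP m, ?_⟩
    rintro C hC hCV ⟨y, hyC, hy⟩
    exact absurd (hCV hyC).2 (connectedComponentIn_subset _ _ hy).2
  obtain ⟨Ω, -, ⟨⟨oΩ, cΩ, mΩ, ΩV, iΩ, sΩ, eΩ⟩, hmax⟩⟩ := zorn_subset_nonempty fam (by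
    intro c hc hch ⟨O₀, hO₀⟩
    refine ⟨⋃₀ c, ⟨isOpen_sUnion fun O hO ↦ (hc hO).1, isPreconnected_sUnion m c
      (fun O hO ↦ (hc hO).2.2.1) fun O hO ↦ (hc hO).2.1, ⟨O₀, hO₀, (hc hO₀).2.2.1⟩,
      sUnion_subset fun O hO ↦ (hc hO).2.2.2.1, ?_, ?_, ?_⟩, fun O hO ↦ subset_sUnion_of_mem hO⟩
    · rintro x ⟨O, hO, hx⟩ y ⟨O', hO', hy⟩ hxy
      rcases hch.total hO hO' with h | h
      · exact (hc hO').2.2.2.2.1 (h hx) hy hxy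
      · exact (hc hO).2.2.2.2.1 hx (h hy) hxy
    · rintro C hC hCV ⟨y, hyC, O, hO, hy⟩
      exact ((hc hO).2.2.2.2.2.1 C hC hCV ⟨y, hyC, hy⟩).trans (subset_sUnion_of_mem hO)
    · rintro C hC hCV ⟨y, hyC, O, hO, hy⟩
      exact ((hc hO).2.2.2.2.2.2 C hC hCV ⟨y, hyC, hy⟩).trans (subset_sUnion_of_mem hO)) _ hfam0
  suffices hcl : closure Ω ∩ p ⁻¹' V ⊆ Ω by
    have : connectedComponentIn (p ⁻¹' V) m ⊆ Ω := by
      have hd : Disjoint Ω (closure Ω)ᶜ := disjoint_left.2 fun x hx hx' ↦ hx' (subset_closure hx)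
      have hmm : m ∈ connectedComponentIn (p ⁻¹' V) m := mem_connectedComponentIn hm.1
      rcases (isPreconnected_connectedComponentIn (F := p ⁻¹' V) (x := m)).subset_or_subset oΩ
        isClosed_closure.isOpen_compl hd (fun x hx ↦ by
          by_cases h : x ∈ closure Ω
          · exact Or.inl (hcl ⟨h, connectedComponentIn_subset _ _ hx⟩)
          · exact Or.inr h) with h | h
      · exact h
      · exact absurd (subset_closure mΩ) (h hmm)
    exact iΩ.mono this
  rintro z ⟨hzc, hzV⟩
  by_contra hzΩ
  have hzV : p z ∈ V := hzV
  by_cases hzS : p z ∈ S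
  swap
  · obtain ⟨y, hyP, hyΩ⟩ := mem_closure_iff.1 hzc _ (oP z) (mem_connectedComponentIn ⟨hzV, hzS⟩)
    exact hzΩ (sΩ _ isPreconnected_connectedComponentIn (connectedComponentIn_subset _ _)
      ⟨y, hyP, hyΩ⟩ (mem_connectedComponentIn ⟨hzV, hzS⟩))
  -- rotate the disc so that the point becomes the image of `1`
  obtain ⟨ζ, hζ, hζz⟩ := hzS
  have hζ0 : ζ ≠ 0 := by rintro rfl; simp at hζ
  have nζ : ‖ζ‖ = 1 := by simpa using hζ
  obtain ⟨χ, hχ, hχU, hχ1, hχS⟩ : ∃ χ : ℂ → T, IsOpenEmbedding χ ∧ range χ ⊆ U ∧ χ 1 = p z ∧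
      χ '' Metric.sphere 0 1 = S := by
    refine ⟨fun w ↦ φ (ζ * w), hφ.comp (Homeomorph.mulLeft₀ ζ hζ0).isOpenEmbedding, ?_, by simpa,
      ?_⟩
    · rintro _ ⟨w, rfl⟩; exact hφU ⟨_, rfl⟩
    · ext x; constructor
      · rintro ⟨w, hw, rfl⟩
        exact ⟨ζ * w, by simpa [nζ] using hw, rfl⟩
      · rintro ⟨w, hw, rfl⟩
        refine ⟨ζ⁻¹ * w, by simpa [nζ] using hw, ?_⟩
        simp only [← mul_assoc, mul_inv_cancel₀ hζ0, one_mul]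
  obtain ⟨ψ, hψ, hψ1, hpψ⟩ := hp.exists_lift_openEmbedding hχ hχ1.symm
  obtain ⟨N, oN, hNV, h1N, cN, cNi, cNo, heN, cNe⟩ := exists_circle_strip
    (hV.preimage hχ.continuous) (show (1 : ℂ) ∈ χ ⁻¹' V by rw [mem_preimage, hχ1]; exact hzV)
  have himg : ∀ B : Set ℂ, p '' (ψ '' B) = χ '' B := fun B ↦ by
    rw [image_image]; exact image_congr fun x _ ↦ hpψ x
  have iψ : InjOn p (range ψ) := by
    rintro _ ⟨a, rfl⟩ _ ⟨b, rfl⟩ hab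
    rw [hpψ, hpψ] at hab
    rw [hχ.injective hab]
  set e := N ∩ Metric.sphere 0 1 with he
  have hNS : ∀ w, χ w ∈ S ↔ w ∈ Metric.sphere (0 : ℂ) 1 := by
    intro w
    rw [← hχS]
    exact ⟨fun ⟨v, hv, hvw⟩ ↦ hχ.injective hvw ▸ hv, fun h ↦ ⟨w, h, rfl⟩⟩
  have h1e : (1 : ℂ) ∈ e := ⟨h1N, by simp⟩
  -- components of the circle
  have hee : connectedComponentIn (V ∩ χ '' Metric.sphere 0 1) (χ 1) ⊆ χ '' e := by
    set K := connectedComponentIn (V ∩ χ '' Metric.sphere 0 1) (χ 1)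
    have hK : K ⊆ V ∩ χ '' Metric.sphere 0 1 := connectedComponentIn_subset _ _
    have hKr : K ⊆ range χ := fun x hx ↦ by
      obtain ⟨w, -, rfl⟩ := (hK hx).2
      exact ⟨w, rfl⟩
    have cK : IsPreconnected (χ ⁻¹' K) := by
      rw [← hχ.isInducing.isPreconnected_image, image_preimage_eq_of_subset hKr]
      exact isPreconnected_connectedComponentIn
    have hsub : χ ⁻¹' K ⊆ χ ⁻¹' V ∩ Metric.sphere 0 1 := fun w hw ↦
      ⟨(hK hw).1, (hNS w).1 (hχS ▸ (hK hw).2)⟩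
    have h1K : (1 : ℂ) ∈ χ ⁻¹' K := mem_connectedComponentIn ⟨hNV h1N, 1, by simp, rfl⟩
    intro x hx
    obtain ⟨w, rfl⟩ := hKr hx
    exact ⟨w, ⟨heN (cK.subset_connectedComponentIn h1K hsub hx), (hsub hx).2⟩, rfl⟩
  have hψV : ∀ B ⊆ N, ψ '' B ⊆ p ⁻¹' V := by
    rintro B hB _ ⟨w, hw, rfl⟩
    rw [mem_preimage, hpψ]; exact hNV (hB hw)
  have edis : Disjoint (χ '' e) (p '' Ω) := by
    rw [disjoint_left]
    rintro _ ⟨w, hw, rfl⟩ ⟨x, hxΩ, hx⟩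
    obtain ⟨ψ', hψ', hψ'w, hpψ'⟩ := hp.exists_lift_openEmbedding hχ hx
    have hsub : ψ' '' e ⊆ Ω := by
      refine eΩ _ (cNe.image _ hψ'.continuous.continuousOn) ?_ ⟨x, ⟨w, hw, hψ'w⟩, hxΩ⟩
      rintro _ ⟨v, hv, rfl⟩
      rw [mem_preimage, hpψ']
      exact ⟨hNV hv.1, (hNS v).2 hv.2⟩
    have h1Ω : ψ' 1 ∈ Ω := hsub ⟨1, h1e, rfl⟩
    have hne : ψ' 1 ≠ ψ 1 := fun h ↦ hzΩ (by rw [← hψ1, ← h]; exact h1Ω)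
    -- points of `Ω` close to `z` have two preimages
    have ho : IsOpen (ψ '' (ψ' ⁻¹' Ω)) := hψ.isOpenMap _ (oΩ.preimage hψ'.continuous)
    obtain ⟨_, ⟨v, hv, rfl⟩, hvΩ⟩ := mem_closure_iff.1 hzc _ ho ⟨1, h1Ω, hψ1⟩
    have hvv : ψ' v = ψ v := iΩ hv hvΩ (by rw [hpψ, hpψ'])
    have : ψ' = ψ := hp.eq_of_comp_eq hψ'.continuous hψ.continuous
      (funext fun x ↦ by simp [hpψ, hpψ']) v hvv
    exact hne (by rw [this])
  have hside : ∀ w ∈ N, w ∉ Metric.sphere (0 : ℂ) 1 → χ w ∈ V \ S := fun w hw hws ↦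
    ⟨hNV hw, fun h ↦ hws ((hNS w).1 h)⟩
  have full : ∀ B ⊆ N, IsPreconnected B → Disjoint B (Metric.sphere 0 1) →
      (χ '' B ∩ p '' Ω).Nonempty → χ '' B ⊆ p '' Ω := by
    rintro B hBN cB hBS ⟨_, ⟨w, hw, rfl⟩, x, hxΩ, hx⟩
    obtain ⟨ψ', hψ', hψ'w, hpψ'⟩ := hp.exists_lift_openEmbedding hχ hx
    have hsub : ψ' '' B ⊆ Ω := by
      refine sΩ _ (cB.image _ hψ'.continuous.continuousOn) ?_ ⟨x, ⟨w, hw, hψ'w⟩, hxΩ⟩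
      rintro _ ⟨v, hv, rfl⟩
      rw [mem_preimage, hpψ']
      exact hside v (hBN hv) (disjoint_left.1 hBS hv)
    rintro _ ⟨v, hv, rfl⟩
    exact ⟨ψ' v, hsub ⟨v, hv, rfl⟩, hpψ' v⟩
  have key : ∀ B B' : Set ℂ, B ⊆ N → B' ⊆ N → N ⊆ B ∪ B' ∪ e → IsPreconnected B →
      IsPreconnected B' → Disjoint B (Metric.sphere 0 1) → Disjoint B' (Metric.sphere 0 1) →
      B'.Nonempty → ¬ (χ '' B ⊆ p '' Ω ∧ χ '' B' ⊆ p '' Ω) → (ψ '' B ∩ Ω).Nonempty → False := by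
    intro B B' hB hB' hN cB cB' dB dB' ⟨w', hw'⟩ hboth hne
    have hψB : ∀ D ⊆ N, Disjoint D (Metric.sphere 0 1) → ψ '' D ⊆ p ⁻¹' (V \ S) := by
      rintro D hD dD _ ⟨v, hv, rfl⟩
      rw [mem_preimage, hpψ]
      exact hside v (hD hv) (disjoint_left.1 dD hv)
    have hBΩ : ψ '' B ⊆ Ω := sΩ _ (cB.image _ hψ.continuous.continuousOn) (hψB B hB dB) hne
    have hBΩ' : χ '' B ⊆ p '' Ω := by
      rw [← himg]; exact image_mono hBΩ
    have dis' : Disjoint (χ '' B') (p '' Ω) := by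
      rw [disjoint_iff_inter_eq_empty, ← not_nonempty_iff_eq_empty]
      exact fun h ↦ hboth ⟨hBΩ', full B' hB' cB' dB' h⟩
    set P := connectedComponentIn (p ⁻¹' (V \ S)) (ψ w') with hP
    have hw'V : p (ψ w') ∈ V \ S := hψB B' hB' dB' ⟨w', hw', rfl⟩
    have hPimg := iP _ hw'V
    set P₀ := connectedComponentIn (V \ S) (p (ψ w')) with hP₀
    have hP₀V : P₀ ⊆ V \ S := connectedComponentIn_subset _ _
    have hB'P : ψ '' B' ⊆ P := (cB'.image _ hψ.continuous.continuousOn).subset_connectedComponentIn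
      ⟨w', hw', rfl⟩ (hψB B' hB' dB')
    have hPΩ : Disjoint P₀ (p '' Ω) := by
      rw [disjoint_left]
      rintro _ hx ⟨x, hxΩ, rfl⟩
      have h1 := iP x (hP₀V hx)
      rw [← connectedComponentIn_eq hx] at h1
      have h2 : connectedComponentIn (p ⁻¹' (V \ S)) x ⊆ Ω :=
        sΩ _ isPreconnected_connectedComponentIn (connectedComponentIn_subset _ _)
          ⟨x, mem_connectedComponentIn (hP₀V hx), hxΩ⟩
      have h3 : p (ψ w') ∈ p '' Ω := by
        have : p (ψ w') ∈ P₀ := mem_connectedComponentIn hw'V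
        rw [hP₀, ← h1] at this
        exact image_mono h2 this
      exact disjoint_left.1 dis' ⟨w', hw', rfl⟩ (hpψ w' ▸ h3)
    have iPi : InjOn p P := hoth _ hw'V
      (fun h ↦ disjoint_left.1 hPΩ h ⟨m, mΩ, rfl⟩) P isPreconnected_connectedComponentIn
      (image_subset_iff.1 hPimg.subset)
    have oψN : IsOpen (ψ '' N) := hψ.isOpenMap _ oN
    have hBB' : ∀ x ∈ χ '' N, x ∈ χ '' B ∨ x ∈ χ '' B' ∨ x ∈ χ '' e := by
      rintro _ ⟨v, hv, rfl⟩
      rcases hN hv with (h | h) | h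
      · exact Or.inl ⟨v, h, rfl⟩
      · exact Or.inr (Or.inl ⟨v, h, rfl⟩)
      · exact Or.inr (Or.inr ⟨v, h, rfl⟩)
    have i₁ : InjOn p (Ω ∪ ψ '' N) := by
      refine injOn_union_of_sheets hp oΩ oψN iΩ (iψ.mono (image_subset_range _ _)) ?_ ?_
      · have : p '' Ω ∩ p '' (ψ '' N) = χ '' B := by
          rw [himg]
          refine Subset.antisymm ?_ (subset_inter hBΩ' (image_mono hB))
          rintro x ⟨hx, hxN⟩
          rcases hBB' x hxN with h | h | h
          · exact h
          · exact absurd hx (disjoint_left.1 dis' h)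
          · exact absurd hx (disjoint_left.1 edis h)
        rw [this]
        exact cB.image _ hχ.continuous.continuousOn
      · obtain ⟨x, hx, hxΩ⟩ := hne
        exact ⟨x, hxΩ, image_mono hB hx⟩
    have i₂ : InjOn p (Ω ∪ ψ '' N ∪ P) := by
      refine injOn_union_of_sheets hp (oΩ.union oψN) (oP _) i₁ iPi ?_
        ⟨ψ w', Or.inr ⟨w', hB' hw', rfl⟩, mem_connectedComponentIn hw'V⟩
      have : p '' (Ω ∪ ψ '' N) ∩ p '' P = χ '' B' := by
        rw [hPimg, image_union, himg]
        refine Subset.antisymm ?_ (subset_inter ((image_mono hB').trans subset_union_right) ?_)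
        · rintro x ⟨hx | hx, hxP⟩
          · exact absurd hx (disjoint_left.1 hPΩ hxP)
          · rcases hBB' x hx with h | h | h
            · exact absurd (hBΩ' h) (disjoint_left.1 hPΩ hxP)
            · exact h
            · obtain ⟨v, hv, rfl⟩ := h
              exact absurd ((hNS v).2 hv.2) (hP₀V hxP).2
        · rw [← himg, ← hPimg]; exact image_mono hB'P
      rw [this]
      exact cB'.image _ hχ.continuous.continuousOn
    have hnew : Ω ∪ ψ '' N ∪ P ∈ fam := by
      refine ⟨(oΩ.union oψN).union (oP _), ?_, Or.inl (Or.inl mΩ), ?_, i₂, ?_, ?_⟩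
      · refine IsPreconnected.union (ψ w') (Or.inr ⟨w', hB' hw', rfl⟩)
          (mem_connectedComponentIn hw'V) ?_
          isPreconnected_connectedComponentIn
        obtain ⟨x, hx, hxΩ⟩ := hne
        exact IsPreconnected.union x hxΩ (image_mono hB hx) cΩ
          (cN.image _ hψ.continuous.continuousOn)
      · exact union_subset (union_subset ΩV (hψV N Subset.rfl))
          ((connectedComponentIn_subset _ _).trans (preimage_mono sdiff_subset))
      · rintro C hC hCV ⟨x, hxC, (hx | hx) | hx⟩
        · exact (sΩ C hC hCV ⟨x, hxC, hx⟩).trans fun y hy ↦ Or.inl (Or.inl hy)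
        · obtain ⟨v, hv, rfl⟩ := hx
          rcases hN hv with (h | h) | h
          · exact (sΩ C hC hCV ⟨_, hxC, hBΩ ⟨v, h, rfl⟩⟩).trans fun y hy ↦ Or.inl (Or.inl hy)
          · exact (satP _ C hC hCV ⟨_, hxC, hB'P ⟨v, h, rfl⟩⟩).trans fun y hy ↦ Or.inr hy
          · have := hCV hxC
            rw [mem_preimage, hpψ] at this
            exact absurd ((hNS v).2 h.2) this.2
        · exact (satP _ C hC hCV ⟨_, hxC, hx⟩).trans fun y hy ↦ Or.inr hy
      · rintro C hC hCV ⟨x, hxC, (hx | hx) | hx⟩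
        · exact (eΩ C hC hCV ⟨x, hxC, hx⟩).trans fun y hy ↦ Or.inl (Or.inl hy)
        · obtain ⟨v, hv, rfl⟩ := hx
          have hvS : v ∈ Metric.sphere (0 : ℂ) 1 := by
            have := hCV hxC
            rw [mem_preimage, hpψ] at this
            exact (hNS v).1 this.2
          have hcc : connectedComponentIn (V ∩ S) (χ v) = connectedComponentIn (V ∩ S) (χ 1) := by
            refine (connectedComponentIn_eq ?_).symm
            refine (cNe.image χ hχ.continuous.continuousOn).subset_connectedComponentIn
              ⟨1, h1e, rfl⟩ ?_ ⟨v, ⟨hv, hvS⟩, rfl⟩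
            rintro _ ⟨w, hw, rfl⟩
            exact ⟨hNV hw.1, (hNS w).2 hw.2⟩
          have hCe : p '' C ⊆ χ '' e := by
            refine Subset.trans ?_ hee
            rw [hχS, ← hcc]
            exact (hC.image p hp.continuous.continuousOn).subset_connectedComponentIn
              ⟨_, hxC, hpψ v⟩ (image_subset_iff.2 hCV)
          have : C ⊆ ψ '' N := subset_of_sheet hp oψN (iψ.mono (image_subset_range _ _)) hC
            (fun y hy ↦ by
              rw [himg]; exact image_mono inter_subset_left (hCe ⟨y, hy, rfl⟩))
            ⟨_, hxC, v, hv, rfl⟩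
          exact this.trans fun y hy ↦ Or.inl (Or.inr hy)
        · exact absurd (hCV hxC).2 (connectedComponentIn_subset _ _ hx).2
    exact hzΩ (hmax hnew (fun y hy ↦ Or.inl (Or.inl hy)) (Or.inl (Or.inr ⟨1, h1N, hψ1⟩)))
  have hlt : N ∩ {w | ‖w‖ < 1} ⊆ N := inter_subset_left
  have hgt : N ∩ {w | 1 < ‖w‖} ⊆ N := inter_subset_left
  have dlt : Disjoint (N ∩ {w | ‖w‖ < 1}) (Metric.sphere 0 1) := disjoint_left.2 fun w hw hw' ↦
    (ne_of_lt hw.2) (by simpa using hw')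
  have dgt : Disjoint (N ∩ {w | 1 < ‖w‖}) (Metric.sphere 0 1) := disjoint_left.2 fun w hw hw' ↦
    (ne_of_gt hw.2) (by simpa using hw')
  have hNr : ∀ᶠ r : ℝ in 𝓝 1, (r : ℂ) ∈ N :=
    (Complex.continuous_ofReal.tendsto' 1 1 (by simp)).eventually (oN.mem_nhds h1N)
  obtain ⟨ε, hε, hεN⟩ := Metric.eventually_nhds_iff.1 hNr
  have nlt : (N ∩ {w | ‖w‖ < 1}).Nonempty := by
    refine ⟨((1 - min (ε / 2) (1 / 2) : ℝ) : ℂ), hεN ?_, ?_⟩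
    · rw [Real.dist_eq, abs_lt]
      constructor <;> linarith [min_le_left (ε / 2) (1 / 2), lt_min (half_pos hε)
        (half_pos one_pos)]
    · simp only [mem_ofPred_eq]
      rw [Complex.norm_real, Real.norm_eq_abs, abs_lt]
      constructor <;> linarith [min_le_right (ε / 2) (1 / 2), lt_min (half_pos hε)
        (half_pos one_pos)]
  have ngt : (N ∩ {w | 1 < ‖w‖}).Nonempty := by
    refine ⟨((1 + ε / 2 : ℝ) : ℂ), hεN ?_, ?_⟩
    · rw [Real.dist_eq, abs_lt]
      constructor <;> linarith
    · simp only [mem_ofPred_eq]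
      rw [Complex.norm_real, Real.norm_eq_abs, abs_of_pos (by linarith)]
      linarith
  have hboth : ¬ (χ '' (N ∩ {w | ‖w‖ < 1}) ⊆ p '' Ω ∧ χ '' (N ∩ {w | 1 < ‖w‖}) ⊆ p '' Ω) := by
    rintro ⟨h1, h2⟩
    refine no_crossing hU cU sep hch hVU hY (hp.isOpenMap _ oΩ)
      (cΩ.image p hp.continuous.continuousOn) (image_subset_iff.2 ΩV) hχ hχU (hχ1 ▸ hzV)
      (edis.mono_left hee) ?_
    filter_upwards [nhdsWithin_le_nhds hNr, nhdsWithin_le_nhds (lt_mem_nhds (a := (0:ℝ)) one_pos),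
      self_mem_nhdsWithin] with r hr hr0 hr1
    have nr : ‖(r : ℂ)‖ = r := by rw [Complex.norm_real, Real.norm_eq_abs, abs_of_pos hr0]
    rcases lt_or_gt_of_ne hr1 with h | h
    · exact h1 ⟨r, ⟨hr, by simpa only [mem_ofPred_eq, nr] using h⟩, rfl⟩
    · exact h2 ⟨r, ⟨hr, by simpa only [mem_ofPred_eq, nr] using h⟩, rfl⟩
  obtain ⟨_, ⟨v, hv, rfl⟩, hvΩ⟩ := mem_closure_iff.1 hzc _ (hψ.isOpenMap _ oN) ⟨1, h1N, hψ1⟩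
  have tri : N ⊆ N ∩ {w | ‖w‖ < 1} ∪ N ∩ {w | 1 < ‖w‖} ∪ e := by
    intro w hw
    rcases lt_trichotomy ‖w‖ 1 with h | h | h
    · exact Or.inl (Or.inl ⟨hw, h⟩)
    · exact Or.inr ⟨hw, by simpa using h⟩
    · exact Or.inl (Or.inr ⟨hw, h⟩)
  rcases tri hv with (h | h) | h
  · exact key _ _ hlt hgt tri cNi cNo dlt dgt ngt hboth ⟨_, ⟨v, h, rfl⟩, hvΩ⟩
  · exact key _ _ hgt hlt (by rwa [union_comm (N ∩ {w | 1 < ‖w‖})]) cNo cNi dgt dlt nlt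
      (fun h ↦ hboth h.symm) ⟨_, ⟨v, h, rfl⟩, hvΩ⟩
  · exact disjoint_left.1 edis ⟨v, h, rfl⟩ ⟨_, hvΩ, hpψ v⟩

theorem isPreconnected_diff_component {X : Type*} [TopologicalSpace X] [LocallyConnectedSpace X]
    {U V : Set X} (cU : IsPreconnected U) (hV : IsOpen V) (hVU : V ⊆ U)
    (hY : IsPreconnected (U \ V)) (hne : (U \ V).Nonempty) (x : X) :
    IsPreconnected (U \ connectedComponentIn V x) := by
  obtain ⟨y, hy⟩ := hne
  have hmeet : ∀ w ∈ V, (closure (connectedComponentIn V w) ∩ (U \ V)).Nonempty := by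
    intro w hw
    by_contra hcon
    rw [not_nonempty_iff_eq_empty] at hcon
    have hcl : closure (connectedComponentIn V w) ∩ U ⊆ connectedComponentIn V w := by
      rintro z ⟨hz, hzU⟩
      by_contra hzn
      have hzf : z ∈ frontier (connectedComponentIn V w) :=
        ⟨hz, fun h ↦ hzn (interior_subset h)⟩
      have hzV := frontier_connectedComponentIn_subset hV w hzf
      exact notMem_empty z (hcon ▸ ⟨hz, hzU, hzV⟩)
    rcases cU.subset_or_subset (hV.connectedComponentIn (x := w)) isClosed_closure.isOpen_compl
      (disjoint_left.2 fun z hz hz' ↦ hz' (subset_closure hz)) (fun z hz ↦ by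
        by_cases h : z ∈ closure (connectedComponentIn V w)
        · exact Or.inl (hcl ⟨h, hz⟩)
        · exact Or.inr h) with h | h
    · exact hy.2 (connectedComponentIn_subset _ _ (h hy.1))
    · exact h (hVU hw) (subset_closure (mem_connectedComponentIn hw))
  have : U \ connectedComponentIn V x = ⋃₀ ({U \ V} ∪
      {S | ∃ w ∈ V, w ∉ connectedComponentIn V x ∧ S = (U \ V) ∪
        (connectedComponentIn V w ∪ (closure (connectedComponentIn V w) ∩ (U \ V)))}) := by
    apply Subset.antisymm
    · rintro z ⟨hzU, hz⟩
      by_cases hzV : z ∈ V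
      · exact ⟨_, Or.inr ⟨z, hzV, hz, rfl⟩, Or.inr (Or.inl (mem_connectedComponentIn hzV))⟩
      · exact ⟨_, Or.inl rfl, hzU, hzV⟩
    · refine sUnion_subset ?_
      rintro S (rfl | ⟨w, hw, hwx, rfl⟩)
      · exact sdiff_subset_sdiff_right (connectedComponentIn_subset _ _)
      · refine union_subset (sdiff_subset_sdiff_right (connectedComponentIn_subset _ _))
          (union_subset ?_
          (inter_subset_right.trans (sdiff_subset_sdiff_right (connectedComponentIn_subset _ _))))
        intro z hz
        refine ⟨hVU (connectedComponentIn_subset _ _ hz), fun hz' ↦ hwx ?_⟩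
        rw [connectedComponentIn_eq hz', ← connectedComponentIn_eq hz]
        exact mem_connectedComponentIn hw
  rw [this]
  refine isPreconnected_sUnion y _ ?_ ?_
  · rintro S (rfl | ⟨w, hw, hwx, rfl⟩)
    · exact hy
    · exact Or.inl hy
  · rintro S (rfl | ⟨w, hw, hwx, rfl⟩)
    · exact hY
    · obtain ⟨z, hz⟩ := hmeet w hw
      exact IsPreconnected.union z hz.2 (Or.inr hz) hY
        (isPreconnected_connectedComponentIn.subset_closure subset_union_left
          (union_subset subset_closure inter_subset_left))

theorem exists_chart_subset {T : Type*} [TopologicalSpace T] {φ : ℂ → T} (hφ : IsOpenEmbedding φ)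
    {W : Set T} (hW : IsOpen W) (h0 : φ 0 ∈ W) :
    ∃ χ : ℂ → T, IsOpenEmbedding χ ∧ χ 0 = φ 0 ∧ range χ ⊆ W := by
  obtain ⟨r, hr, hb⟩ := Metric.isOpen_iff.1 (hW.preimage hφ.continuous) 0 h0
  have hs := OpenPartialHomeomorph.univBall_source (0 : ℂ) r
  refine ⟨φ ∘ OpenPartialHomeomorph.univBall (0 : ℂ) r,
    hφ.comp (OpenPartialHomeomorph.isOpenEmbedding _ hs), by simp, ?_⟩
  rintro _ ⟨x, rfl⟩
  have := (OpenPartialHomeomorph.univBall (0 : ℂ) r).map_source (x := x) (by rw [hs]; trivial)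
  rw [OpenPartialHomeomorph.univBall_target _ hr] at this
  exact hb this

/-- The closed disc in a chart. -/
def closedDisc {T : Type*} (φ : ℂ → T) : Set T := φ '' Metric.closedBall 0 1

theorem isCompact_closedDisc {T : Type*} [TopologicalSpace T] {φ : ℂ → T} (hφ : Continuous φ) :
    IsCompact (closedDisc φ) := (isCompact_closedBall (0 : ℂ) 1).image hφ

theorem isPreconnected_closedDisc {T : Type*} [TopologicalSpace T] {φ : ℂ → T}
    (hφ : Continuous φ) : IsPreconnected (closedDisc φ) :=
  ((convex_closedBall (0 : ℂ) 1).isPreconnected).image φ hφ.continuousOn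

theorem closedDisc_mem_nhds {T : Type*} [TopologicalSpace T] {φ : ℂ → T} (hφ : IsOpenEmbedding φ) :
    closedDisc φ ∈ 𝓝 (φ 0) :=
  hφ.isOpenMap.image_mem_nhds (Metric.closedBall_mem_nhds 0 one_pos)

theorem subset_disc_or_subset_diff {T : Type*} [TopologicalSpace T] [T2Space T] {φ : ℂ → T}
    (hφ : IsOpenEmbedding φ) {V W : Set T} (hW : IsPreconnected W)
    (hWV : W ⊆ V \ φ '' Metric.sphere 0 1) :
    W ⊆ φ '' Metric.ball 0 1 ∨ W ⊆ V \ closedDisc φ := by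
  have hcl : IsClosed (closedDisc φ) := (isCompact_closedDisc hφ.continuous).isClosed
  rcases hW.subset_or_subset (hφ.isOpenMap _ (Metric.isOpen_ball (x := 0) (ε := 1)))
    hcl.isOpen_compl (disjoint_left.2 fun x hx hx' ↦ hx'
      (image_mono Metric.ball_subset_closedBall hx))
    (fun x hx ↦ by
      by_cases h : x ∈ closedDisc φ
      · obtain ⟨w, hw, rfl⟩ := h
        refine Or.inl ⟨w, lt_of_le_of_ne (Metric.mem_closedBall.1 hw) fun h ↦ ?_, rfl⟩
        exact (hWV hx).2 ⟨w, h, rfl⟩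
      · exact Or.inr h) with h | h
  · exact Or.inl h
  · exact Or.inr fun x hx ↦ ⟨(hWV hx).1, h hx⟩

section

variable {A T : Type*} [TopologicalSpace A] [TopologicalSpace T] [T2Space T]
    [LocallyConnectedSpace T] [LocallyConnectedSpace A] {p : A → T} {U : Set T}

theorem liftInj_of_discs (hp : IsCoveringMap p) (hU : IsOpen U) (cU : IsPreconnected U)
    (sep : ∀ F : C(Circle1, T), Function.Injective F → range F ⊆ U → ¬ IsPreconnected (U \ range F))
    (hch : ∀ x ∈ U, ∃ φ : ℂ → T, IsOpenEmbedding φ ∧ φ 0 = x) (s : Finset (ℂ → T)) :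
    (∀ φ ∈ s, IsOpenEmbedding φ ∧ range φ ⊆ U) → ∀ V ⊆ U, IsOpen V → IsPreconnected (U \ V) →
    (U \ V).Nonempty → V ⊆ ⋃ φ ∈ s, closedDisc φ → LiftInj p V := by
  induction s using Finset.strongInduction with
  | H s ih =>
  intro hs V hVU hV hY hne hVs C hC hCV
  rcases C.eq_empty_or_nonempty with rfl | ⟨m, hm⟩
  · exact injOn_empty _
  have hmV : p m ∈ V := hCV hm
  set V₁ := connectedComponentIn V (p m) with hV₁
  have oV₁ : IsOpen V₁ := hV.connectedComponentIn
  have V₁V : V₁ ⊆ V := connectedComponentIn_subset _ _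
  have mV₁ : p m ∈ V₁ := mem_connectedComponentIn hmV
  have hY₁ : IsPreconnected (U \ V₁) := isPreconnected_diff_component cU hV hVU hY hne _
  have hne₁ : (U \ V₁).Nonempty := hne.mono (sdiff_subset_sdiff_right V₁V)
  have hCV₁ : C ⊆ p ⁻¹' V₁ := image_subset_iff.1
    ((hC.image p hp.continuous.continuousOn).subset_connectedComponentIn ⟨m, hm, rfl⟩
      (image_subset_iff.2 hCV))
  -- a disc meeting both `V₁` and its complement
  obtain ⟨φ, hφs, ⟨y, hyD, hyV⟩, hφV⟩ : ∃ φ ∈ s, (closedDisc φ ∩ (U \ V₁)).Nonempty ∧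
      (closedDisc φ ∩ V₁).Nonempty := by
    have hcl : IsClosed (⋃ φ ∈ s.filter fun φ ↦ (closedDisc φ ∩ V₁).Nonempty, closedDisc φ) := by
      refine isClosed_biUnion_finset fun φ hφ ↦ ?_
      exact (isCompact_closedDisc (hs φ (Finset.mem_filter.1 hφ).1).1.continuous).isClosed
    have hsub : closure V₁ ⊆ ⋃ φ ∈ s.filter fun φ ↦ (closedDisc φ ∩ V₁).Nonempty, closedDisc φ := by
      refine closure_minimal (fun x hx ↦ ?_) hcl
      obtain ⟨φ, hφ, hxφ⟩ := mem_iUnion₂.1 (hVs (V₁V hx))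
      exact mem_iUnion₂.2 ⟨φ, Finset.mem_filter.2 ⟨hφ, x, hxφ, hx⟩, hxφ⟩
    obtain ⟨y, hy, hyU⟩ : (closure V₁ ∩ (U \ V₁)).Nonempty := by
      by_contra hcon
      rw [not_nonempty_iff_eq_empty] at hcon
      rcases cU.subset_or_subset oV₁ isClosed_closure.isOpen_compl
        (disjoint_left.2 fun z hz hz' ↦ hz' (subset_closure hz)) (fun z hz ↦ by
          by_cases h : z ∈ closure V₁
          · by_contra hz'
            exact notMem_empty z (hcon ▸ ⟨h, hz, fun h' ↦ hz' (Or.inl h')⟩)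
          · exact Or.inr h) with h | h
      · obtain ⟨z, hz⟩ := hne₁; exact hz.2 (h hz.1)
      · exact h (hVU hmV) (subset_closure mV₁)
    obtain ⟨φ, hφ, hyφ⟩ := mem_iUnion₂.1 (hsub hy)
    exact ⟨φ, (Finset.mem_filter.1 hφ).1, ⟨y, hyφ, hyU⟩, (Finset.mem_filter.1 hφ).2⟩
  obtain ⟨hφ, hφU⟩ := hs φ hφs
  by_cases hVD : V₁ ⊆ closedDisc φ
  · exact hp.liftInj_range hφ C hC
      (hCV₁.trans (preimage_mono (hVD.trans (image_subset_range _ _))))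
  obtain ⟨v, hvV, hvD⟩ := not_subset.1 hVD
  have hDU : closedDisc φ ⊆ U := (image_subset_range _ _).trans hφU
  have hcl : IsClosed (closedDisc φ) := (isCompact_closedDisc hφ.continuous).isClosed
  have hSD : φ '' Metric.sphere 0 1 ⊆ closedDisc φ := image_mono Metric.sphere_subset_closedBall
  have hrest : LiftInj p (V₁ \ closedDisc φ) := by
    have heq : U \ (V₁ \ closedDisc φ) = U \ V₁ ∪ closedDisc φ := by
      ext x; constructor
      · rintro ⟨hx, hx'⟩
        by_cases h : x ∈ closedDisc φ
        · exact Or.inr h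
        · exact Or.inl ⟨hx, fun h' ↦ hx' ⟨h', h⟩⟩
      · rintro (⟨hx, hx'⟩ | hx)
        · exact ⟨hx, fun h ↦ hx' h.1⟩
        · exact ⟨hDU hx, fun h ↦ h.2 hx⟩
    refine ih (s.erase φ) (Finset.erase_ssubset hφs) (fun χ hχ ↦ hs χ (Finset.mem_of_mem_erase hχ))
      _
      (sdiff_subset.trans (V₁V.trans hVU)) (oV₁.sdiff hcl) ?_ ?_ ?_
    · rw [heq]
      exact IsPreconnected.union y hyV hyD hY₁ (isPreconnected_closedDisc hφ.continuous)
    · rw [heq]; exact hne₁.mono subset_union_left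
    · rintro x ⟨hx, hxD⟩
      obtain ⟨χ, hχ, hxχ⟩ := mem_iUnion₂.1 (hVs (V₁V hx))
      exact mem_iUnion₂.2 ⟨χ, Finset.mem_erase.2 ⟨by rintro rfl; exact hxD hxχ, hχ⟩, hxχ⟩
  have hall : LiftInj p (V₁ \ φ '' Metric.sphere 0 1) := by
    intro C' hC' hCV'
    rcases subset_disc_or_subset_diff hφ (hC'.image p hp.continuous.continuousOn)
      (image_subset_iff.2 hCV') with h | h
    · exact hp.liftInj_range hφ C' hC' (image_subset_iff.1 (h.trans (image_subset_range _ _)))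
    · exact hrest C' hC' (image_subset_iff.1 h)
  obtain ⟨m', hm', hm'v⟩ : v ∈ p '' connectedComponentIn (p ⁻¹' V₁) m := by
    rw [image_connectedComponentIn_preimage hp oV₁ isPreconnected_connectedComponentIn mV₁]
    exact hvV
  have h := injOn_of_cut_disc hp hU cU sep hch oV₁ (V₁V.trans hVU) hY₁ hφ hφU (m := m')
    (hm'v ▸ ⟨hvV, fun h ↦ hvD (hSD h)⟩)
    (hall _ isPreconnected_connectedComponentIn (connectedComponentIn_subset _ _))
    fun w _ _ ↦ hall.mono (connectedComponentIn_subset _ _)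
  rw [← connectedComponentIn_eq hm'] at h
  exact h.mono (hC.subset_connectedComponentIn hm hCV₁)

theorem injOn_add_disc (hp : IsCoveringMap p) (hU : IsOpen U) (cU : IsPreconnected U)
    (sep : ∀ F : C(Circle1, T), Function.Injective F → range F ⊆ U → ¬ IsPreconnected (U \ range F))
    (hch : ∀ x ∈ U, ∃ φ : ℂ → T, IsOpenEmbedding φ ∧ φ 0 = x) {s : Finset (ℂ → T)}
    (hs : ∀ φ ∈ s, IsOpenEmbedding φ ∧ range φ ⊆ U) {Z : Set T} (hZU : Z ⊆ U)
    (cZ : IsPreconnected Z) (oZ : IsOpen (U \ Z)) {H : Set A} (cH : IsPreconnected H) {m : A}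
    (hm : m ∈ H) (hHZ : p '' H ⊆ U \ Z) (hZs : U \ (Z ∪ p '' H) ⊆ ⋃ φ ∈ s, closedDisc φ)
    {φ : ℂ → T} (hφ : IsOpenEmbedding φ) (hφU : range φ ⊆ U \ p '' H)
    (hDZ : (closedDisc φ ∩ Z).Nonempty ∨ Z = ∅)
    (hinj : InjOn p (connectedComponentIn (p ⁻¹' (U \ (Z ∪ closedDisc φ))) m)) :
    InjOn p (connectedComponentIn (p ⁻¹' (U \ Z)) m) := by
  have hDU : closedDisc φ ⊆ U \ p '' H := (image_subset_range _ _).trans hφU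
  have hcl : IsClosed (closedDisc φ) := (isCompact_closedDisc hφ.continuous).isClosed
  have hSD : φ '' Metric.sphere 0 1 ⊆ closedDisc φ := image_mono Metric.sphere_subset_closedBall
  have hcU : IsPreconnected (U \ (U \ Z)) := by
    rwa [sdiff_sdiff_right_self, inter_eq_right.2 hZU]
  have hmD : p m ∉ closedDisc φ := fun h ↦ (hDU h).2 ⟨m, hm, rfl⟩
  have hmZ : p m ∈ U \ Z := hHZ ⟨m, hm, rfl⟩
  have hHD : p '' H ⊆ (U \ Z) \ closedDisc φ := fun x hx ↦ ⟨hHZ hx, fun h ↦ (hDU h).2 hx⟩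
  have e1 : U \ (Z ∪ closedDisc φ) = (U \ Z) \ closedDisc φ := by rw [Set.sdiff_sdiff]
  refine injOn_of_cut_disc hp hU cU sep hch oZ sdiff_subset hcU hφ (hφU.trans sdiff_subset)
    ⟨hmZ, fun h ↦ hmD (hSD h)⟩ (hinj.mono ?_) ?_
  · have hmm : m ∈ connectedComponentIn (p ⁻¹' ((U \ Z) \ φ '' Metric.sphere 0 1)) m :=
      mem_connectedComponentIn ⟨hmZ, fun h ↦ hmD (hSD h)⟩
    refine isPreconnected_connectedComponentIn.subset_connectedComponentIn hmm ?_
    rcases subset_disc_or_subset_diff hφ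
      (isPreconnected_connectedComponentIn.image p hp.continuous.continuousOn)
      (image_subset_iff.2 (connectedComponentIn_subset
        (p ⁻¹' ((U \ Z) \ φ '' Metric.sphere 0 1)) m)) with h | h
    · exact absurd (image_mono Metric.ball_subset_closedBall (h ⟨m, hmm, rfl⟩)) hmD
    · rw [e1]; exact image_subset_iff.1 h
  · intro w hw hmw
    rcases subset_disc_or_subset_diff hφ isPreconnected_connectedComponentIn
      (connectedComponentIn_subset ((U \ Z) \ φ '' Metric.sphere 0 1) w) with h | h
    · exact (hp.liftInj_range hφ).mono (h.trans (image_subset_range _ _))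
    · have hww := mem_connectedComponentIn hw
      have heq : connectedComponentIn ((U \ Z) \ φ '' Metric.sphere 0 1) w =
          connectedComponentIn ((U \ Z) \ closedDisc φ) w :=
        (isPreconnected_connectedComponentIn.subset_connectedComponentIn hww h).antisymm
          (connectedComponentIn_mono _ (sdiff_subset_sdiff_right hSD))
      rw [heq] at hmw ⊢
      have e2 : U \ ((U \ Z) \ closedDisc φ) = Z ∪ closedDisc φ := by
        rw [← e1, sdiff_sdiff_right_self, inter_eq_right.2
          (union_subset hZU (hDU.trans sdiff_subset))]
      have c0 : φ 0 ∈ closedDisc φ := ⟨0, by simp, rfl⟩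
      have hsubU : (U \ Z) \ closedDisc φ ⊆ U := sdiff_subset.trans sdiff_subset
      have c2 : IsPreconnected (U \ ((U \ Z) \ closedDisc φ)) := by
        rw [e2]
        rcases hDZ with ⟨y, hy, hyZ⟩ | rfl
        · exact cZ.union y hyZ hy (isPreconnected_closedDisc hφ.continuous)
        · rw [empty_union]; exact isPreconnected_closedDisc hφ.continuous
      have n2 : (U \ ((U \ Z) \ closedDisc φ)).Nonempty := by
        rw [e2]; exact ⟨_, Or.inr c0⟩
      have hdis : Disjoint (connectedComponentIn ((U \ Z) \ closedDisc φ) w) (p '' H) := by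
        rw [disjoint_left]
        intro x hx hxH
        refine hmw ?_
        rw [connectedComponentIn_eq hx]
        exact (cH.image p hp.continuous.continuousOn).subset_connectedComponentIn hxH hHD
          ⟨m, hm, rfl⟩
      refine liftInj_of_discs hp hU cU sep hch s hs _
        ((connectedComponentIn_subset _ _).trans hsubU)
        (oZ.sdiff hcl).connectedComponentIn
        (isPreconnected_diff_component cU (oZ.sdiff hcl) hsubU c2 n2 w)
        (n2.mono (sdiff_subset_sdiff_right (connectedComponentIn_subset _ _))) ?_
      intro x hx
      have := connectedComponentIn_subset _ _ hx
      exact hZs ⟨this.1.1, fun h ↦ h.elim this.1.2 (disjoint_left.1 hdis hx)⟩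

/-- Enlarging a set by a disc that meets it. -/
def AddDisc (G : Set T) (Z Z' : Set T) : Prop :=
  ∃ φ : ℂ → T, IsOpenEmbedding φ ∧ range φ ⊆ G ∧ (closedDisc φ ∩ Z).Nonempty ∧ Z' = Z ∪ closedDisc φ

end

section

variable {A T : Type*} [TopologicalSpace A] [TopologicalSpace T] {p : A → T} {U : Set T}

theorem AddDisc.chain_union {G Z Z' W : Set T} (h : Relation.ReflTransGen (AddDisc G) Z Z')
    (hW : Z ⊆ W) : Relation.ReflTransGen (AddDisc G) W (W ∪ Z') := by
  induction h with
  | refl => rw [union_eq_left.2 hW]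
  | tail _ h ih =>
    obtain ⟨φ, h1, h2, h3, rfl⟩ := h
    exact ih.tail ⟨φ, h1, h2, h3.mono (inter_subset_inter_right _ subset_union_right), by
      rw [union_assoc]⟩

theorem AddDisc.chain_subset {G Z Z' : Set T} (h : Relation.ReflTransGen (AddDisc G) Z Z') :
    Z ⊆ Z' := by
  induction h with
  | refl => exact Subset.rfl
  | tail _ h ih =>
    obtain ⟨φ, h1, h2, h3, rfl⟩ := h
    exact ih.trans subset_union_left

theorem exists_chain {G : Set T} (cG : IsPreconnected G)
    (hch : ∀ x ∈ G, ∃ φ : ℂ → T, IsOpenEmbedding φ ∧ φ 0 = x ∧ range φ ⊆ G)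
    {Z K : Set T} (hZ : (G ∩ Z).Nonempty) (hK : IsCompact K) (hKG : K ⊆ G) :
    ∃ Z', Relation.ReflTransGen (AddDisc G) Z Z' ∧ K ⊆ Z' := by
  have key : G ⊆ {x | ∃ Z', Relation.ReflTransGen (AddDisc G) Z Z' ∧ Z' ∈ 𝓝 x} := by
    refine cG.subset_of_closure_inter_subset ?_ ?_ ?_
    · rw [isOpen_iff_mem_nhds]
      rintro x ⟨Z', h, hx⟩
      filter_upwards [eventually_mem_nhds_iff.2 hx] with y hy using ⟨Z', h, hy⟩
    · obtain ⟨x, hx, hxZ⟩ := hZ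
      obtain ⟨φ, hφ, rfl, hφG⟩ := hch x hx
      have c0 : φ 0 ∈ closedDisc φ := ⟨0, by simp, rfl⟩
      exact ⟨_, hx, _, .single ⟨φ, hφ, hφG, ⟨_, c0, hxZ⟩, rfl⟩,
        mem_of_superset (closedDisc_mem_nhds hφ) subset_union_right⟩
    · rintro x ⟨hx, hxG⟩
      obtain ⟨φ, hφ, rfl, hφG⟩ := hch x hxG
      obtain ⟨y, hy, Z', h, hyZ⟩ := mem_closure_iff_nhds.1 hx _ (closedDisc_mem_nhds hφ)
      exact ⟨_, h.tail ⟨φ, hφ, hφG, ⟨y, hy, mem_of_mem_nhds hyZ⟩, rfl⟩,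
        mem_of_superset (closedDisc_mem_nhds hφ) subset_union_right⟩
  refine hK.induction_on (p := fun S ↦ ∃ Z', Relation.ReflTransGen (AddDisc G) Z Z' ∧ S ⊆ Z')
    ⟨Z, .refl, empty_subset _⟩ (fun S S' h ⟨Z', h1, h2⟩ ↦ ⟨Z', h1, h.trans h2⟩) ?_ ?_
  · rintro S S' ⟨Z1, h1, h2⟩ ⟨Z2, h3, h4⟩
    exact ⟨_, h1.trans (AddDisc.chain_union h3 (AddDisc.chain_subset h1)),
      union_subset_union h2 h4⟩
  · intro x hx
    obtain ⟨Z', h, hxZ⟩ := key (hKG hx)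
    exact ⟨Z', mem_nhdsWithin_of_mem_nhds hxZ, Z', h, Subset.rfl⟩

theorem exists_finset_discs (hU : IsOpen U)
    (hch : ∀ x ∈ U, ∃ φ : ℂ → T, IsOpenEmbedding φ ∧ φ 0 = x) {K : Set T} (hK : IsCompact K)
    (hKU : K ⊆ U) : ∃ s : Finset (ℂ → T), (∀ φ ∈ s, IsOpenEmbedding φ ∧ range φ ⊆ U) ∧
      K ⊆ ⋃ φ ∈ s, closedDisc φ := by
  refine hK.induction_on (p := fun S ↦ ∃ s : Finset (ℂ → T),
    (∀ φ ∈ s, IsOpenEmbedding φ ∧ range φ ⊆ U) ∧ S ⊆ ⋃ φ ∈ s, closedDisc φ)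
    ⟨∅, by simp, empty_subset _⟩ (fun S S' h ⟨Z', h1, h2⟩ ↦ ⟨Z', h1, h.trans h2⟩) ?_ ?_
  · rintro S S' ⟨s, h1, h2⟩ ⟨s', h3, h4⟩
    refine ⟨s ∪ s', fun φ hφ ↦ (Finset.mem_union.1 hφ).elim (h1 φ) (h3 φ), ?_⟩
    rw [Finset.set_biUnion_union]
    exact union_subset_union h2 h4
  · intro x hx
    obtain ⟨φ, hφ, rfl⟩ := hch x (hKU hx)
    obtain ⟨χ, hχ, h0, hχU⟩ := exists_chart_subset hφ hU (hKU hx)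
    exact ⟨closedDisc χ, mem_nhdsWithin_of_mem_nhds (h0 ▸ closedDisc_mem_nhds hχ), {χ}, by
      simpa using ⟨hχ, hχU⟩, by simp⟩

variable [T2Space T] [LocallyConnectedSpace T] [LocallyConnectedSpace A]

/-- If all simple closed curves in `U` separate `U` then the component over `U ∖ Y` of a
preconnected seed `H` is mapped injectively. -/
theorem injOn_component_of_seed (hp : IsCoveringMap p) (hU : IsOpen U) (cU : IsPreconnected U)
    (sep : ∀ F : C(Circle1, T), Function.Injective F → range F ⊆ U → ¬ IsPreconnected (U \ range F))
    (hch : ∀ x ∈ U, ∃ φ : ℂ → T, IsOpenEmbedding φ ∧ φ 0 = x)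
    {Y : Set T} (hYU : Y ⊆ U) (cY : IsPreconnected Y) (oY : IsOpen (U \ Y))
    {H : Set A} (cH : IsPreconnected H) {m : A} (hm : m ∈ H) (hHY : p '' H ⊆ U \ Y)
    (oH : IsOpen (U \ p '' H)) (cUH : IsPreconnected (U \ p '' H))
    {M : Set A} (oM : IsOpen M) (iM : InjOn p M) (hHM : H ⊆ M)
    {K : Set T} (cK : IsCompact K) (hK : K ⊆ U \ p '' H) (hcov : U \ (Y ∪ K) ⊆ p '' M)
    {K' : Set T} (cK' : IsCompact K') (hK' : K' ⊆ U) (hcov' : U \ (Y ∪ p '' H) ⊆ K') :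
    InjOn p (connectedComponentIn (p ⁻¹' (U \ Y)) m) := by
  obtain ⟨s, hs, hsK⟩ := exists_finset_discs hU hch cK' hK'
  have hchG : ∀ x ∈ U \ p '' H, ∃ φ : ℂ → T, IsOpenEmbedding φ ∧ φ 0 = x ∧ range φ ⊆ U \ p '' H :=
    by
    intro x hx
    obtain ⟨φ, hφ, rfl⟩ := hch x hx.1
    exact exists_chart_subset hφ oH hx
  have base : ∀ Z : Set T, Y ⊆ Z → K ⊆ Z →
      InjOn p (connectedComponentIn (p ⁻¹' (U \ Z)) m) := by
    intro Z hYZ hKZ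
    by_cases hmZ : m ∈ p ⁻¹' (U \ Z)
    · refine iM.mono (subset_of_sheet hp oM iM isPreconnected_connectedComponentIn ?_
        ⟨m, mem_connectedComponentIn hmZ, hHM hm⟩)
      intro x hx
      have := connectedComponentIn_subset _ _ hx
      exact hcov ⟨this.1, fun h ↦ this.2 (h.elim (fun h ↦ hYZ h) (fun h ↦ hKZ h))⟩
    · rw [connectedComponentIn_eq_empty hmZ]; exact injOn_empty _
  have chain : ∀ Z Z' : Set T, Relation.ReflTransGen (AddDisc (U \ p '' H)) Z Z' → K ⊆ Z' →
      Y ⊆ Z → Z ⊆ U → IsPreconnected Z → IsOpen (U \ Z) → p '' H ⊆ U \ Z →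
      InjOn p (connectedComponentIn (p ⁻¹' (U \ Z)) m) := by
    intro Z Z' h hKZ
    induction h using Relation.ReflTransGen.head_induction_on with
    | refl => exact fun h _ _ _ _ ↦ base _ h hKZ
    | head h _ ih =>
      obtain ⟨φ, h1, h2, h3, rfl⟩ := h
      intro hYZ hZU cZ oZ hHZ
      have hDG : closedDisc φ ⊆ U \ p '' H := (image_subset_range _ _).trans h2
      have hcl : IsClosed (closedDisc φ) := (isCompact_closedDisc h1.continuous).isClosed
      refine injOn_add_disc hp hU cU sep hch hs hZU cZ oZ cH hm hHZ (Subset.trans ?_ hsK) h1 h2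
        (Or.inl h3) (ih (hYZ.trans subset_union_left)
          (union_subset hZU (hDG.trans sdiff_subset)) ?_ ?_ ?_)
      · exact (sdiff_subset_sdiff_right (union_subset_union_left _ hYZ)).trans hcov'
      · obtain ⟨y, hy, hyZ⟩ := h3
        exact cZ.union y hyZ hy (isPreconnected_closedDisc h1.continuous)
      · rw [← Set.sdiff_sdiff]; exact oZ.sdiff hcl
      · exact fun x hx ↦ ⟨(hHZ hx).1, fun h ↦ h.elim (hHZ hx).2 fun h ↦ (hDG h).2 hx⟩
  rcases Y.eq_empty_or_nonempty with rfl | ⟨y, hy⟩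
  · rcases K.eq_empty_or_nonempty with rfl | ⟨k, hk⟩
    · exact base _ Subset.rfl Subset.rfl
    · obtain ⟨φ, h1, rfl, h2⟩ := hchG k (hK hk)
      have hDG : closedDisc φ ⊆ U \ p '' H := (image_subset_range _ _).trans h2
      have hcl : IsClosed (closedDisc φ) := (isCompact_closedDisc h1.continuous).isClosed
      have c0 : φ 0 ∈ closedDisc φ := ⟨0, by simp, rfl⟩
      obtain ⟨Z', h, hKZ⟩ := exists_chain (Z := closedDisc φ) cUH hchG ⟨_, hDG c0, c0⟩ cK hK
      refine injOn_add_disc hp hU cU sep hch hs hYU cY oY cH hm hHY (hcov'.trans hsK) h1 h2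
        (Or.inr rfl) ?_
      rw [empty_union]
      exact chain _ _ h hKZ (empty_subset _) (hDG.trans sdiff_subset)
        (isPreconnected_closedDisc h1.continuous) (hU.sdiff hcl)
        fun x hx ↦ ⟨(hHY hx).1, fun h ↦ (hDG h).2 hx⟩
  · obtain ⟨Z', h, hKZ⟩ := exists_chain (Z := Y) cUH hchG ⟨y, ⟨hYU hy, fun h ↦ (hHY h).2 hy⟩, hy⟩
      cK hK
    exact chain _ _ h hKZ Subset.rfl hYU cY oY hHY

end

theorem exists_compact_connected_between {G K : Set ℂ} (hG : IsOpen G) (cG : IsPreconnected G)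
    (hK : IsCompact K) (hKG : K ⊆ G) {a : ℂ} (ha : a ∈ G) :
    ∃ L, IsCompact L ∧ IsPreconnected L ∧ a ∈ L ∧ K ⊆ interior L ∧ L ⊆ G := by
  obtain ⟨K', hK', hKK', hK'G⟩ := exists_compact_between hK hG hKG
  have hch : ∀ x ∈ G, ∃ φ : ℂ → ℂ, IsOpenEmbedding φ ∧ φ 0 = x ∧ range φ ⊆ G := by
    intro x hx
    have h1 : IsOpenEmbedding (fun z : ℂ ↦ x + z) := (Homeomorph.addLeft x).isOpenEmbedding
    obtain ⟨χ, h2, h3, h4⟩ := exists_chart_subset h1 hG (by simpa using hx)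
    exact ⟨χ, h2, by simpa using h3, h4⟩
  obtain ⟨L, hL, hKL⟩ := exists_chain (Z := {a}) cG hch ⟨a, ha, rfl⟩ hK' hK'G
  refine ⟨L, ?_, ?_, AddDisc.chain_subset hL rfl, hKK'.trans (interior_mono hKL), ?_⟩
  · clear hKL
    induction hL with
    | refl => exact isCompact_singleton
    | tail _ h ih =>
      obtain ⟨φ, h1, h2, h3, rfl⟩ := h
      exact ih.union (isCompact_closedDisc h1.continuous)
  · clear hKL
    induction hL with
    | refl => exact isPreconnected_singleton
    | tail _ h ih =>
      obtain ⟨φ, h1, h2, ⟨y, hy, hyZ⟩, rfl⟩ := h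
      exact ih.union y hyZ hy (isPreconnected_closedDisc h1.continuous)
  · clear hKL
    induction hL with
    | refl => simpa using ha
    | tail _ h ih =>
      obtain ⟨φ, h1, h2, h3, rfl⟩ := h
      exact union_subset ih ((image_subset_range _ _).trans h2)

theorem image_component_exp {O : Set ℂ} (hO : IsOpen O) (cO : IsPreconnected O) (h0 : (0 : ℂ) ∉ O)
    {z : ℂ} (hz : Complex.exp z ∈ O) :
    Complex.exp '' connectedComponentIn (Complex.exp ⁻¹' O) z = O := by
  have hE : IsOpenEmbedding (Subtype.val : {z : ℂ // z ≠ 0} → ℂ) :=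
    isOpen_ne.isOpenEmbedding_subtypeVal
  have : LocallyConnectedSpace {z : ℂ // z ≠ 0} := hE.locallyConnectedSpace
  have hr : O ⊆ range (Subtype.val : {z : ℂ // z ≠ 0} → ℂ) :=
    fun x hx ↦ ⟨⟨x, fun h ↦ h0 (h ▸ hx)⟩, rfl⟩
  have c' : IsPreconnected (Subtype.val ⁻¹' O : Set {z : ℂ // z ≠ 0}) :=
    cO.preimage_of_isOpenMap Subtype.val_injective hE.isOpenMap hr
  have h := image_connectedComponentIn_preimage Complex.isCoveringMap_exp
    (hO.preimage continuous_subtype_val) c' (x := z) hz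
  have := congrArg (image Subtype.val) h
  rw [image_image, image_preimage_eq_inter_range, inter_eq_left.2 hr] at this
  exact this

/-- The preimage under `exp` of a connected open set containing a punctured neighbourhood of an
end of `ℂ ∖ {0}` is connected. -/
theorem isPreconnected_exp_preimage {O B : Set ℂ} (hO : IsOpen O) (cO : IsPreconnected O)
    (h0 : (0 : ℂ) ∉ O) (hBO : B ⊆ O) (hB : B.Nonempty)
    (cB : IsPreconnected (Complex.exp ⁻¹' B)) : IsPreconnected (Complex.exp ⁻¹' O) := by
  obtain ⟨b, hb⟩ := hB
  obtain ⟨w, rfl⟩ : ∃ w, Complex.exp w = b := ⟨_, Complex.exp_log fun h ↦ h0 (h ▸ hBO hb)⟩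
  have hw : w ∈ Complex.exp ⁻¹' B := hb
  refine isPreconnected_of_forall w fun z hz ↦ ?_
  refine ⟨connectedComponentIn (Complex.exp ⁻¹' O) z, connectedComponentIn_subset _ _, ?_,
    mem_connectedComponentIn hz, isPreconnected_connectedComponentIn⟩
  obtain ⟨w', hw', he⟩ := (image_component_exp hO cO h0 hz).symm ▸ hBO hb
  rw [connectedComponentIn_eq hw']
  exact cB.subset_connectedComponentIn (show Complex.exp w' ∈ B by rw [he]; exact hb)
    (preimage_mono hBO) hw

theorem isPreconnected_exp_preimage_norm_ge (R : ℝ) :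
    IsPreconnected (Complex.exp ⁻¹' {z : ℂ | R ≤ ‖z‖}) := by
  rcases le_or_gt R 0 with h | h
  · have : Complex.exp ⁻¹' {z : ℂ | R ≤ ‖z‖} = univ :=
      eq_univ_of_forall fun z ↦ h.trans (norm_nonneg _)
    rw [this]; exact isPreconnected_univ
  · have : Complex.exp ⁻¹' {z : ℂ | R ≤ ‖z‖} = {z | Real.log R ≤ z.re} := by
      ext z
      simp [Complex.norm_exp, Real.log_le_iff_le_exp h]
    rw [this]
    exact (convex_halfSpace_re_ge _).isPreconnected

theorem isPreconnected_exp_preimage_ball {r : ℝ} (h : 0 < r) :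
    IsPreconnected (Complex.exp ⁻¹' (Metric.ball 0 r)) := by
  have : Complex.exp ⁻¹' (Metric.ball 0 r) = {z | z.re < Real.log r} := by
    ext z
    simp [Complex.norm_exp, Real.lt_log_iff_exp_lt h]
  rw [this]
  exact (convex_halfSpace_re_lt _).isPreconnected

theorem isPreconnected_compl_component {V : Set ℂ} (hV : IsOpen V) (c : IsPreconnected Vᶜ)
    (hne : Vᶜ.Nonempty) (x : ℂ) : IsPreconnected (connectedComponentIn V x)ᶜ := by
  rw [compl_eq_univ_sdiff] at c hne ⊢
  exact isPreconnected_diff_component isPreconnected_univ hV (subset_univ _) c hne x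

set_option maxHeartbeats 400000 in
/-- A collar on the inner side of a curve surrounding the origin. -/
theorem exists_plane_collar {J In Out N : Set ℂ} (hIn : IsOpen In) (hOut : IsOpen Out)
    (cIn : IsPreconnected In) (cOut : IsPreconnected Out) (hdis : Disjoint In Out)
    (hU : In ∪ Out = Jᶜ) (h0 : (0 : ℂ) ∈ In) (hb : Bornology.IsBounded In) {R : ℝ}
    (hR : ∀ z : ℂ, R ≤ ‖z‖ → z ∈ Out) (hJI : J ⊆ closure In) (hJO : J ⊆ closure Out)
    (hJne : J.Nonempty) (hN : IsOpen N) (hJN : J ⊆ N) :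
    ∃ O O' H : Set ℂ, IsOpen O ∧ IsOpen O' ∧ J ∪ Out ⊆ O' ∧ O' ⊆ O ∧ (0 : ℂ) ∉ O ∧ O ∩ In ⊆ N ∧
      IsPreconnected (O ∩ In) ∧ H ⊆ O ∩ In ∧ IsPreconnected H ∧ H.Nonempty ∧ O' ∩ In ⊆ H ∧
      IsCompact (H ∪ J) ∧ IsOpen ((O ∩ In) \ H) ∧ IsPreconnected ((O ∩ In) \ H) ∧
      ((O ∩ In) \ H).Nonempty ∧ IsPreconnected (Complex.exp ⁻¹' ((O ∩ In) \ H)) := by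
  have hclIn : closure In = In ∪ J := by
    refine Subset.antisymm (fun z hz ↦ ?_) (union_subset subset_closure hJI)
    by_contra hcon
    have hzO : z ∈ In ∪ Out := by rw [hU]; exact fun h ↦ hcon (Or.inr h)
    exact disjoint_left.1 (hdis.closure_left hOut) hz (hzO.resolve_left fun h ↦ hcon (Or.inl h))
  have hbc : IsCompact (closure In) := hb.isCompact_closure
  have hJIn : Disjoint J In := disjoint_left.2 fun x hx h ↦
    (show x ∉ J by rw [← mem_compl_iff, ← hU]; exact Or.inl h) hx
  have hK1 : IsCompact (In \ N) := by
    have : In \ N = closure In \ N := by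
      rw [hclIn, union_sdiff_distrib, sdiff_eq_empty.2 hJN, union_empty]
    rw [this]; exact hbc.diff hN
  obtain ⟨K, hK, cK, hK0, hK1K, hKIn⟩ := exists_compact_connected_between hIn cIn hK1 sdiff_subset
    h0
  have hRout : (R : ℂ) ∈ Out := hR _ (by simpa using le_abs_self R)
  obtain ⟨r, hr⟩ : ∃ r : ℂ, r = R := ⟨_, rfl⟩
  rw [← hr] at hRout
  have cB : IsPreconnected (J ∪ Out) :=
    cOut.subset_closure subset_union_right (union_subset hJO subset_closure)
  have hBc : J ∪ Out = Inᶜ := by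
    ext x
    refine ⟨fun h hI ↦ h.elim (fun hJ ↦ disjoint_left.1 hJIn hJ hI)
      (fun hO ↦ disjoint_left.1 hdis hI hO), fun h ↦ ?_⟩
    by_cases hJ : x ∈ J
    · exact Or.inl hJ
    · have : x ∈ In ∪ Out := by rw [hU]; exact hJ
      exact Or.inr (this.resolve_left h)
  have hcomp : ∀ K, IsCompact K → IsPreconnected K → (0 : ℂ) ∈ K → K ⊆ In →
      IsOpen (connectedComponentIn Kᶜ r) ∧ IsPreconnected (connectedComponentIn Kᶜ r) ∧
      J ∪ Out ⊆ connectedComponentIn Kᶜ r ∧ IsPreconnected (connectedComponentIn Kᶜ r)ᶜ ∧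
      connectedComponentIn Kᶜ r ⊆ Kᶜ := by
    intro K hK cK h0 hKI
    have ho := hK.isClosed.isOpen_compl
    refine ⟨ho.connectedComponentIn, isPreconnected_connectedComponentIn,
      cB.subset_connectedComponentIn (Or.inr hRout) (by rw [hBc]; exact compl_subset_compl.2 hKI),
      isPreconnected_compl_component ho ?_ ?_ _, connectedComponentIn_subset _ _⟩
    · rwa [compl_compl]
    · rw [compl_compl]; exact ⟨0, h0⟩
  obtain ⟨hO, cO, hBO, cOc, hOK⟩ := hcomp K hK cK hK0 hKIn
  set O := connectedComponentIn Kᶜ r with hOdef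
  have hOcIn : Oᶜ ⊆ In := by rw [← compl_compl In, ← hBc]; exact compl_subset_compl.2 hBO
  have h0O : (0 : ℂ) ∈ Oᶜ := fun h ↦ hOK h hK0
  have hOcc : IsCompact Oᶜ := hbc.of_isClosed_subset hO.isClosed_compl (hOcIn.trans subset_closure)
  obtain ⟨K', hK', cK', hK'0, hKK', hK'In⟩ :=
    exists_compact_connected_between hIn cIn hOcc hOcIn h0
  obtain ⟨hO', cO', hBO', cOc', hOK'⟩ := hcomp K' hK' cK' hK'0 hK'In
  set O' := connectedComponentIn K'ᶜ r with hO'def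
  have hO'cIn : O'ᶜ ⊆ In := by rw [← compl_compl In, ← hBc]; exact compl_subset_compl.2 hBO'
  have hO'cl : Disjoint (closure O') (interior K') :=
    Disjoint.closure_left (disjoint_left.2 fun x hx h ↦ hOK' hx (interior_subset h)) isOpen_interior
  have hO'O : O' ⊆ O := fun x hx ↦ by
    by_contra h
    exact hOK' hx (interior_subset (hKK' h))
  set V := (closure O')ᶜ with hVdef
  have hV : IsOpen V := isClosed_closure.isOpen_compl
  have hVIn : V ⊆ In := (compl_subset_compl.2 subset_closure).trans hO'cIn
  have hOcV : Oᶜ ⊆ V := fun x hx h ↦ disjoint_left.1 hO'cl h (hKK' hx)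
  set I' := connectedComponentIn V 0 with hI'
  have hI'o : IsOpen I' := hV.connectedComponentIn
  have hI'V : I' ⊆ V := connectedComponentIn_subset _ _
  have hI'In : I' ⊆ In := hI'V.trans hVIn
  have hOcI' : Oᶜ ⊆ I' := cOc.subset_connectedComponentIn h0O hOcV
  have hOI' : O ∪ I' = univ := eq_univ_of_forall fun x ↦ by
    by_cases h : x ∈ O
    · exact Or.inl h
    · exact Or.inr (hOcI' h)
  have hOIn : O ∪ In = univ := eq_univ_of_forall fun x ↦ by
    by_cases h : x ∈ O
    · exact Or.inl h
    · exact Or.inr (hOcIn h)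
  have hO'In : O' ∪ In = univ := eq_univ_of_forall fun x ↦ by
    by_cases h : x ∈ O'
    · exact Or.inl h
    · exact Or.inr (hO'cIn h)
  have hL : (O ∩ In) \ (In \ I') = O ∩ I' := by
    ext x
    exact ⟨fun h ↦ ⟨h.1.1, by_contra fun h' ↦ h.2 ⟨h.1.2, h'⟩⟩,
      fun h ↦ ⟨⟨h.1, hI'In h.2⟩, fun h' ↦ h'.2 h.2⟩⟩
  have cI' : IsPreconnected I' := isPreconnected_connectedComponentIn
  have hO'H : O' ∩ In ⊆ In \ I' := fun x hx ↦ ⟨hx.2, fun h ↦ hI'V h (subset_closure hx.1)⟩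
  obtain ⟨b, hbJ⟩ := hJne
  have hne : (O' ∩ In).Nonempty :=
    mem_closure_iff.1 (hJI hbJ) O' hO' (hBO' (Or.inl hbJ))
  have h0I' : (0 : ℂ) ∈ I' := hOcI' h0O
  refine ⟨O, O', In \ I', hO, hO', hBO', hO'O, h0O, ?_, ?_, ?_, ?_, hne.mono hO'H, hO'H, ?_, ?_, ?_,
    ?_, ?_⟩
  · rintro x ⟨hx, hxI⟩
    by_contra h
    exact hOK hx (interior_subset (hK1K ⟨hxI, h⟩))
  · exact isPreconnected_inter_of_union_eq_univ hO hIn cO cIn hOIn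
  · rintro x ⟨hx, hxI⟩
    exact ⟨by_contra fun h ↦ hxI (hOcI' h), hx⟩
  · have c1 := isPreconnected_inter_of_union_eq_univ hO' hIn cO' cIn hO'In
    have e : In \ V = In ∩ closure O' := by rw [hVdef, sdiff_compl]
    refine isPreconnected_diff_component cIn hV hVIn ?_ ?_ 0
    · rw [e]
      refine c1.subset_closure (fun x hx ↦ ⟨hx.2, subset_closure hx.1⟩) ?_
      rw [inter_comm O']
      exact hIn.inter_closure
    · rw [e]; exact hne.mono fun x hx ↦ ⟨hx.2, subset_closure hx.1⟩
  · have : In \ I' ∪ J = closure In \ I' := by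
      rw [hclIn, union_sdiff_distrib, (hJIn.mono_right hI'In).sdiff_eq_left]
    rw [this]
    exact hbc.diff hI'o
  · rw [hL]; exact hO.inter hI'o
  · rw [hL]; exact isPreconnected_inter_of_union_eq_univ hO hI'o cO cI' hOI'
  · rw [hL]
    have := isPreconnected_univ (α := ℂ) O I' hO hI'o hOI'.ge ⟨r, trivial, hBO (Or.inr hRout)⟩
      ⟨0, trivial, h0I'⟩
    simpa using this
  · rw [hL, preimage_inter]
    obtain ⟨s, hs, hsI⟩ := Metric.isOpen_iff.1 hI'o 0 h0I'
    refine isPreconnected_inter_of_union_eq_univ (hO.preimage Complex.continuous_exp)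
      (hI'o.preimage Complex.continuous_exp) ?_ ?_ ?_
    · exact isPreconnected_exp_preimage hO cO h0O (B := {z | R ≤ ‖z‖})
        (fun z hz ↦ hBO (Or.inr (hR z hz))) ⟨r, by simpa [hr] using le_abs_self R⟩
        (isPreconnected_exp_preimage_norm_ge R)
    · have e : Complex.exp ⁻¹' I' = Complex.exp ⁻¹' (I' \ {0}) := by
        ext z; simp
      have e2 : Complex.exp ⁻¹' (Metric.ball 0 s \ {0}) = Complex.exp ⁻¹' (Metric.ball 0 s) := by
        ext z; simp
      rw [e]
      refine isPreconnected_exp_preimage (hI'o.sdiff isClosed_singleton) ?_ (by simp)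
        (B := Metric.ball 0 s \ {0}) (sdiff_subset_sdiff_left hsI) ?_ ?_
      · exact isPreconnected_diff_point hI'o cI' (φ := id) IsOpenEmbedding.id 0
      · exact ⟨(s / 2 : ℝ), by simp [abs_of_pos hs, hs, hs.ne']⟩
      · rw [e2]; exact isPreconnected_exp_preimage_ball hs
    · rw [← preimage_union, hOI', preimage_univ]

/-- The punctured plane. -/
abbrev PuncturedPlane := {z : ℂ // z ≠ 0}

/-- The universal cover of an annulus parametrized by the punctured plane. -/
def expCover {A : Type*} [TopologicalSpace A] (e : PuncturedPlane ≃ₜ A) (z : ℂ) : A :=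
  e ⟨Complex.exp z, z.exp_ne_zero⟩

/-- The side `E` of the curve `J` has collars inside any neighbourhood of `J`. -/
def HasCollars {A : Type*} [TopologicalSpace A] (e : PuncturedPlane ≃ₜ A) (J E F : Set A) : Prop :=
  ∀ N, IsOpen N → J ⊆ N → ∃ O O' H : Set A, IsOpen O ∧ IsOpen O' ∧ J ∪ F ⊆ O' ∧ O' ⊆ O ∧
    O ∩ E ⊆ N ∧ IsPreconnected (O ∩ E) ∧ H ⊆ O ∩ E ∧ IsPreconnected H ∧ H.Nonempty ∧
    O' ∩ E ⊆ H ∧ IsCompact (H ∪ J) ∧ IsOpen ((O ∩ E) \ H) ∧ IsPreconnected ((O ∩ E) \ H) ∧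
    ((O ∩ E) \ H).Nonempty ∧ IsPreconnected (expCover e ⁻¹' ((O ∩ E) \ H))

section

variable {A : Type*} [TopologicalSpace A] (e : PuncturedPlane ≃ₜ A)

theorem isOpenEmbedding_coord : IsOpenEmbedding (fun x ↦ (e.symm x : ℂ)) :=
  isOpen_ne.isOpenEmbedding_subtypeVal.comp e.symm.isOpenEmbedding

theorem subset_range_coord {S : Set ℂ} (h : (0 : ℂ) ∉ S) : S ⊆ range (fun x ↦ (e.symm x : ℂ)) :=
  fun z hz ↦ ⟨e ⟨z, fun h' ↦ h (h' ▸ hz)⟩, by simp⟩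

theorem isPreconnected_coord_preimage {S : Set ℂ} (h : (0 : ℂ) ∉ S) (c : IsPreconnected S) :
    IsPreconnected ((fun x ↦ (e.symm x : ℂ)) ⁻¹' S) :=
  c.preimage_of_isOpenMap (isOpenEmbedding_coord e).injective (isOpenEmbedding_coord e).isOpenMap
    (subset_range_coord e h)

theorem nonempty_coord_preimage {S : Set ℂ} (h : (0 : ℂ) ∉ S) (c : S.Nonempty) :
    ((fun x ↦ (e.symm x : ℂ)) ⁻¹' S).Nonempty := by
  obtain ⟨z, hz⟩ := c
  obtain ⟨x, rfl⟩ := subset_range_coord e h hz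
  exact ⟨x, hz⟩

theorem exists_inner_side {f : Circle1 → A} (hf : Continuous f) (hi : Function.Injective f)
    (hess : ¬ HasLogOn (fun t ↦ (e.symm (f t) : ℂ)) univ) :
    ∃ E F : Set A, IsOpen E ∧ IsOpen F ∧ IsPreconnected E ∧ IsPreconnected F ∧ Disjoint E F ∧
      E ∪ F = (range f)ᶜ ∧ range f ⊆ closure E ∧ range f ⊆ closure F ∧
      (∃ r > 0, ∀ x, ‖(e.symm x : ℂ)‖ < r → x ∈ E) ∧
      (∃ R > 0, ∀ x, R ≤ ‖(e.symm x : ℂ)‖ → x ∈ F) ∧ ¬ IsCompact (E ∪ range f) ∧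
      HasCollars e (range f) E F := by
  have hj := isOpenEmbedding_coord e
  obtain ⟨In, Out, hIn, hOut, cIn, cOut, hdis, hU, h0, hb, ⟨R, hR0, hR⟩, hJI, hJO⟩ :=
    jordan_essential (hj.continuous.comp hf) (hj.injective.comp hi) (fun t ↦ (e.symm (f t)).2) hess
  set j : A → ℂ := fun x ↦ (e.symm x : ℂ) with hjdef
  have h0O : (0 : ℂ) ∉ Out := fun h ↦ disjoint_left.1 hdis h0 h
  have hpre : j ⁻¹' range (j ∘ f) = range f := by
    rw [range_comp, preimage_image_eq _ hj.injective]
  have hcl : ∀ S : Set ℂ, range (j ∘ f) ⊆ closure S → range f ⊆ closure (j ⁻¹' S) := by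
    intro S hS
    rw [← hj.isOpenMap.preimage_closure_eq_closure_preimage hj.continuous, ← hpre]
    exact preimage_mono hS
  have e1 : j ⁻¹' In = j ⁻¹' (In \ {0}) := by
    ext x; simp [hjdef, (e.symm x).2]
  obtain ⟨s, hs, hsI⟩ := Metric.isOpen_iff.1 hIn 0 h0
  refine ⟨j ⁻¹' In, j ⁻¹' Out, hIn.preimage hj.continuous, hOut.preimage hj.continuous, ?_,
    isPreconnected_coord_preimage e h0O cOut, hdis.preimage j, ?_, hcl _ hJI, hcl _ hJO,
    ⟨s, hs, fun x hx ↦ hsI (by simpa using hx)⟩, ⟨R, hR0, fun x hx ↦ hR _ hx⟩, ?_, ?_⟩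
  · rw [e1]
    exact isPreconnected_coord_preimage e (by simp)
      (isPreconnected_diff_point hIn cIn (φ := id) IsOpenEmbedding.id 0)
  · rw [← preimage_union, hU, preimage_compl, hpre]
  · intro hc
    have hcl := (hc.image hj.continuous).isClosed
    have : (0 : ℂ) ∈ closure (j '' (j ⁻¹' In ∪ range f)) := by
      refine Metric.mem_closure_iff.2 fun δ hδ ↦ ?_
      have hpos : 0 < min s δ / 2 := by positivity
      have hne : ((min s δ / 2 : ℝ) : ℂ) ≠ 0 := by exact_mod_cast hpos.ne'
      have hlt : min s δ / 2 < min s δ := by linarith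
      refine ⟨_, ⟨e ⟨_, hne⟩, Or.inl (hsI ?_), rfl⟩, ?_⟩
      · simp only [hjdef, Homeomorph.symm_apply_apply, Metric.mem_ball, dist_zero_right,
          Complex.norm_real, Real.norm_eq_abs, abs_of_pos hpos]
        exact hlt.trans_le (min_le_left _ _)
      · simp only [hjdef, Homeomorph.symm_apply_apply, dist_zero_left,
          Complex.norm_real, Real.norm_eq_abs, abs_of_pos hpos]
        exact hlt.trans_le (min_le_right _ _)
    rw [hcl.closure_eq] at this
    obtain ⟨x, -, hx⟩ := this
    exact (e.symm x).2 hx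
  · intro N hN hJN
    obtain ⟨O, O', H, hO, hO', hJO', hO'O, h0O, hON, c1, hH, cH, nH, hO'H, kH, oL, cL, nL, eL⟩ :=
      exists_plane_collar hIn hOut cIn cOut hdis hU h0 hb hR hJI hJO (range_nonempty _)
        (hj.isOpenMap _ hN) (by rw [range_comp]; exact image_mono hJN)
    have h0' : ∀ S ⊆ O, (0 : ℂ) ∉ S := fun S hS h ↦ h0O (hS h)
    refine ⟨j ⁻¹' O, j ⁻¹' O', j ⁻¹' H, hO.preimage hj.continuous, hO'.preimage hj.continuous, ?_,
      preimage_mono hO'O, ?_, isPreconnected_coord_preimage e (h0' _ inter_subset_left) c1,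
      preimage_mono hH, isPreconnected_coord_preimage e (h0' _ (hH.trans inter_subset_left)) cH,
      nonempty_coord_preimage e (h0' _ (hH.trans inter_subset_left)) nH, preimage_mono hO'H, ?_,
      oL.preimage hj.continuous,
      isPreconnected_coord_preimage e (h0' _ (sdiff_subset.trans inter_subset_left)) cL,
      nonempty_coord_preimage e (h0' _ (sdiff_subset.trans inter_subset_left)) nL, ?_⟩
    · rw [← hpre]; exact preimage_mono hJO'
    · intro x hx
      obtain ⟨y, hy, hyx⟩ := hON hx
      exact hj.injective hyx ▸ hy
    · rw [← hpre, ← preimage_union]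
      refine (hj.isInducing.isCompact_preimage_iff ?_).2 kH
      exact union_subset (subset_range_coord e (h0' _ (hH.trans inter_subset_left)))
        (range_comp_subset_range _ _)
    · convert eL using 1
      ext z
      simp [expCover, hjdef]

/-- Inversion of the punctured plane. -/
def puncturedInv : PuncturedPlane ≃ₜ PuncturedPlane where
  toFun z := ⟨z.1⁻¹, inv_ne_zero z.2⟩
  invFun z := ⟨z.1⁻¹, inv_ne_zero z.2⟩
  left_inv z := by simp
  right_inv z := by simp
  continuous_toFun := Continuous.subtype_mk (continuous_subtype_val.inv₀ fun z ↦ z.2) _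
  continuous_invFun := Continuous.subtype_mk (continuous_subtype_val.inv₀ fun z ↦ z.2) _

theorem expCover_inv (z : ℂ) : expCover (puncturedInv.trans e) z = expCover e (-z) := by
  simp [expCover, puncturedInv, Complex.exp_neg]

theorem coord_inv (x : A) : (((puncturedInv.trans e).symm x : PuncturedPlane) : ℂ) =
    (e.symm x : ℂ)⁻¹ := rfl

theorem HasCollars.of_inv {J E F : Set A} (h : HasCollars (puncturedInv.trans e) J E F) :
    HasCollars e J E F := by
  intro N hN hJ
  obtain ⟨O, O', H, h1, h2, h3, h4, h5, h6, h7, h8, h9, h10, h11, h12, h13, h14, h15⟩ := h N hN hJ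
  refine ⟨O, O', H, h1, h2, h3, h4, h5, h6, h7, h8, h9, h10, h11, h12, h13, h14, ?_⟩
  have : expCover e ⁻¹' ((O ∩ E) \ H) =
      (fun z ↦ -z) '' (expCover (puncturedInv.trans e) ⁻¹' ((O ∩ E) \ H)) := by
    ext z
    constructor
    · intro hz
      refine ⟨-z, ?_, neg_neg z⟩
      rw [mem_preimage, expCover_inv, neg_neg]
      exact hz
    · rintro ⟨w, hw, rfl⟩
      rw [mem_preimage, expCover_inv] at hw
      exact hw
  rw [this]
  exact h15.image _ continuous_neg.continuousOn

theorem exists_sides {f : Circle1 → A} (hf : Continuous f) (hi : Function.Injective f)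
    (hess : ¬ HasLogOn (fun t ↦ (e.symm (f t) : ℂ)) univ) :
    ∃ E F : Set A, IsOpen E ∧ IsOpen F ∧ IsPreconnected E ∧ IsPreconnected F ∧ Disjoint E F ∧
      E ∪ F = (range f)ᶜ ∧ range f ⊆ closure E ∧ range f ⊆ closure F ∧
      ¬ IsCompact (E ∪ range f) ∧ ¬ IsCompact (F ∪ range f) ∧
      HasCollars e (range f) E F ∧ HasCollars e (range f) F E := by
  obtain ⟨E, F, oE, oF, cE, cF, hd, hU, hE, hF, ⟨r, hr, hrE⟩, ⟨R, hR, hRF⟩, kE, colE⟩ :=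
    exists_inner_side e hf hi hess
  obtain ⟨E', F', oE', oF', cE', cF', hd', hU', hE', hF', ⟨r', hr', hrE'⟩, -, kE', colE'⟩ :=
    exists_inner_side (puncturedInv.trans e) hf hi (fun ⟨g, hg, he⟩ ↦ hess ⟨fun t ↦ -g t, hg.neg,
      fun t ht ↦ by
        have : Complex.exp (g t) = (e.symm (f t) : ℂ)⁻¹ := he t ht
        simp only [Complex.exp_neg, this, inv_inv]⟩)
  have sub : ∀ {S P Q : Set A}, IsPreconnected S → IsOpen P → IsOpen Q → Disjoint P Q →
      S ⊆ P ∪ Q → (S ∩ P).Nonempty → S ⊆ P := by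
    intro S P Q cS oP oQ hPQ hS ⟨x, hxS, hxP⟩
    rcases cS.subset_or_subset oP oQ hPQ hS with h | h
    · exact h
    · exact absurd (h hxS) (disjoint_left.1 hPQ hxP)
  have hUU : E ∪ F = E' ∪ F' := hU.trans hU'.symm
  -- a point near the outer end
  obtain ⟨x, hxF, hxE'⟩ : ∃ x, x ∈ F ∧ x ∈ E' := by
    have hpos : 0 < max R (r'⁻¹ + 1) := lt_max_of_lt_left hR
    have hne : ((max R (r'⁻¹ + 1) : ℝ) : ℂ) ≠ 0 := by exact_mod_cast hpos.ne'
    refine ⟨e ⟨_, hne⟩, hRF _ ?_, hrE' _ ?_⟩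
    · simp [abs_of_pos hpos]
    · rw [coord_inv, norm_inv]
      simp only [Homeomorph.symm_apply_apply, Complex.norm_real, Real.norm_eq_abs, abs_of_pos hpos]
      refine inv_lt_of_inv_lt₀ hr' ?_
      exact (lt_add_one _).trans_le (le_max_right _ _)
  have h1 : F = E' := by
    refine Subset.antisymm (sub cF oE' oF' hd' (subset_union_right.trans hUU.subset) ⟨x, hxF, hxE'⟩)
      (sub cE' oF oE hd.symm ?_ ⟨x, hxE', hxF⟩)
    rw [union_comm, hUU]; exact subset_union_left
  have h2 : E = F' := by
    subst h1
    have a : E = (E ∪ F) \ F := by rw [union_sdiff_right, hd.sdiff_eq_left]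
    have b : F' = (F ∪ F') \ F := by rw [union_sdiff_left, hd'.symm.sdiff_eq_left]
    rw [a, hUU, ← b]
  subst h1 h2
  exact ⟨E, F, oE, oF, cE, cF, hd, hU, hE, hF, kE, kE', colE, colE'.of_inv⟩

end

theorem nonempty_puncturedPlane_homeomorph :
    Nonempty (PuncturedPlane ≃ₜ Circle1 × ℝ) := by
  have hc : Nonempty (Circle1 ≃ₜ Circle) := ⟨AddCircle.homeomorphCircle one_ne_zero⟩
  obtain ⟨h⟩ := hc
  refine ⟨((h.prodCongr (Homeomorph.refl ℝ)).trans (?_ : Circle × ℝ ≃ₜ PuncturedPlane)).symm⟩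
  refine
    { toFun := fun x ↦ ⟨(x.1 : ℂ) * (Real.exp x.2 : ℂ), mul_ne_zero x.1.coe_ne_zero
          (by exact_mod_cast (Real.exp_pos _).ne')⟩
      invFun := fun z ↦ (⟨(z : ℂ) / (‖(z : ℂ)‖ : ℂ), by
          refine mem_sphere_zero_iff_norm.2 ?_
          rw [norm_div, Complex.norm_real, norm_norm, div_self (norm_ne_zero_iff.2 z.2)]⟩, Real.log
            ‖(z : ℂ)‖)
      left_inv := ?_
      right_inv := ?_
      continuous_toFun := ?_
      continuous_invFun := ?_ }
  · rintro ⟨u, t⟩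
    have h1 : ‖(u : ℂ) * (Real.exp t : ℂ)‖ = Real.exp t := by
      rw [norm_mul, Circle.norm_coe, one_mul, Complex.norm_real, Real.norm_eq_abs,
        abs_of_pos (Real.exp_pos _)]
    ext1
    · apply Circle.ext
      change ((u : ℂ) * (Real.exp t : ℂ)) / (‖(u : ℂ) * (Real.exp t : ℂ)‖ : ℂ) = u
      rw [h1]
      exact mul_div_cancel_right₀ _ (by exact_mod_cast (Real.exp_pos _).ne')
    · change Real.log ‖(u : ℂ) * (Real.exp t : ℂ)‖ = t
      rw [h1, Real.log_exp]
  · intro z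
    have h0 : ‖(z : ℂ)‖ ≠ 0 := norm_ne_zero_iff.2 z.2
    apply Subtype.ext
    change ((z : ℂ) / (‖(z : ℂ)‖ : ℂ)) * (Real.exp (Real.log ‖(z : ℂ)‖) : ℂ) = z
    rw [Real.exp_log (norm_pos_iff.2 z.2)]
    exact div_mul_cancel₀ _ (by exact_mod_cast h0)
  · refine Continuous.subtype_mk ?_ _
    fun_prop
  · refine Continuous.prodMk (Continuous.subtype_mk ?_ _) ?_
    · refine Continuous.div (by fun_prop) (by fun_prop) fun z ↦ ?_
      exact_mod_cast norm_ne_zero_iff.2 z.2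
    · exact Continuous.log (by fun_prop) fun z ↦ norm_ne_zero_iff.2 z.2

section

variable {A : Type*} [TopologicalSpace A]

theorem expCover_surjective (e : PuncturedPlane ≃ₜ A) : Function.Surjective (expCover e) := by
  intro x
  refine ⟨Complex.log (e.symm x), ?_⟩
  rw [expCover]
  have : (⟨Complex.exp (Complex.log (e.symm x)), Complex.exp_ne_zero _⟩ : PuncturedPlane)
      = e.symm x := Subtype.ext (Complex.exp_log (e.symm x).2)
  rw [this, Homeomorph.apply_symm_apply]

theorem isCoveringMap_expCover (e : PuncturedPlane ≃ₜ A) : IsCoveringMap (expCover e) :=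
  Complex.isCoveringMap_exp.homeomorph_comp e

theorem continuous_expCover (e : PuncturedPlane ≃ₜ A) : Continuous (expCover e) :=
  (isCoveringMap_expCover e).continuous

theorem not_hasLogOn_of_essential {T : Type*} [TopologicalSpace T] (e : PuncturedPlane ≃ₜ A)
    {p : A → T} (hp : Continuous p) {f : Circle1 → A} (F : C(Circle1, T)) (hF : ∀ t, F t = p (f t))
    (hess : ¬ ∃ x, F.Homotopic (ContinuousMap.const Circle1 x)) :
    ¬ HasLogOn (fun t ↦ (e.symm (f t) : ℂ)) univ := by
  rintro ⟨g, hg, he⟩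
  rw [continuousOn_univ] at hg
  have h1 : ∀ t, expCover e (g t) = f t := by
    intro t
    have : (⟨Complex.exp (g t), Complex.exp_ne_zero _⟩ : PuncturedPlane) = e.symm (f t) :=
      Subtype.ext (he t trivial)
    rw [expCover, this, Homeomorph.apply_symm_apply]
  have hc := continuous_expCover e
  refine hess ⟨p (expCover e 0), ⟨⟨⟨fun x ↦ p (expCover e (((1 - (x.1 : ℝ) : ℝ) : ℂ) * g x.2)), ?_⟩,
    ?_, ?_⟩⟩⟩
  · fun_prop
  · intro t
    simp [h1, hF]
  · intro t
    simp

/-- A collar `H` of the curve `J` on the side `E`, inside `O ∩ E`. -/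
structure IsCollar (e : PuncturedPlane ≃ₜ A) (N J E F O O' H : Set A) : Prop where
  oO : IsOpen O
  oO' : IsOpen O'
  sub' : J ∪ F ⊆ O'
  O'O : O' ⊆ O
  subN : O ∩ E ⊆ N
  cOE : IsPreconnected (O ∩ E)
  HO : H ⊆ O ∩ E
  cH : IsPreconnected H
  neH : H.Nonempty
  O'H : O' ∩ E ⊆ H
  kH : IsCompact (H ∪ J)
  oD : IsOpen ((O ∩ E) \ H)
  cD : IsPreconnected ((O ∩ E) \ H)
  neD : ((O ∩ E) \ H).Nonempty
  cexp : IsPreconnected (expCover e ⁻¹' ((O ∩ E) \ H))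

/-- A lift `J` of a curve `δ` to an annular cover with its two sides, a neighbourhood to which
the covering map restricts injectively, and collars on both sides. -/
structure Frame {T : Type*} (e : PuncturedPlane ≃ₜ A) (p : A → T) (δ : Set T) (J : Set A) where
  (E F N O O' H P P' G : Set A)
  pJ : p '' J = δ
  kJ : IsCompact J
  cJ : IsPreconnected J
  neJ : J.Nonempty
  oE : IsOpen E
  oF : IsOpen F
  cE : IsPreconnected E
  cF : IsPreconnected F
  disj : Disjoint E F
  union : E ∪ F = Jᶜ
  clE : J ⊆ closure E
  clF : J ⊆ closure F
  nkE : ¬ IsCompact (E ∪ J)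
  nkF : ¬ IsCompact (F ∪ J)
  oN : IsOpen N
  JN : J ⊆ N
  iN : InjOn p N
  colE : IsCollar e N J E F O O' H
  colF : IsCollar e N J F E P P' G

/-- Exchange the two sides of a frame. -/
def Frame.symm {T : Type*} {e : PuncturedPlane ≃ₜ A} {p : A → T} {δ : Set T} {J : Set A}
    (fr : Frame e p δ J) : Frame e p δ J where
  E := fr.F
  F := fr.E
  N := fr.N
  O := fr.P
  O' := fr.P'
  H := fr.G
  P := fr.O
  P' := fr.O'
  G := fr.H
  pJ := fr.pJ
  kJ := fr.kJ
  cJ := fr.cJ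
  neJ := fr.neJ
  oE := fr.oF
  oF := fr.oE
  cE := fr.cF
  cF := fr.cE
  disj := fr.disj.symm
  union := by rw [union_comm, fr.union]
  clE := fr.clF
  clF := fr.clE
  nkE := fr.nkF
  nkF := fr.nkE
  oN := fr.oN
  JN := fr.JN
  iN := fr.iN
  colE := fr.colF
  colF := fr.colE

theorem nonempty_frame {T : Type} [TopologicalSpace T] [T2Space T] (e : PuncturedPlane ≃ₜ A)
    {p : A → T} (hp : IsCoveringMap p) {δ : Set T} {J : Set A} (kJ : IsCompact J)
    (bJ : BijOn p J δ) (hδ : IsEssentialSCC δ) : Nonempty (Frame e p δ J) := by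
  have : T2Space A := e.symm.isEmbedding.t2Space
  obtain ⟨⟨φ, hφi, hφr⟩, hess⟩ := hδ
  have : CompactSpace J := isCompact_iff_compactSpace.1 kJ
  have hmem : ∀ t, φ t ∈ p '' J := fun t ↦ bJ.image_eq ▸ hφr ▸ mem_range_self t
  -- the inverse of `p` on the curve
  have hemb : IsClosedEmbedding (fun x : J ↦ p x) :=
    (hp.continuous.comp continuous_subtype_val).isClosedEmbedding
      (fun x y h ↦ Subtype.ext (bJ.injOn x.2 y.2 h))
  choose f hfJ hpf using hmem
  have hf : Continuous f := by
    have h1 : Continuous (fun t ↦ (⟨f t, hfJ t⟩ : J)) := by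
      rw [hemb.isInducing.continuous_iff]
      have : (fun x : J ↦ p x) ∘ (fun t ↦ (⟨f t, hfJ t⟩ : J)) = φ := funext hpf
      rw [this]
      exact φ.continuous
    exact continuous_subtype_val.comp h1
  have hi : Function.Injective f := fun s t h ↦ hφi (by rw [← hpf, ← hpf, h])
  have hr : range f = J := by
    apply Subset.antisymm
    · rintro _ ⟨t, rfl⟩
      exact hfJ t
    · intro x hx
      obtain ⟨t, ht⟩ : p x ∈ range φ := hφr ▸ bJ.mapsTo hx
      exact ⟨t, bJ.injOn (hfJ t) hx (by rw [hpf, ht])⟩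
  obtain ⟨E, F, oE, oF, cE, cF, hd, hu, clE, clF, nkE, nkF, colE, colF⟩ :=
    exists_sides e hf hi (not_hasLogOn_of_essential e hp.continuous φ (fun t ↦ (hpf t).symm)
      (hess φ hφr))
  rw [hr] at hu clE clF nkE nkF colE colF
  obtain ⟨N, hN, iN⟩ : ∃ N ∈ 𝓝ˢ J, InjOn p N := by
    refine bJ.injOn.exists_mem_nhdsSet kJ (fun x _ ↦ hp.continuous.continuousAt) fun x _ ↦ ?_
    obtain ⟨e', hx, he'⟩ := hp.isLocalHomeomorph x
    exact ⟨e'.source, e'.open_source.mem_nhds hx, he' ▸ e'.injOn⟩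
  obtain ⟨N', oN', hJN', hN'N⟩ := mem_nhdsSet_iff_exists.1 hN
  obtain ⟨O, O', H, h1, h2, h3, h4, h5, h6, h7, h8, h9, h10, h11, h12, h13, h14, h15⟩ :=
    colE N' oN' hJN'
  obtain ⟨P, P', G, g1, g2, g3, g4, g5, g6, g7, g8, g9, g10, g11, g12, g13, g14, g15⟩ :=
    colF N' oN' hJN'
  exact ⟨⟨E, F, N', O, O', H, P, P', G, bJ.image_eq, kJ, hr ▸ isPreconnected_range hf,
    hr ▸ range_nonempty f, oE, oF, cE, cF, hd, hu, clE, clF, nkE, nkF, oN', hJN', iN.mono hN'N,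
    ⟨h1, h2, h3, h4, h5, h6, h7, h8, h9, h10, h11, h12, h13, h14, h15⟩,
    ⟨g1, g2, g3, g4, g5, g6, g7, g8, g9, g10, g11, g12, g13, g14, g15⟩⟩⟩

end

/-- Every simple closed curve in `U` separates `U`. -/
def JordanIn {T : Type*} [TopologicalSpace T] (U : Set T) : Prop :=
  ∀ F : C(Circle1, T), Function.Injective F → range F ⊆ U → ¬ IsPreconnected (U \ range F)

/-- Every point of `T` is the centre of a planar chart. -/
def HasPlanarCharts (T : Type*) [TopologicalSpace T] : Prop :=
  ∀ x : T, ∃ φ : ℂ → T, IsOpenEmbedding φ ∧ φ 0 = x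

namespace Frame

variable {A T : Type*} [TopologicalSpace A] {e : PuncturedPlane ≃ₜ A} {p : A → T}
  {δ : Set T} {J : Set A}

theorem cases_mem (fr : Frame e p δ J) (x : A) : x ∈ fr.E ∨ x ∈ J ∨ x ∈ fr.F := by
  by_cases h : x ∈ J
  · exact Or.inr (Or.inl h)
  · have : x ∈ fr.E ∪ fr.F := fr.union ▸ h
    rcases this with h | h
    · exact Or.inl h
    · exact Or.inr (Or.inr h)

theorem notMem_of_mem_E (fr : Frame e p δ J) {x : A} (h : x ∈ fr.E) : x ∉ J := by
  have : x ∈ Jᶜ := fr.union ▸ Or.inl h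
  exact this

theorem notMem_of_mem_F (fr : Frame e p δ J)
    {x : A} (h : x ∈ fr.F) : x ∉ J := fr.symm.notMem_of_mem_E h

theorem J_subset_O (fr : Frame e p δ J)
    : J ⊆ fr.O := fun _ h ↦ fr.colE.O'O (fr.colE.sub' (Or.inl h))

theorem F_subset_O (fr : Frame e p δ J)
    : fr.F ⊆ fr.O := fun _ h ↦ fr.colE.O'O (fr.colE.sub' (Or.inr h))

theorem J_subset_P (fr : Frame e p δ J) : J ⊆ fr.P := fr.symm.J_subset_O

theorem E_subset_P (fr : Frame e p δ J) : fr.E ⊆ fr.P := fr.symm.F_subset_O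

theorem mem_J (fr : Frame e p δ J) {x : A} (hx : x ∈ fr.N) (h : p x ∈ δ) : x ∈ J := by
  rw [← fr.pJ] at h
  obtain ⟨y, hy, hxy⟩ := h
  exact fr.iN (fr.JN hy) hx hxy ▸ hy

theorem apply_mem (fr : Frame e p δ J)
    {x : A} (hx : x ∈ J) : p x ∈ δ := fr.pJ ▸ mem_image_of_mem p hx

theorem apply_notMem (fr : Frame e p δ J) {x : A} (hx : x ∈ fr.O ∩ fr.E) : p x ∉ δ := fun h ↦
  fr.notMem_of_mem_E hx.2 (fr.mem_J (fr.colE.subN hx) h)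

theorem injOn_component (fr : Frame e p δ J) [TopologicalSpace T] [T2Space T] [CompactSpace T]
    [LocallyConnectedSpace A] [LocallyConnectedSpace T] (hp : IsCoveringMap p)
    (ch : HasPlanarCharts T) {U : Set T} (hU : IsOpen U) (cU : IsPreconnected U)
    (sep : JordanIn U) (kU : IsClosed (U ∪ δ)) (hUδ : Disjoint U δ)
    (hB : p '' (fr.O ∩ fr.E) ⊆ U) {Y : Set T} (hYU : Y ⊆ U) (cY : IsPreconnected Y)
    (oY : IsOpen (U \ Y)) (hYH : Disjoint Y (p '' fr.H)) (hY : U ∩ p '' (fr.P' ∩ fr.F) ⊆ Y)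
    {m : A} (hm : m ∈ fr.H) : InjOn p (connectedComponentIn (p ⁻¹' (U \ Y)) m) := by
  have hop := hp.isOpenMap
  have hHB : p '' fr.H ⊆ p '' (fr.O ∩ fr.E) := image_mono fr.colE.HO
  have hJ : ∀ {x}, x ∈ U → x ∉ δ := fun h h' ↦ disjoint_left.1 hUδ h h'
  have oH : IsOpen (U \ p '' fr.H) := by
    have : U \ p '' fr.H = U \ p '' (fr.H ∪ J) := by
      rw [image_union, fr.pJ]
      ext x
      constructor
      · rintro ⟨h1, h2⟩
        exact ⟨h1, fun h ↦ h.elim h2 (hJ h1)⟩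
      · rintro ⟨h1, h2⟩
        exact ⟨h1, fun h ↦ h2 (Or.inl h)⟩
    rw [this]
    exact hU.sdiff ((fr.colE.kH.image hp.continuous).isClosed)
  have oM : IsOpen (fr.O ∩ fr.E) := fr.colE.oO.inter fr.oE
  have iM : InjOn p (fr.O ∩ fr.E) := fr.iN.mono fr.colE.subN
  have cUH : IsPreconnected (U \ p '' fr.H) := by
    refine isPreconnected_diff_of_ring cU (hop _ oM) hB hHB oH ?_
    have : p '' (fr.O ∩ fr.E) \ p '' fr.H = p '' ((fr.O ∩ fr.E) \ fr.H) :=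
      (iM.image_sdiff_subset fr.colE.HO).symm
    rw [this]
    exact fr.colE.cD.image _ hp.continuous.continuousOn
  have hfin : ∀ x ∈ U, x ∉ Y → ∀ w, p w = x → w ∈ fr.P' → w ∈ fr.E := by
    intro x hx hxY w hw hP
    rcases fr.cases_mem w with h | h | h
    · exact h
    · exact absurd (hw ▸ fr.apply_mem h) (hJ hx)
    · exact absurd (hY ⟨hx, w, ⟨hP, h⟩, hw⟩) hxY
  refine injOn_component_of_seed hp hU cU sep (fun x _ ↦ ch x) hYU cY oY fr.colE.cH hm ?_ oH cUH
    oM iM fr.colE.HO (K := (U ∪ δ) \ p '' (fr.O ∩ fr.P'))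
    (K' := (U ∪ δ) \ p '' (fr.O' ∩ fr.P')) ?_ ?_ ?_ ?_ ?_ ?_
  · intro x hx
    exact ⟨hB (hHB hx), fun h ↦ disjoint_left.1 hYH h hx⟩
  · exact (kU.sdiff (hop _ (fr.colE.oO.inter fr.colF.oO'))).isCompact
  · rintro x ⟨hx | hx, h⟩
    · refine ⟨hx, ?_⟩
      rintro ⟨w, hw, rfl⟩
      have := fr.colE.HO hw
      exact h ⟨w, ⟨this.1, fr.colF.sub' (Or.inr this.2)⟩, rfl⟩
    · rw [← fr.pJ] at hx
      obtain ⟨w, hw, rfl⟩ := hx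
      exact absurd ⟨w, ⟨fr.J_subset_O hw, fr.colF.sub' (Or.inl hw)⟩, rfl⟩ h
  · rintro x ⟨hx, h⟩
    rw [mem_union, not_or] at h
    have : x ∈ p '' (fr.O ∩ fr.P') := by
      by_contra hc
      exact h.2 ⟨Or.inl hx, hc⟩
    obtain ⟨w, hw, rfl⟩ := this
    exact ⟨w, ⟨hw.1, hfin _ hx h.1 w rfl hw.2⟩, rfl⟩
  · exact (kU.sdiff (hop _ (fr.colE.oO'.inter fr.colF.oO'))).isCompact
  · rintro x ⟨hx | hx, h⟩
    · exact hx
    · rw [← fr.pJ] at hx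
      obtain ⟨w, hw, rfl⟩ := hx
      exact absurd ⟨w, ⟨fr.colE.sub' (Or.inl hw), fr.colF.sub' (Or.inl hw)⟩, rfl⟩ h
  · rintro x ⟨hx, h⟩
    rw [mem_union, not_or] at h
    refine ⟨Or.inl hx, ?_⟩
    rintro ⟨w, hw, rfl⟩
    exact h.2 ⟨w, fr.colE.O'H ⟨hw.1, hfin _ hx h.1 w rfl hw.2⟩, rfl⟩

end Frame

/-- Two disjoint simple closed curves always disconnect `T`. -/
def TwoCurvesSeparate (T : Type) [TopologicalSpace T] : Prop :=
  ∀ c₁ c₂ : Set T, IsSCC c₁ → IsSCC c₂ → Disjoint c₁ c₂ → ¬ IsPreconnected (c₁ ∪ c₂)ᶜ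

namespace Frame

section

variable {A T : Type*} [TopologicalSpace A] {e : PuncturedPlane ≃ₜ A} {p : A → T}
  {δ : Set T} {J : Set A}

theorem isOpen_OE (fr : Frame e p δ J) : IsOpen (fr.O ∩ fr.E) := fr.colE.oO.inter fr.oE

theorem isOpen_PF (fr : Frame e p δ J) : IsOpen (fr.P ∩ fr.F) := fr.symm.isOpen_OE

theorem isOpen_core (fr : Frame e p δ J) : IsOpen (fr.O ∩ fr.P) := fr.colE.oO.inter fr.colF.oO

theorem core_eq (fr : Frame e p δ J) : fr.O ∩ fr.P = (fr.O ∩ fr.E) ∪ J ∪ (fr.P ∩ fr.F) := by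
  ext x
  constructor
  · rintro ⟨h1, h2⟩
    rcases fr.cases_mem x with h | h | h
    · exact Or.inl (Or.inl ⟨h1, h⟩)
    · exact Or.inl (Or.inr h)
    · exact Or.inr ⟨h2, h⟩
  · rintro ((⟨h, h'⟩ | h) | ⟨h, h'⟩)
    · exact ⟨h, fr.E_subset_P h'⟩
    · exact ⟨fr.J_subset_O h, fr.J_subset_P h⟩
    · exact ⟨fr.F_subset_O h', h⟩

theorem core_subset_N (fr : Frame e p δ J) : fr.O ∩ fr.P ⊆ fr.N := by
  rw [fr.core_eq]
  exact union_subset (union_subset fr.colE.subN fr.JN) fr.colF.subN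

theorem image_core (fr : Frame e p δ J)
    : p '' (fr.O ∩ fr.P) = p '' (fr.O ∩ fr.E) ∪ δ ∪ p '' (fr.P ∩ fr.F) := by
  rw [fr.core_eq, image_union, image_union, fr.pJ]

theorem nonempty_OE (fr : Frame e p δ J) : (fr.O ∩ fr.E).Nonempty := fr.colE.neH.mono fr.colE.HO

theorem nonempty_curve (fr : Frame e p δ J) : δ.Nonempty := fr.pJ ▸ fr.neJ.image p

theorem isCompact_curve (fr : Frame e p δ J)
    [TopologicalSpace T] (hp : Continuous p) : IsCompact δ :=
  fr.pJ ▸ fr.kJ.image hp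

theorem J_subset_closure (fr : Frame e p δ J) : J ⊆ closure (fr.O ∩ fr.E) := by
  intro x hx
  have h := fr.colE.oO.inter_closure (t := fr.E) ⟨fr.J_subset_O hx, fr.clE hx⟩
  exact h

theorem curve_subset_closure (fr : Frame e p δ J) [TopologicalSpace T] (hp : Continuous p) :
    δ ⊆ closure (p '' (fr.O ∩ fr.E)) := by
  have h := (image_mono fr.J_subset_closure).trans (image_closure_subset_closure_image hp)
  exact fr.pJ.symm.subset.trans h

theorem isPreconnected_image_OE (fr : Frame e p δ J) [TopologicalSpace T] (hp : Continuous p) :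
    IsPreconnected (p '' (fr.O ∩ fr.E)) := fr.colE.cOE.image p hp.continuousOn

theorem image_OE_subset (fr : Frame e p δ J) : p '' (fr.O ∩ fr.E) ⊆ δᶜ := by
  rintro _ ⟨x, hx, rfl⟩
  exact fr.apply_notMem hx

/-- A component of the complement of `δ` contains one of the two collars. -/
theorem component_contains (fr : Frame e p δ J)
    [TopologicalSpace T] [T2Space T] [PreconnectedSpace T]
    [LocallyConnectedSpace T] (hp : IsCoveringMap p) {x : T} (hx : x ∉ δ) :
    p '' (fr.O ∩ fr.E) ⊆ connectedComponentIn δᶜ x ∨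
      p '' (fr.P ∩ fr.F) ⊆ connectedComponentIn δᶜ x := by
  set V := connectedComponentIn δᶜ x with hV
  have cδ : IsClosed δ := (fr.isCompact_curve hp.continuous).isClosed
  have oV : IsOpen V := cδ.isOpen_compl.connectedComponentIn
  have hxV : x ∈ V := mem_connectedComponentIn hx
  have key : ∀ {S : Set T}, IsPreconnected S → S ⊆ δᶜ → (S ∩ V).Nonempty → S ⊆ V := by
    rintro S cS hS ⟨y, hyS, hyV⟩
    rw [hV, connectedComponentIn_eq hyV]
    exact cS.subset_connectedComponentIn hyS hS
  have hmeet : (p '' (fr.O ∩ fr.P) ∩ V).Nonempty := by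
    by_contra hn
    have hcl : IsClosed V := by
      rw [← isOpen_compl_iff]
      have : Vᶜ = p '' (fr.O ∩ fr.P) ∪ ⋃ y ∈ (δᶜ \ V), connectedComponentIn δᶜ y := by
        ext y
        simp only [mem_compl_iff, mem_union, mem_iUnion, exists_prop]
        constructor
        · intro hy
          by_cases hyδ : y ∈ δ
          · left
            rw [fr.image_core]
            exact Or.inl (Or.inr hyδ)
          · exact Or.inr ⟨y, ⟨hyδ, hy⟩, mem_connectedComponentIn hyδ⟩
        · rintro (hy | ⟨z, hz, hy⟩) hyV
          · exact hn ⟨y, hy, hyV⟩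
          · refine hz.2 ?_
            rw [hV, connectedComponentIn_eq hyV, ← connectedComponentIn_eq hy]
            exact mem_connectedComponentIn hz.1
      rw [this]
      exact (hp.isOpenMap _ fr.isOpen_core).union
        (isOpen_biUnion fun y _ ↦ cδ.isOpen_compl.connectedComponentIn)
    rcases isClopen_iff.1 ⟨hcl, oV⟩ with h | h
    · exact (h ▸ hxV : x ∈ (∅ : Set T))
    · obtain ⟨y, hy⟩ := fr.nonempty_curve
      have : y ∈ V := h ▸ mem_univ y
      exact connectedComponentIn_subset _ _ this hy
  obtain ⟨y, hy, hyV⟩ := hmeet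
  rw [fr.image_core] at hy
  rcases hy with (hy | hy) | hy
  · exact Or.inl (key (fr.isPreconnected_image_OE hp.continuous) fr.image_OE_subset ⟨y, hy, hyV⟩)
  · exact absurd hy (connectedComponentIn_subset _ _ hyV)
  · exact Or.inr (key (fr.symm.isPreconnected_image_OE hp.continuous) fr.symm.image_OE_subset
      ⟨y, hy, hyV⟩)

/-- A separating curve cannot cut off a region in which all curves separate. -/
theorem not_jordanIn (fr : Frame e p δ J) [TopologicalSpace T] [T2Space T] [CompactSpace T]
    [LocallyConnectedSpace A] [LocallyConnectedSpace T] (hp : IsCoveringMap p)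
    (ch : HasPlanarCharts T) {U U' : Set T} (hU : IsOpen U) (hU' : IsOpen U')
    (cU : IsPreconnected U) (hB : p '' (fr.O ∩ fr.E) ⊆ U) (hB' : p '' (fr.P ∩ fr.F) ⊆ U')
    (hd : Disjoint U U') (hcov : U ∪ U' = δᶜ) : ¬ JordanIn U := by
  intro sep
  have hUU' : ∀ {x}, x ∈ U → x ∉ U' := fun h h' ↦ disjoint_left.1 hd h h'
  have hUδ : ∀ {x}, x ∈ U → x ∉ δ := fun {x} h ↦
    (hcov ▸ Or.inl h : x ∈ δᶜ)
  have hU'δ : ∀ {x}, x ∈ U' → x ∉ δ := fun {x} h ↦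
    (hcov ▸ Or.inr h : x ∈ δᶜ)
  have kU : IsClosed (U ∪ δ) := by
    have : U ∪ δ = U'ᶜ := by
      ext x
      constructor
      · rintro (h | h) h'
        · exact hUU' h h'
        · exact hU'δ h' h
      · intro h
        by_contra hc
        rw [mem_union, not_or] at hc
        have : x ∈ U ∪ U' := hcov ▸ hc.2
        exact this.elim hc.1 h
    rw [this]
    exact hU'.isClosed_compl
  obtain ⟨m, hm⟩ := fr.colE.neH
  have hinj := fr.injOn_component hp ch hU cU sep kU (disjoint_left.2 fun _ ↦ hUδ) hB
    (empty_subset U) isPreconnected_empty (by simpa using hU) (empty_disjoint _)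
    (by
      rintro x ⟨hx, w, hw, rfl⟩
      exact hUU' hx (hB' ⟨w, ⟨fr.colF.O'O hw.1, hw.2⟩, rfl⟩)) hm
  rw [sdiff_empty] at hinj
  set R := connectedComponentIn (p ⁻¹' U) m with hR
  have hmU : p m ∈ U := hB ⟨m, fr.colE.HO hm, rfl⟩
  have oR : IsOpen R := (hU.preimage hp.continuous).connectedComponentIn
  have cR : IsPreconnected R := isPreconnected_connectedComponentIn
  have hRU : ∀ {x}, x ∈ R → p x ∈ U := fun h ↦
    connectedComponentIn_subset (p ⁻¹' U) m h
  have pR : p '' R = U := image_connectedComponentIn_preimage hp hU cU hmU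
  have hOER : fr.O ∩ fr.E ⊆ R :=
    fr.colE.cOE.subset_connectedComponentIn (fr.colE.HO hm) (image_subset_iff.1 hB)
  have hQ : InjOn p (R ∪ (fr.O ∩ fr.P)) := by
    refine injOn_union_of_sheets hp oR fr.isOpen_core hinj (fr.iN.mono fr.core_subset_N) ?_
      ⟨m, hOER (fr.colE.HO hm), by rw [fr.core_eq]; exact Or.inl (Or.inl (fr.colE.HO hm))⟩
    have : p '' R ∩ p '' (fr.O ∩ fr.P) = p '' (fr.O ∩ fr.E) := by
      rw [pR, fr.image_core]
      ext x
      constructor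
      · rintro ⟨h, (h' | h') | h'⟩
        · exact h'
        · exact absurd h' (hUδ h)
        · exact absurd (hB' h') (hUU' h)
      · intro h
        exact ⟨hB h, Or.inl (Or.inl h)⟩
    rw [this]
    exact fr.isPreconnected_image_OE hp.continuous
  have hJQ : J ⊆ R ∪ (fr.O ∩ fr.P) := fun x hx ↦ Or.inr ⟨fr.J_subset_O hx, fr.J_subset_P hx⟩
  have oQ : IsOpen (R ∪ (fr.O ∩ fr.P)) := oR.union fr.isOpen_core
  have : Nonempty A := ⟨m⟩
  have hUJ : U ∪ δ = p '' (R ∪ J) := by rw [image_union, pR, fr.pJ]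
  have kRJ : IsCompact (R ∪ J) := by
    have h1 : R ∪ J = Function.invFunOn p (R ∪ (fr.O ∩ fr.P)) '' (U ∪ δ) := by
      rw [hUJ, image_image]
      have : ∀ x ∈ R ∪ J, Function.invFunOn p (R ∪ (fr.O ∩ fr.P)) (p x) = x := fun x hx ↦
        hQ.leftInvOn_invFunOn (union_subset subset_union_left hJQ hx)
      rw [image_congr this, image_id']
    rw [h1]
    refine kU.isCompact.image_of_continuousOn
      ((continuousOn_invFunOn hp.isOpenMap oQ hQ).mono ?_)
    rw [hUJ]
    exact image_mono (union_subset subset_union_left hJQ)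
  have : T2Space A := e.symm.isEmbedding.t2Space
  have hRJ : ∀ {x}, x ∈ R → x ∉ J := fun h h' ↦ hUδ (hRU h) (fr.apply_mem h')
  have hRE : R ⊆ fr.E := by
    rcases cR.subset_or_subset fr.oE fr.oF fr.disj (fun x hx ↦ fr.union ▸ hRJ hx) with h | h
    · exact h
    · exact absurd (h (hOER (fr.colE.HO hm)))
        (disjoint_left.1 fr.disj (fr.colE.HO hm).2)
  have hER : fr.E ⊆ R := by
    rcases fr.cE.subset_or_subset oR kRJ.isClosed.isOpen_compl
      (disjoint_left.2 fun x hx h ↦ h (Or.inl hx)) (fun x hx ↦ by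
        by_cases h : x ∈ R
        · exact Or.inl h
        · exact Or.inr fun h' ↦ h'.elim h (fr.notMem_of_mem_E hx)) with h | h
    · exact h
    · exact absurd (Or.inl (hOER (fr.colE.HO hm))) (h (fr.colE.HO hm).2)
  exact fr.nkE ((hRE.antisymm hER) ▸ kRJ)

end

variable {A : Type*} {T : Type} [TopologicalSpace A] {e : PuncturedPlane ≃ₜ A} {p : A → T}
  {δ : Set T} {J : Set A}

theorem isPreconnected_compl (fr : Frame e p δ J) [TopologicalSpace T] [T2Space T] [CompactSpace T]
    [PreconnectedSpace T] [LocallyConnectedSpace A] [LocallyConnectedSpace T]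
    (hp : IsCoveringMap p) (ch : HasPlanarCharts T) (hg : TwoCurvesSeparate T) :
    IsPreconnected δᶜ := by
  have cδ : IsClosed δ := (fr.isCompact_curve hp.continuous).isClosed
  obtain ⟨a, ha⟩ := fr.nonempty_OE
  obtain ⟨b, hb⟩ := fr.symm.nonempty_OE
  have haδ : p a ∈ δᶜ := fr.apply_notMem ha
  have hbδ : p b ∈ δᶜ := fr.symm.apply_notMem hb
  set U := connectedComponentIn δᶜ (p a) with hU
  set U' := connectedComponentIn δᶜ (p b) with hU'
  have hB : p '' (fr.O ∩ fr.E) ⊆ U :=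
    (fr.isPreconnected_image_OE hp.continuous).subset_connectedComponentIn
      (mem_image_of_mem p ha) fr.image_OE_subset
  have hB' : p '' (fr.P ∩ fr.F) ⊆ U' :=
    (fr.symm.isPreconnected_image_OE hp.continuous).subset_connectedComponentIn
      (mem_image_of_mem p hb) fr.symm.image_OE_subset
  have hcov : U ∪ U' = δᶜ := by
    apply Subset.antisymm
    · exact union_subset (connectedComponentIn_subset _ _) (connectedComponentIn_subset _ _)
    · intro x hx
      rcases fr.component_contains hp hx with h | h
      · left
        rw [hU, ← connectedComponentIn_eq (h (mem_image_of_mem p ha))]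
        exact mem_connectedComponentIn hx
      · right
        rw [hU', ← connectedComponentIn_eq (h (mem_image_of_mem p hb))]
        exact mem_connectedComponentIn hx
  have cU : IsPreconnected U := isPreconnected_connectedComponentIn
  have cU' : IsPreconnected U' := isPreconnected_connectedComponentIn
  rw [← hcov]
  by_contra hnc
  have hd : Disjoint U U' := by
    rw [disjoint_left]
    intro x hx hx'
    exact hnc (cU.union x hx hx' cU')
  have oU : IsOpen U := cδ.isOpen_compl.connectedComponentIn
  have oU' : IsOpen U' := cδ.isOpen_compl.connectedComponentIn
  have h1 : ¬ JordanIn U := fr.not_jordanIn hp ch oU oU' cU hB hB' hd hcov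
  have h2 : ¬ JordanIn U' := fr.symm.not_jordanIn hp ch oU' oU cU' hB' hB hd.symm
    (by rw [union_comm, hcov])
  unfold JordanIn at h1 h2
  push Not at h1 h2
  obtain ⟨F₁, hF₁, hr₁, c₁⟩ := h1
  obtain ⟨F₂, hF₂, hr₂, c₂⟩ := h2
  have hUδ : ∀ {x}, x ∈ U → x ∉ δ := fun {x} h ↦ connectedComponentIn_subset _ _ h
  have hU'δ : ∀ {x}, x ∈ U' → x ∉ δ := fun {x} h ↦ connectedComponentIn_subset _ _ h
  have key : ∀ {V B : Set T} (F : C(Circle1, T)), range F ⊆ δᶜ → IsPreconnected (V \ range F) →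
      B ⊆ V → δ ⊆ closure B → IsPreconnected ((V \ range F) ∪ δ) := by
    intro V B F hF cF hBV hδ
    refine cF.subset_closure subset_union_left (union_subset subset_closure ?_)
    intro x hx
    have hk : IsClosed (range F) := (isCompact_range F.continuous).isClosed
    have : x ∈ closure ((range F)ᶜ ∩ B) :=
      
      hk.isOpen_compl.inter_closure (t := B) (And.intro (fun h ↦ hF h hx) (hδ hx))
    have hs : (range F)ᶜ ∩ B ⊆ V \ range F := fun y hy ↦ ⟨hBV hy.2, hy.1⟩
    exact closure_mono hs this
  refine hg (range F₁) (range F₂) ⟨F₁, hF₁, rfl⟩ ⟨F₂, hF₂, rfl⟩ (hd.mono hr₁ hr₂) ?_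
  obtain ⟨z, hz⟩ := fr.nonempty_curve
  have := (key F₁ (fun x hx ↦ hUδ (hr₁ hx)) c₁ hB (fr.curve_subset_closure hp.continuous)).union z
    (Or.inr hz) (Or.inr hz)
    (key F₂ (fun x hx ↦ hU'δ (hr₂ hx)) c₂ hB' (fr.symm.curve_subset_closure hp.continuous))
  convert this using 1
  ext x
  have hx : x ∈ U ∨ x ∈ U' ∨ x ∈ δ := by
    by_cases h : x ∈ δ
    · exact Or.inr (Or.inr h)
    · have : x ∈ U ∪ U' := hcov ▸ h
      exact this.elim Or.inl fun h ↦ Or.inr (Or.inl h)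
  simp only [mem_compl_iff, mem_union, Set.mem_sdiff, not_or]
  rcases hx with h | h | h
  · have : x ∉ range F₂ := fun h' ↦ disjoint_left.1 hd h (hr₂ h')
    simp [h, this, hUδ h, disjoint_left.1 hd h]
  · have : x ∉ range F₁ := fun h' ↦ disjoint_left.1 hd (hr₁ h') h
    simp [h, this, hU'δ h, disjoint_right.1 hd h]
  · have h1 : x ∉ range F₁ := fun h' ↦ hUδ (hr₁ h') h
    have h2 : x ∉ range F₂ := fun h' ↦ hU'δ (hr₂ h') h
    simp only [h, h1, h2, or_true, not_false_eq_true, and_self]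

end Frame

section

variable {A T : Type*} [TopologicalSpace A] [TopologicalSpace T]

/-- A ring-shaped region `D` of an annular cover whose image lies in the image of a sheet `R`
determines a lift of the covering map which carries `D` into `R`. -/
theorem exists_shift (e : PuncturedPlane ≃ₜ A) {p : A → T} (hp : IsCoveringMap p) {D R : Set A}
    (cexp : IsPreconnected (expCover e ⁻¹' D)) (hD : D.Nonempty) (oR : IsOpen R) (iR : InjOn p R)
    (hDR : p '' D ⊆ p '' R) : ∃ g : A → A, Continuous g ∧ (∀ x, p (g x) = p x) ∧ MapsTo g D R := by
  have ce := continuous_expCover e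
  obtain ⟨d, hd⟩ := hD
  obtain ⟨z₀, rfl⟩ := expCover_surjective e d
  obtain ⟨y, hyR, hy⟩ := hDR (mem_image_of_mem p hd)
  obtain ⟨F, ⟨hF0, hF⟩, -⟩ := hp.existsUnique_continuousMap_lifts
    (⟨fun z ↦ p (expCover e z), hp.continuous.comp ce⟩ : C(ℂ, T)) z₀ y hy
  replace hF : ∀ z, p (F z) = p (expCover e z) := congr_fun hF
  have hFR : ∀ z, expCover e z ∈ D → F z ∈ R := by
    have : F '' (expCover e ⁻¹' D) ⊆ R := by
      refine subset_of_sheet hp oR iR (cexp.image _ F.continuous.continuousOn) ?_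
        ⟨y, ⟨z₀, hd, hF0⟩, hyR⟩
      rintro _ ⟨z, hz, rfl⟩
      rw [hF]
      exact hDR ⟨_, hz, rfl⟩
    exact fun z hz ↦ this ⟨z, hz, rfl⟩
  have hshift : ∀ z, expCover e (z + 2 * Real.pi * Complex.I) = expCover e z := by
    intro z
    simp only [expCover, Complex.exp_periodic z]
  have hper : Function.Periodic F (2 * Real.pi * Complex.I) := by
    have h1 : (fun z ↦ F (z + 2 * Real.pi * Complex.I)) = F := by
      refine hp.eq_of_comp_eq (by fun_prop) F.continuous (funext fun z ↦ ?_) z₀ ?_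
      · simp only [Function.comp_apply, hF, hshift]
      · refine iR (hFR _ ?_) (hFR _ hd) ?_
        · rw [hshift]
          exact hd
        · rw [hF, hF, hshift]
    exact congr_fun h1
  have hdesc : ∀ z w, expCover e z = expCover e w → F z = F w := by
    intro z w h
    have h1 : Complex.exp z = Complex.exp w := congr_arg Subtype.val (e.injective h)
    obtain ⟨n, hn⟩ := Complex.exp_eq_exp_iff_exists_int.1 h1
    rw [hn]
    exact hper.int_mul n w
  choose s hs using expCover_surjective e
  have hgF : ∀ z, F (s (expCover e z)) = F z := fun z ↦ hdesc _ _ (hs _)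
  refine ⟨fun x ↦ F (s x), ?_, fun x ↦ ?_, fun x hx ↦ hFR _ (by rwa [hs])⟩
  · rw [((isCoveringMap_expCover e).isQuotientMap (expCover_surjective e)).continuous_iff]
    have : (fun x ↦ F (s x)) ∘ expCover e = F := funext hgF
    rw [this]
    exact F.continuous
  · rw [hF, hs]

end

namespace Frame

variable {A T : Type*} [TopologicalSpace A] {e : PuncturedPlane ≃ₜ A}
  {p : A → T} {δ : Set T} {J : Set A}

theorem image_OE_subset' (fr : Frame e p δ J) : p '' (fr.O ∩ fr.E) ⊆ δᶜ \ p '' fr.G := by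
  rintro _ ⟨x, hx, rfl⟩
  refine ⟨fr.apply_notMem hx, ?_⟩
  rintro ⟨y, hy, hxy⟩
  have hy' := fr.colF.HO hy
  have : y = x := fr.iN (fr.colF.subN hy') (fr.colE.subN hx) hxy
  exact disjoint_left.1 fr.disj hx.2 (this ▸ hy'.2)

variable [TopologicalSpace T] [T2Space T]

theorem isOpen_diff_G (fr : Frame e p δ J) (hp : Continuous p) : IsOpen (δᶜ \ p '' fr.G) := by
  have : δᶜ \ p '' fr.G = (p '' (fr.G ∪ J))ᶜ := by
    rw [image_union, fr.pJ]
    ext x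
    simp only [Set.mem_sdiff, mem_compl_iff, mem_union, not_or]
    exact and_comm
  rw [this]
  exact (fr.colF.kH.image hp).isClosed.isOpen_compl

theorem isPreconnected_diff_G (fr : Frame e p δ J) (hp : IsCoveringMap p) (hc : IsPreconnected δᶜ) :
    IsPreconnected (δᶜ \ p '' fr.G) := by
  refine isPreconnected_diff_of_ring hc (hp.isOpenMap _ fr.isOpen_PF) fr.symm.image_OE_subset
    (image_mono fr.colF.HO) (fr.isOpen_diff_G hp.continuous) ?_
  have : p '' (fr.P ∩ fr.F) \ p '' fr.G = p '' ((fr.P ∩ fr.F) \ fr.G) :=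
    ((fr.iN.mono fr.colF.subN).image_sdiff_subset fr.colF.HO).symm
  rw [this]
  exact fr.colF.cD.image _ hp.continuous.continuousOn

/-- The complement of both collars is connected. -/
theorem isPreconnected_diff_collars (fr : Frame e p δ J)
    (hp : IsCoveringMap p) (hc : IsPreconnected δᶜ) :
    IsPreconnected ((δᶜ \ p '' fr.G) \ p '' fr.H) := by
  refine isPreconnected_diff_of_ring (fr.isPreconnected_diff_G hp hc)
    (hp.isOpenMap _ fr.isOpen_OE) fr.image_OE_subset' (image_mono fr.colE.HO) ?_ ?_
  · have : (δᶜ \ p '' fr.G) \ p '' fr.H = (δᶜ \ p '' fr.G) ∩ (δᶜ \ p '' fr.H) := by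
      ext x
      simp only [Set.mem_sdiff, mem_inter_iff]
      tauto
    rw [this]
    exact (fr.isOpen_diff_G hp.continuous).inter (fr.symm.isOpen_diff_G hp.continuous)
  · have : p '' (fr.O ∩ fr.E) \ p '' fr.H = p '' ((fr.O ∩ fr.E) \ fr.H) :=
      ((fr.iN.mono fr.colE.subN).image_sdiff_subset fr.colE.HO).symm
    rw [this]
    exact fr.colE.cD.image _ hp.continuous.continuousOn

/-- A sheet over the complement of the curve and of one of the collars. -/
theorem exists_sheet_diff (fr : Frame e p δ J)
    [CompactSpace T] [LocallyConnectedSpace A] [LocallyConnectedSpace T]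
    (hp : IsCoveringMap p) (ch : HasPlanarCharts T) (hc : IsPreconnected δᶜ) (sep : JordanIn δᶜ) :
    ∃ R, IsOpen R ∧ IsPreconnected R ∧ InjOn p R ∧ p '' R = δᶜ \ p '' fr.G ∧ fr.O ∩ fr.E ⊆ R := by
  have oU : IsOpen δᶜ := (fr.isCompact_curve hp.continuous).isClosed.isOpen_compl
  obtain ⟨m, hm⟩ := fr.colE.neH
  have hGU : p '' fr.G ⊆ δᶜ := (image_mono fr.colF.HO).trans fr.symm.image_OE_subset
  have hi := fr.injOn_component hp ch oU hc sep (by simp) disjoint_compl_left fr.image_OE_subset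
    hGU (fr.colF.cH.image _ hp.continuous.continuousOn) (fr.isOpen_diff_G hp.continuous)
    (disjoint_left.2 fun x hx hx' ↦ (fr.image_OE_subset' (image_mono fr.colE.HO hx')).2 hx)
    (fun x hx ↦ image_mono fr.colF.O'H hx.2) hm
  have hmU : p m ∈ δᶜ \ p '' fr.G := fr.image_OE_subset' ⟨m, fr.colE.HO hm, rfl⟩
  exact ⟨_, ((fr.isOpen_diff_G hp.continuous).preimage hp.continuous).connectedComponentIn,
    isPreconnected_connectedComponentIn, hi,
    image_connectedComponentIn_preimage hp (fr.isOpen_diff_G hp.continuous)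
      (fr.isPreconnected_diff_G hp hc) hmU,
    fr.colE.cOE.subset_connectedComponentIn (fr.colE.HO hm)
      (image_subset_iff.1 fr.image_OE_subset')⟩

/-- A lift of the covering map carrying the collar of `J` on one side into a sheet on the other
side, together with its inverse. -/
theorem exists_deck (fr : Frame e p δ J)
    [CompactSpace T] [PreconnectedSpace A] [LocallyConnectedSpace A]
    [LocallyConnectedSpace T] (hp : IsCoveringMap p) (ch : HasPlanarCharts T)
    (hc : IsPreconnected δᶜ) (sep : JordanIn δᶜ) :
    ∃ (g : A ≃ₜ A) (R : Set A), (∀ x, p (g x) = p x) ∧ IsOpen R ∧ IsPreconnected R ∧ InjOn p R ∧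
      p '' R = δᶜ \ p '' fr.G ∧ fr.O ∩ fr.E ⊆ R ∧ MapsTo g ((fr.P ∩ fr.F) \ fr.G) R := by
  have key : ∀ fr : Frame e p δ J, ∀ R R' : Set A, ∀ g h : A → A, IsOpen R → InjOn p R →
      p '' R = δᶜ \ p '' fr.G → fr.O ∩ fr.E ⊆ R → IsOpen R' → InjOn p R' →
      p '' R' = δᶜ \ p '' fr.H → fr.P ∩ fr.F ⊆ R' → Continuous g → (∀ x, p (g x) = p x) →
      MapsTo g ((fr.P ∩ fr.F) \ fr.G) R → Continuous h → (∀ x, p (h x) = p x) →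
      MapsTo h ((fr.O ∩ fr.E) \ fr.H) R' → h ∘ g = id := by
    intro fr R R' g h oR iR pR hR oR' iR' pR' hR' cg pg gR ch ph hR''
    obtain ⟨x, hx⟩ := fr.colF.neD
    obtain ⟨y, hy⟩ := fr.colE.neD
    have : Nonempty A := ⟨x⟩
    have hinv : ∀ w ∈ R, Function.invFunOn p R (p w) = w := fun w hw ↦ iR.leftInvOn_invFunOn hw
    set Q := (δᶜ \ p '' fr.G) \ p '' fr.H with hQ
    have hQR : Q ⊆ p '' R := by
      rw [pR]
      exact sdiff_subset
    have cQ : IsPreconnected (h '' (Function.invFunOn p R '' Q)) :=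
      ((fr.isPreconnected_diff_collars hp hc).image _
        ((continuousOn_invFunOn hp.isOpenMap oR iR).mono hQR)).image _ ch.continuousOn
    have pgxQ : p x ∈ Q := by
      refine ⟨?_, ?_⟩
      · rw [← pR, ← pg]
        exact ⟨_, gR hx, rfl⟩
      · exact (fr.symm.image_OE_subset' ⟨x, hx.1, rfl⟩).2
    have pyQ : p y ∈ Q := by
      refine ⟨fr.image_OE_subset' ⟨y, hy.1, rfl⟩, ?_⟩
      rintro ⟨z, hz, hzy⟩
      have : z = y := fr.iN (fr.colE.subN (fr.colE.HO hz)) (fr.colE.subN hy.1) hzy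
      exact hy.2 (this ▸ hz)
    have hsub : h '' (Function.invFunOn p R '' Q) ⊆ R' := by
      refine subset_of_sheet hp oR' iR' cQ ?_ ⟨h y, ⟨y, ⟨p y, pyQ, hinv y (hR hy.1)⟩, rfl⟩, hR'' hy⟩
      rintro _ ⟨_, ⟨q, hq, rfl⟩, rfl⟩
      rw [ph, Function.invFunOn_eq (hQR hq), pR']
      exact ⟨hq.1.1, hq.2⟩
    have hgx : h (g x) = x := by
      refine iR' (hsub ⟨g x, ⟨p x, pgxQ, ?_⟩, rfl⟩) (hR' hx.1) (by rw [ph, pg])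
      rw [← pg, hinv _ (gR hx)]
    refine hp.eq_of_comp_eq (ch.comp cg) continuous_id (funext fun w ↦ ?_) x hgx
    simp only [Function.comp_apply, ph, pg, id]
  obtain ⟨R, oR, cR, iR, pR, hR⟩ := fr.exists_sheet_diff hp ch hc sep
  obtain ⟨R', oR', cR', iR', pR', hR'⟩ := fr.symm.exists_sheet_diff hp ch hc sep
  have sub : ∀ fr : Frame e p δ J, p '' ((fr.O ∩ fr.E) \ fr.H) ⊆ δᶜ \ p '' fr.H := by
    rintro fr _ ⟨y, hy, rfl⟩
    refine ⟨fr.apply_notMem hy.1, ?_⟩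
    rintro ⟨z, hz, hzy⟩
    have : z = y := fr.iN (fr.colE.subN (fr.colE.HO hz)) (fr.colE.subN hy.1) hzy
    exact hy.2 (this ▸ hz)
  obtain ⟨g, cg, pg, gR⟩ := exists_shift e hp fr.colF.cexp fr.colF.neD oR iR
    (pR ▸ sub fr.symm)
  obtain ⟨h, ch', ph, hR''⟩ := exists_shift e hp fr.colE.cexp fr.colE.neD oR' iR'
    (pR' ▸ sub fr)
  have h1 := key fr R R' g h oR iR pR hR oR' iR' pR' hR' cg pg gR ch' ph hR''
  have h2 := key fr.symm R' R h g oR' iR' pR' hR' oR iR pR hR ch' ph hR'' cg pg gR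
  exact ⟨⟨⟨g, h, congr_fun h1, congr_fun h2⟩, cg, ch'⟩, R, pg, oR, cR, iR, pR, hR, gR⟩

end Frame

namespace Frame

variable {A T : Type*} [TopologicalSpace A] [TopologicalSpace T] {e : PuncturedPlane ≃ₜ A}
  {p : A → T} {δ : Set T} {J : Set A}

/-- `R` is a fundamental domain of the deck transformation `g`, bounded by `J` and `g '' J`. -/
structure IsShift (fr : Frame e p δ J) (g : A ≃ₜ A) (R : Set A) : Prop where
  pg : ∀ x, p (g x) = p x
  oR : IsOpen R
  cR : IsPreconnected R
  iR : InjOn p R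
  pR : p '' R = δᶜ
  OER : fr.O ∩ fr.E ⊆ R
  gR : ∀ x ∈ fr.P ∩ fr.F, g x ∈ R

theorem exists_isShift (fr : Frame e p δ J) [T2Space T] [CompactSpace T] [PreconnectedSpace A]
    [LocallyConnectedSpace A] [LocallyConnectedSpace T] (hp : IsCoveringMap p)
    (ch : HasPlanarCharts T) (hc : IsPreconnected δᶜ) (sep : JordanIn δᶜ) :
    ∃ g R, fr.IsShift g R := by
  obtain ⟨g, R, pg, oR, cR, iR, pR, hR, gR⟩ := fr.exists_deck hp ch hc sep
  have pgPF : p '' (g '' (fr.P ∩ fr.F)) = p '' (fr.P ∩ fr.F) := by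
    rw [image_image]
    exact image_congr fun x _ ↦ pg x
  have igPF : InjOn p (g '' (fr.P ∩ fr.F)) := by
    rintro _ ⟨x, hx, rfl⟩ _ ⟨y, hy, rfl⟩ h
    rw [pg, pg] at h
    rw [fr.iN (fr.colF.subN hx) (fr.colF.subN hy) h]
  have hPF : p '' (fr.P ∩ fr.F) ⊆ δᶜ := fr.symm.image_OE_subset
  obtain ⟨x, hx⟩ := fr.colF.neD
  have oPF : IsOpen (g '' (fr.P ∩ fr.F)) := g.isOpenMap _ fr.isOpen_PF
  refine ⟨g, R ∪ g '' (fr.P ∩ fr.F), pg, oR.union oPF,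
    cR.union (g x) (gR hx) (mem_image_of_mem g hx.1)
      (fr.colF.cOE.image _ g.continuous.continuousOn),
    injOn_union_of_sheets hp oR oPF iR igPF ?_ ⟨g x, gR hx, mem_image_of_mem g hx.1⟩, ?_,
    hR.trans subset_union_left, fun x hx ↦ Or.inr (mem_image_of_mem g hx)⟩
  · have : p '' R ∩ p '' (g '' (fr.P ∩ fr.F)) = p '' ((fr.P ∩ fr.F) \ fr.G) := by
      rw [pR, pgPF, (fr.iN.mono fr.colF.subN).image_sdiff_subset fr.colF.HO]
      ext y
      constructor
      · rintro ⟨h1, h2⟩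
        exact ⟨h2, h1.2⟩
      · rintro ⟨h1, h2⟩
        exact ⟨⟨hPF h1, h2⟩, h1⟩
    rw [this]
    exact fr.colF.cD.image _ hp.continuous.continuousOn
  · rw [image_union, pR, pgPF]
    apply Subset.antisymm
    · exact union_subset sdiff_subset hPF
    · intro y hy
      by_cases h : y ∈ p '' fr.G
      · exact Or.inr (image_mono fr.colF.HO h)
      · exact Or.inl ⟨hy, h⟩

namespace IsShift

variable {fr : Frame e p δ J} {g : A ≃ₜ A} {R : Set A}

theorem p_symm (h : fr.IsShift g R) (x : A) : p (g.symm x) = p x := by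
  rw [← h.pg, g.apply_symm_apply]

theorem symm (h : fr.IsShift g R) : fr.symm.IsShift g.symm (g.symm '' R) where
  pg := h.p_symm
  oR := g.symm.isOpenMap _ h.oR
  cR := h.cR.image _ g.symm.continuous.continuousOn
  iR := by
    rintro _ ⟨x, hx, rfl⟩ _ ⟨y, hy, rfl⟩ hxy
    rw [h.p_symm, h.p_symm] at hxy
    rw [h.iR hx hy hxy]
  pR := by
    rw [image_image, ← h.pR]
    exact image_congr fun x _ ↦ h.p_symm x
  OER := fun x hx ↦ ⟨g x, h.gR x hx, g.symm_apply_apply x⟩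
  gR := fun x hx ↦ mem_image_of_mem _ (h.OER hx)

theorem p_zpow (h : fr.IsShift g R) (n : ℤ) : ∀ x, p ((g ^ n) x) = p x := by
  induction n with
  | zero => intro x; rfl
  | succ n ih =>
    intro x
    rw [zpow_add_one, Homeomorph.mul_apply, ih, h.pg]
  | pred n ih =>
    intro x
    rw [zpow_sub_one, Homeomorph.mul_apply, ih, Homeomorph.inv_apply, h.p_symm]

theorem apply_notMem (h : fr.IsShift g R) {x : A} (hx : x ∈ R) : p x ∉ δ := by
  have : p x ∈ δᶜ := h.pR ▸ mem_image_of_mem p hx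
  exact this

theorem notMem (h : fr.IsShift g R)
    {x : A} (hx : x ∈ R) : x ∉ J := fun h' ↦ h.apply_notMem hx (fr.apply_mem h')

theorem nonempty (h : fr.IsShift g R) : R.Nonempty := fr.nonempty_OE.mono h.OER

theorem subset_E (h : fr.IsShift g R) : R ⊆ fr.E := by
  obtain ⟨x, hx⟩ := fr.nonempty_OE
  rcases h.cR.subset_or_subset fr.oE fr.oF fr.disj (fun x hx ↦ fr.union ▸ h.notMem hx) with h' | h'
  · exact h'
  · exact absurd hx.2 (disjoint_right.1 fr.disj (h' (h.OER hx)))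

theorem J_subset_closure (h : fr.IsShift g R)
    : J ⊆ closure R := fr.J_subset_closure.trans (closure_mono h.OER)

theorem image_J_subset_closure (h : fr.IsShift g R) : g '' J ⊆ closure R := by
  have h1 := h.symm.J_subset_closure
  rw [← g.symm.image_closure] at h1
  rintro _ ⟨x, hx, rfl⟩
  obtain ⟨y, hy, hyx⟩ := h1 hx
  rw [← hyx, g.apply_symm_apply]
  exact hy

theorem closure_subset (h : fr.IsShift g R) : closure R ⊆ fr.E ∪ J := by
  have hc : IsClosed (fr.E ∪ J) := by
    have : fr.E ∪ J = fr.Fᶜ := by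
      ext x
      constructor
      · rintro (h1 | h1) h2
        · exact disjoint_left.1 fr.disj h1 h2
        · exact fr.notMem_of_mem_F h2 h1
      · intro hx
        rcases fr.cases_mem x with h1 | h1 | h1
        · exact Or.inl h1
        · exact Or.inr h1
        · exact absurd h1 hx
    rw [this]
    exact fr.oF.isClosed_compl
  exact closure_minimal (h.subset_E.trans subset_union_left) hc

variable [PreconnectedSpace A]

theorem eq_of_apply_eq (hp : IsCoveringMap p)
    {d d' : A ≃ₜ A} (hd : ∀ x, p (d x) = p x) (hd' : ∀ x, p (d' x) = p x) {x : A}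
    (hx : d x = d' x) : d = d' :=
  Homeomorph.ext (congr_fun (hp.eq_of_comp_eq d.continuous d'.continuous
    (funext fun y ↦ (hd y).trans (hd' y).symm) x hx))

theorem apply_J_notMem (h : fr.IsShift g R) (hp : IsCoveringMap p)
    {x : A} (hx : x ∈ J) : g x ∉ J := by
  intro hgx
  have h1 : g x = x := fr.iN (fr.JN hgx) (fr.JN hx) (h.pg x)
  have h2 : g = 1 := eq_of_apply_eq hp h.pg (fun _ ↦ rfl) h1
  obtain ⟨r, hr⟩ := h.nonempty
  have h3 : r ∈ fr.F := h.symm.subset_E ⟨r, hr, by rw [h2]; rfl⟩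
  exact disjoint_left.1 fr.disj (h.subset_E hr) h3

theorem apply_J_mem (h : fr.IsShift g R) (hp : IsCoveringMap p) {x : A} (hx : x ∈ J) : g x ∈ fr.E :=
  (h.closure_subset (h.image_J_subset_closure (mem_image_of_mem g hx))).resolve_right
    (h.apply_J_notMem hp hx)

theorem apply_E_mem (h : fr.IsShift g R) (hp : IsCoveringMap p)
    {x : A} (hx : x ∈ fr.E) : g x ∈ fr.E := by
  have h1 : g '' fr.E ⊆ fr.E ∪ fr.F := by
    rintro _ ⟨y, hy, rfl⟩
    rw [fr.union]
    intro hJ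
    have : g.symm (g y) ∈ fr.F := h.symm.apply_J_mem hp hJ
    rw [g.symm_apply_apply] at this
    exact disjoint_left.1 fr.disj hy this
  rcases (fr.cE.image g g.continuous.continuousOn).subset_or_subset fr.oE fr.oF fr.disj h1
    with h2 | h2
  · exact h2 (mem_image_of_mem g hx)
  · obtain ⟨y, hy⟩ := fr.neJ
    have h3 : g y ∈ closure (g '' fr.E) := by
      rw [← g.image_closure]
      exact mem_image_of_mem g (fr.clE hy)
    obtain ⟨z, hz, hz'⟩ := mem_closure_iff.1 h3 _ fr.oE (h.apply_J_mem hp hy)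
    exact absurd (h2 hz') (disjoint_left.1 fr.disj hz)

theorem pow_J_mem (h : fr.IsShift g R) (hp : IsCoveringMap p)
    (n : ℕ) {x : A} (hx : x ∈ J) : (g ^ (n + 1)) x ∈ fr.E := by
  induction n with
  | zero => rw [zero_add, pow_one]; exact h.apply_J_mem hp hx
  | succ n ih => rw [pow_succ']; exact h.apply_E_mem hp ih

theorem zpow_J_mem (h : fr.IsShift g R) (hp : IsCoveringMap p)
    {n : ℤ} (hn : 0 < n) {x : A} (hx : x ∈ J) : (g ^ n) x ∈ fr.E := by
  obtain ⟨m, rfl⟩ := Int.eq_succ_of_zero_lt hn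
  have := h.pow_J_mem hp m hx
  rwa [← zpow_natCast] at this

theorem zpow_J_mem' (h : fr.IsShift g R) (hp : IsCoveringMap p)
    {n : ℤ} (hn : n < 0) {x : A} (hx : x ∈ J) : (g ^ n) x ∈ fr.F := by
  have h1 : (g.symm ^ (-n)) x ∈ fr.F := h.symm.zpow_J_mem hp (neg_pos.2 hn) hx
  have h2 : g.symm ^ (-n) = g ^ n := by
    change g⁻¹ ^ (-n) = g ^ n
    rw [inv_zpow, zpow_neg, inv_inv]
  rwa [h2] at h1

theorem zpow_injective (h : fr.IsShift g R) (hp : IsCoveringMap p)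
    : Function.Injective (fun n : ℤ ↦ g ^ n) := by
  intro m n hmn
  by_contra hne
  have key : ∀ k : ℤ, k ≠ 0 → g ^ k ≠ 1 := by
    intro k hk hk1
    obtain ⟨x, hx⟩ := fr.neJ
    rcases lt_or_gt_of_ne hk with h1 | h1
    · have := h.zpow_J_mem' hp h1 hx
      rw [hk1] at this
      exact fr.notMem_of_mem_F this hx
    · have := h.zpow_J_mem hp h1 hx
      rw [hk1] at this
      exact fr.notMem_of_mem_E this hx
  refine key (m - n) (sub_ne_zero.2 hne) ?_
  change g ^ m = g ^ n at hmn
  rw [zpow_sub, hmn, mul_inv_cancel]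

theorem zpow_eq_of_mem (h : fr.IsShift g R) (hp : IsCoveringMap p)
    {k : ℤ} {x : A} (hx : x ∈ R) (hk : (g ^ k) x ∈ R) : k = 0 := by
  have h1 : (g ^ k) x = x := h.iR hk hx (h.p_zpow k x)
  refine h.zpow_injective hp ?_
  exact eq_of_apply_eq hp (h.p_zpow k) (h.p_zpow 0) h1

theorem zpow_eq_of_mem_J (h : fr.IsShift g R) (hp : IsCoveringMap p)
    {k : ℤ} {x y : A} (hx : x ∈ J) (hy : y ∈ J) (hk : (g ^ k) x = y) :
    k = 0 := by
  by_contra hne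
  rcases lt_or_gt_of_ne hne with h1 | h1
  · exact fr.notMem_of_mem_F (h.zpow_J_mem' hp h1 hx) (hk ▸ hy)
  · exact fr.notMem_of_mem_E (h.zpow_J_mem hp h1 hx) (hk ▸ hy)

theorem exists_zpow_mem_core (h : fr.IsShift g R) {x : A} (n : ℤ) (hx : (g ^ n) x ∈ R ∪ J)
    (hc : p x ∈ p '' (fr.O ∩ fr.P)) : ∃ k : ℤ, (g ^ k) x ∈ fr.O ∩ fr.P := by
  rcases hx with hx | hx
  · obtain ⟨v, hv, hvx⟩ := hc
    have hv' := hv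
    rw [fr.core_eq] at hv'
    rcases hv' with (h1 | h1) | h1
    · have : v = (g ^ n) x := h.iR (h.OER h1) hx (by rw [hvx, h.p_zpow])
      exact ⟨n, this ▸ hv⟩
    · refine absurd (fr.apply_mem h1) ?_
      rw [hvx, ← h.p_zpow n]
      exact h.apply_notMem hx
    · have : g v = (g ^ n) x := h.iR (h.gR v h1) hx (by rw [h.pg, hvx, h.p_zpow])
      refine ⟨-1 + n, ?_⟩
      rw [zpow_add, Homeomorph.mul_apply, ← this, zpow_neg_one, Homeomorph.inv_apply,
        g.symm_apply_apply]
      exact hv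
  · exact ⟨n, fr.J_subset_O hx, fr.J_subset_P hx⟩

theorem exists_zpow_mem (h : fr.IsShift g R) (hp : IsCoveringMap p)
    [T2Space T] [LocallyConnectedSpace A] (x : A) :
    ∃ n : ℤ, (g ^ n) x ∈ R ∪ J := by
  have hW : ∀ y (n : ℤ), (g ^ n) y ∈ R ∪ (fr.O ∩ fr.P) → ∃ n : ℤ, (g ^ n) y ∈ R ∪ J := by
    rintro y n (hy | hy)
    · exact ⟨n, Or.inl hy⟩
    · rw [fr.core_eq] at hy
      rcases hy with (h1 | h1) | h1
      · exact ⟨n, Or.inl (h.OER h1)⟩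
      · exact ⟨n, Or.inr h1⟩
      · refine ⟨1 + n, Or.inl ?_⟩
        rw [zpow_add, zpow_one]
        exact h.gR _ h1
  have hJO : J ⊆ fr.O ∩ fr.P := fun y hy ↦ ⟨fr.J_subset_O hy, fr.J_subset_P hy⟩
  set S : Set A := {x | ∃ n : ℤ, (g ^ n) x ∈ R ∪ J} with hS
  have oS : IsOpen S := by
    have : S = ⋃ n : ℤ, (g ^ n) ⁻¹' (R ∪ (fr.O ∩ fr.P)) := by
      ext y
      rw [mem_iUnion]
      constructor
      · rintro ⟨n, hn⟩
        exact ⟨n, union_subset_union_right R hJO hn⟩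
      · rintro ⟨n, hn⟩
        exact hW y n hn
    rw [this]
    exact isOpen_iUnion fun n ↦ (h.oR.union fr.isOpen_core).preimage (g ^ n).continuous
  have oU : IsOpen δᶜ := (fr.isCompact_curve hp.continuous).isClosed.isOpen_compl
  have push : ∀ (B C : Set A) (n : ℤ) (w : A), IsOpen B → InjOn p B → IsPreconnected C →
      MapsTo p C (p '' B) → w ∈ C → (g ^ n) w ∈ B → ∀ y ∈ C, (g ^ n) y ∈ B := by
    intro B C n w oB iB cC hCB hw hwB y hy
    refine subset_of_sheet hp oB iB (cC.image _ (g ^ n).continuous.continuousOn) ?_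
      ⟨_, mem_image_of_mem _ hw, hwB⟩ (mem_image_of_mem _ hy)
    rintro _ ⟨z, hz, rfl⟩
    rw [h.p_zpow]
    exact hCB hz
  have cS : IsClosed S := by
    rw [← isOpen_compl_iff, isOpen_iff_forall_mem_open]
    intro y hy
    by_cases hyδ : p y ∈ δ
    · have oV : IsOpen (p ⁻¹' (p '' (fr.O ∩ fr.P))) :=
        (hp.isOpenMap _ fr.isOpen_core).preimage hp.continuous
      have hyV : y ∈ p ⁻¹' (p '' (fr.O ∩ fr.P)) := by
        rw [mem_preimage, fr.image_core]
        exact Or.inl (Or.inr hyδ)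
      refine ⟨connectedComponentIn (p ⁻¹' (p '' (fr.O ∩ fr.P))) y, ?_, oV.connectedComponentIn,
        mem_connectedComponentIn hyV⟩
      rintro w hw ⟨n, hn⟩
      obtain ⟨k, hk⟩ := h.exists_zpow_mem_core n hn
        (connectedComponentIn_subset (p ⁻¹' (p '' (fr.O ∩ fr.P))) y hw)
      exact hy (hW y k (Or.inr (push _ _ k w fr.isOpen_core (fr.iN.mono fr.core_subset_N)
        isPreconnected_connectedComponentIn (fun z hz ↦ connectedComponentIn_subset
          (p ⁻¹' (p '' (fr.O ∩ fr.P))) y hz) hw hk y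
        (mem_connectedComponentIn hyV))))
    · refine ⟨connectedComponentIn (p ⁻¹' δᶜ) y, ?_,
        (oU.preimage hp.continuous).connectedComponentIn, mem_connectedComponentIn hyδ⟩
      rintro w hw ⟨n, hn⟩
      have hwδ : p w ∉ δ := connectedComponentIn_subset _ _ hw
      have hnR : (g ^ n) w ∈ R := by
        refine hn.resolve_right fun hJ ↦ hwδ ?_
        rw [← h.p_zpow n]
        exact fr.apply_mem hJ
      refine hy ⟨n, Or.inl (push R _ n w h.oR h.iR isPreconnected_connectedComponentIn
        (fun z hz ↦ ?_) hw hnR y (mem_connectedComponentIn hyδ))⟩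
      have hzδ : z ∈ p ⁻¹' δᶜ := connectedComponentIn_subset _ _ hz
      rw [h.pR]
      exact hzδ
  have : S = univ := by
    refine (isClopen_iff.1 ⟨cS, oS⟩).resolve_left ?_
    obtain ⟨y, hy⟩ := fr.neJ
    exact Nonempty.ne_empty ⟨y, 0, Or.inr hy⟩
  exact (this ▸ mem_univ x : x ∈ S)

theorem exists_zpow_mem_J (h : fr.IsShift g R) (hp : IsCoveringMap p)
    [T2Space T] [LocallyConnectedSpace A] {x : A} (hx : p x ∈ δ) :
    ∃ n : ℤ, x ∈ (g ^ n) '' J := by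
  obtain ⟨n, hn⟩ := h.exists_zpow_mem hp x
  rcases hn with hn | hn
  · refine absurd hx ?_
    rw [← h.p_zpow n]
    exact h.apply_notMem hn
  · refine ⟨-n, _, hn, ?_⟩
    rw [← Homeomorph.mul_apply, ← zpow_add, neg_add_cancel]
    rfl

theorem exists_zpow_mem_R (h : fr.IsShift g R) (hp : IsCoveringMap p)
    [T2Space T] [LocallyConnectedSpace A] {x : A} (hx : p x ∉ δ) :
    ∃ n : ℤ, x ∈ (g ^ n) '' R := by
  obtain ⟨n, hn⟩ := h.exists_zpow_mem hp x
  rcases hn with hn | hn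
  · refine ⟨-n, _, hn, ?_⟩
    rw [← Homeomorph.mul_apply, ← zpow_add, neg_add_cancel]
    rfl
  · refine absurd ?_ hx
    rw [← h.p_zpow n]
    exact fr.apply_mem hn

/-- Every deck transformation is a power of `g`. -/
theorem exists_eq_zpow (h : fr.IsShift g R) (hp : IsCoveringMap p)
    [T2Space T] [LocallyConnectedSpace A] {d : A ≃ₜ A}
    (hd : ∀ x, p (d x) = p x) : ∃ n : ℤ, g ^ n = d := by
  obtain ⟨x, hx⟩ := fr.neJ
  obtain ⟨n, y, hy, hyx⟩ := h.exists_zpow_mem_J hp (x := d x) (by rw [hd]; exact fr.apply_mem hx)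
  have hxy : y = x := fr.iN (fr.JN hy) (fr.JN hx) (by rw [← h.p_zpow n, hyx, hd])
  exact ⟨n, eq_of_apply_eq hp (h.p_zpow n) hd (x := x) (by rw [← hyx, hxy])⟩

/-- The translates of `R` are the components of the complement of the preimage of `δ`. -/
theorem component_eq (h : fr.IsShift g R) (hp : IsCoveringMap p)
    {x : A} {n : ℤ} (hx : x ∈ (g ^ n) '' R) :
    connectedComponentIn (p ⁻¹' δ)ᶜ x = (g ^ n) '' R := by
  have hsub : (g ^ n) '' R ⊆ (p ⁻¹' δ)ᶜ := by
    rintro _ ⟨y, hy, rfl⟩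
    change p _ ∉ δ
    rw [h.p_zpow]
    exact h.apply_notMem hy
  apply Subset.antisymm
  · refine subset_of_sheet hp ((g ^ n).isOpenMap _ h.oR) ?_ isPreconnected_connectedComponentIn ?_
      ⟨x, mem_connectedComponentIn (hsub hx), hx⟩
    · rintro _ ⟨y, hy, rfl⟩ _ ⟨z, hz, rfl⟩ hyz
      rw [h.p_zpow, h.p_zpow] at hyz
      rw [h.iR hy hz hyz]
    · intro y hy
      have h1 : p y ∈ δᶜ := connectedComponentIn_subset (p ⁻¹' δ)ᶜ x hy
      rw [← h.pR] at h1
      obtain ⟨z, hz, hzy⟩ := h1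
      exact ⟨_, mem_image_of_mem _ hz, by rw [h.p_zpow, hzy]⟩
  · exact (h.cR.image _ (g ^ n).continuous.continuousOn).subset_connectedComponentIn hx hsub

/-- The only translates of `J` in the closure of `R` are `J` and its first translate. -/
theorem eq_zero_or_one (h : fr.IsShift g R) (hp : IsCoveringMap p)
    {x : A} (hx : x ∈ J) {n : ℤ} (hn : (g ^ n) x ∈ closure R) :
    n = 0 ∨ n = 1 := by
  have h1 : (g ^ n) x ∈ (g ^ n) '' (fr.O ∩ fr.P) :=
    mem_image_of_mem _ ⟨fr.J_subset_O hx, fr.J_subset_P hx⟩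
  obtain ⟨_, ⟨y, hy, rfl⟩, hyR⟩ :=
    mem_closure_iff.1 hn _ ((g ^ n).isOpenMap _ fr.isOpen_core) h1
  rw [fr.core_eq] at hy
  rcases hy with (h2 | h2) | h2
  · exact Or.inl (h.zpow_eq_of_mem hp (h.OER h2) hyR)
  · refine absurd (fr.apply_mem h2) ?_
    rw [← h.p_zpow n]
    exact h.apply_notMem hyR
  · right
    have h3 : (g ^ (n - 1)) (g y) ∈ R := by
      rwa [← Homeomorph.mul_apply, ← zpow_add_one, sub_add_cancel]
    have := h.zpow_eq_of_mem hp (h.gR y h2) h3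
    omega

end IsShift

end Frame

/-- In a graph isomorphic to the line, the distance is the difference of the positions. -/
theorem SimpleGraph.dist_eq_natAbs {V : Type*} {G : SimpleGraph V} {f : ℤ → V}
    (hf : Function.Bijective f) (hadj : ∀ m n, G.Adj (f m) (f n) ↔ (m - n).natAbs = 1) (n : ℤ) :
    G.dist (f 0) (f n) = n.natAbs := by
  have lower : ∀ (a b : V) (w : G.Walk a b) (k l : ℤ), f k = a → f l = b →
      (k - l).natAbs ≤ w.length := by
    intro a b w
    induction w with
    | nil =>
      intro k l hk hl
      rw [hf.1 (hk.trans hl.symm)]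
      simp
    | cons h w ih =>
      intro k l hk hl
      obtain ⟨m, hm⟩ := hf.2 _
      have h1 := ih m l hm hl
      rw [← hk, ← hm, hadj] at h
      rw [SimpleGraph.Walk.length_cons]
      omega
  have upper : ∀ (N : ℕ) (k : ℤ), k.natAbs = N → ∃ w : G.Walk (f 0) (f k), w.length = N := by
    intro N
    induction N with
    | zero =>
      intro k hk
      obtain rfl := Int.natAbs_eq_zero.1 hk
      exact ⟨SimpleGraph.Walk.nil, rfl⟩
    | succ N ih =>
      intro k hk
      obtain ⟨l, hl, hlk⟩ : ∃ l : ℤ, l.natAbs = N ∧ (l - k).natAbs = 1 := by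
        rcases le_or_gt 0 k with h0 | h0
        · exact ⟨k - 1, by omega, by omega⟩
        · exact ⟨k + 1, by omega, by omega⟩
      obtain ⟨w, hw⟩ := ih l hl
      exact ⟨w.concat ((hadj _ _).2 hlk), by rw [SimpleGraph.Walk.length_concat, hw]⟩
  obtain ⟨w, hw⟩ := upper _ n rfl
  apply le_antisymm
  · exact hw ▸ SimpleGraph.dist_le w
  · obtain ⟨w', hw'⟩ := (SimpleGraph.Walk.reachable w).exists_walk_length_eq_dist
    have := lower _ _ w' 0 n rfl rfl
    omega

namespace Frame.IsShift

variable {A T : Type*} [TopologicalSpace A] [TopologicalSpace T] {e : PuncturedPlane ≃ₜ A}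
  {p : A → T} {δ : Set T} {J : Set A} {fr : Frame e p δ J} {g : A ≃ₜ A} {R : Set A}

theorem component_J (h : fr.IsShift g R) (hJ : ∀ x ∈ J, connectedComponentIn (p ⁻¹' δ) x = J)
    (n : ℤ) {x : A} (hx : x ∈ J) :
    connectedComponentIn (p ⁻¹' δ) ((g ^ n) x) = (g ^ n) '' J := by
  have h1 : (g ^ n) '' (p ⁻¹' δ) = p ⁻¹' δ := by
    rw [Homeomorph.image_eq_preimage_symm]
    ext y
    have h2 : p ((g ^ n).symm y) = p y := by
      rw [← h.p_zpow n, (g ^ n).apply_symm_apply]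
    simp only [mem_preimage, h2]
  have h2 := (g ^ n).image_connectedComponentIn (s := p ⁻¹' δ) (fr.apply_mem hx : x ∈ p ⁻¹' δ)
  rw [h1, hJ x hx] at h2
  exact h2.symm

theorem mem_closure_image (h : fr.IsShift g R) [PreconnectedSpace A] (hp : IsCoveringMap p)
    {n k : ℤ} (hn : (g ^ n) '' J ⊆ closure ((g ^ k) '' R)) : n = k ∨ n = k + 1 := by
  obtain ⟨x, hx⟩ := fr.neJ
  have h1 := hn (mem_image_of_mem _ hx)
  rw [← (g ^ k).image_closure] at h1
  obtain ⟨y, hy, hyx⟩ := h1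
  have h2 : (g ^ (n - k)) x = y := by
    apply (g ^ k).injective
    rw [hyx, ← Homeomorph.mul_apply, ← zpow_add, add_sub_cancel]
  have := h.eq_zero_or_one hp hx (h2 ▸ hy)
  omega

theorem image_zpow_subset_closure (h : fr.IsShift g R) (k : ℤ) :
    (g ^ k) '' J ⊆ closure ((g ^ k) '' R) := by
  rw [← (g ^ k).image_closure]
  exact image_mono h.J_subset_closure

theorem image_zpow_add_one_subset_closure (h : fr.IsShift g R) (k : ℤ) :
    (g ^ (k + 1)) '' J ⊆ closure ((g ^ k) '' R) := by
  rw [← (g ^ k).image_closure, zpow_add_one]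
  rintro _ ⟨x, hx, rfl⟩
  exact mem_image_of_mem _ (h.image_J_subset_closure (mem_image_of_mem g hx))

end Frame.IsShift

section levels

variable {T : Type} [TopologicalSpace T] {C : AnnCover T} {δ : Set T}

theorem connectedComponentIn_eq_hatSet (D : CurveLift C δ) {x : C.Tot} (hx : x ∈ hatSet D) :
    connectedComponentIn (C.p ⁻¹' δ) x = hatSet D :=
  (connectedComponentIn_eq hx).symm

variable {D : CurveLift C δ} {e : PuncturedPlane ≃ₜ C.Tot} {fr : Frame e C.p δ (hatSet D)}
  {g : C.Tot ≃ₜ C.Tot} {R : Set C.Tot}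

/-- The elevations of `δ`, numbered by the powers of the deck transformation. -/
def Frame.IsShift.elev (h : fr.IsShift g R) (n : ℤ) : Elev C δ :=
  ⟨(g ^ n) '' hatSet D, (g ^ n) D.x0, by
    rw [mem_preimage, h.p_zpow]
    exact D.mem, (h.component_J (fun _ ↦ connectedComponentIn_eq_hatSet D) n
      (mem_connectedComponentIn D.mem)).symm⟩

namespace Frame.IsShift

theorem elev_zero (h : fr.IsShift g R) : h.elev 0 = hatElev D :=
  Subtype.ext (image_id _)

theorem elev_bijective (h : fr.IsShift g R) [T2Space T] [PreconnectedSpace C.Tot]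
    [LocallyConnectedSpace C.Tot] : Function.Bijective h.elev := by
  constructor
  · intro m n hmn
    have h1 : (g ^ m) '' hatSet D = (g ^ n) '' hatSet D := congr_arg Subtype.val hmn
    obtain ⟨x, hx⟩ := fr.neJ
    obtain ⟨y, hy, hyx⟩ := h1 ▸ mem_image_of_mem (g ^ m) hx
    have h2 : (g ^ (m - n)) x = y := by
      apply (g ^ n).injective
      rw [hyx, ← Homeomorph.mul_apply, ← zpow_add, add_sub_cancel]
    have := h.zpow_eq_of_mem_J C.cov hx hy h2
    omega
  · rintro ⟨A, x, hx, rfl⟩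
    obtain ⟨n, y, hy, rfl⟩ := h.exists_zpow_mem_J C.cov hx
    exact ⟨n, Subtype.ext
      (h.component_J (fun _ ↦ connectedComponentIn_eq_hatSet D) n hy).symm⟩

theorem elevTree_adj (h : fr.IsShift g R) [T2Space T] [PreconnectedSpace C.Tot]
    [LocallyConnectedSpace C.Tot] (m n : ℤ) :
    (elevTree C δ).Adj (h.elev m) (h.elev n) ↔ (m - n).natAbs = 1 := by
  have key : ∀ k l : ℤ, l = k + 1 → ∃ x ∈ (C.p ⁻¹' δ)ᶜ,
      (h.elev k).val ⊆ closure (connectedComponentIn (C.p ⁻¹' δ)ᶜ x) ∧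
      (h.elev l).val ⊆ closure (connectedComponentIn (C.p ⁻¹' δ)ᶜ x) := by
    rintro k _ rfl
    obtain ⟨x, hx⟩ := h.nonempty
    refine ⟨(g ^ k) x, ?_, ?_⟩
    · change C.p _ ∉ δ
      rw [h.p_zpow]
      exact h.apply_notMem hx
    · rw [h.component_eq C.cov (mem_image_of_mem _ hx)]
      exact ⟨h.image_zpow_subset_closure k, h.image_zpow_add_one_subset_closure k⟩
  have key' : ∀ k l : ℤ, k ≠ l → (∃ x ∈ (C.p ⁻¹' δ)ᶜ,
      (h.elev k).val ⊆ closure (connectedComponentIn (C.p ⁻¹' δ)ᶜ x) ∧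
      (h.elev l).val ⊆ closure (connectedComponentIn (C.p ⁻¹' δ)ᶜ x)) → (k - l).natAbs = 1 := by
    rintro k l hkl ⟨x, hx, h1, h2⟩
    obtain ⟨i, hi⟩ := h.exists_zpow_mem_R C.cov (x := x) hx
    rw [h.component_eq C.cov hi] at h1 h2
    have := h.mem_closure_image C.cov h1
    have := h.mem_closure_image C.cov h2
    omega
  rw [elevTree, SimpleGraph.fromRel_adj]
  constructor
  · rintro ⟨hne, h1 | h1⟩
    · exact key' m n (fun h' ↦ hne (h' ▸ rfl)) h1
    · have := key' n m (fun h' ↦ hne (h' ▸ rfl)) h1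
      omega
  · intro hmn
    refine ⟨fun h' ↦ ?_, ?_⟩
    · have := h.elev_bijective.1 h'
      omega
    · rcases Int.natAbs_eq (m - n) with h1 | h1
      · exact Or.inr (key n m (by omega))
      · exact Or.inl (key m n (by omega))

theorem dist_elev (h : fr.IsShift g R) [T2Space T] [PreconnectedSpace C.Tot]
    [LocallyConnectedSpace C.Tot] (n : ℤ) :
    (elevTree C δ).dist (hatElev D) (h.elev n) = n.natAbs := by
  rw [← h.elev_zero]
  exact SimpleGraph.dist_eq_natAbs h.elev_bijective h.elevTree_adj n

end Frame.IsShift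

theorem Frame.connectedComponentIn_E {A T : Type*} [TopologicalSpace A] {e : PuncturedPlane ≃ₜ A}
    {p : A → T} {δ : Set T} {J : Set A} (fr : Frame e p δ J) {x : A} (hx : x ∈ fr.E) :
    connectedComponentIn Jᶜ x = fr.E := by
  have hsub : fr.E ⊆ Jᶜ := fr.union ▸ subset_union_left
  apply Subset.antisymm
  · have h1 : connectedComponentIn Jᶜ x ⊆ fr.E ∪ fr.F :=
      (connectedComponentIn_subset Jᶜ x).trans fr.union.ge
    exact isPreconnected_connectedComponentIn.subset_left_of_subset_union fr.oE fr.oF fr.disj h1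
      ⟨x, mem_connectedComponentIn (hsub hx), hx⟩
  · exact fr.cE.subset_connectedComponentIn hx hsub

namespace Frame.IsShift

theorem level_elev (h : fr.IsShift g R) [T2Space T] [PreconnectedSpace C.Tot]
    [LocallyConnectedSpace C.Tot] (hpos : D.pos ∈ fr.E) (n : ℤ) : level D (h.elev n) = n := by
  obtain ⟨x, hx⟩ := fr.neJ
  have hgx : (g ^ n) x ∈ (g ^ n) '' hatSet D := mem_image_of_mem _ hx
  unfold level
  rw [h.dist_elev, fr.connectedComponentIn_E hpos]
  rcases lt_trichotomy n 0 with h0 | rfl | h0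
  · rw [if_neg]
    · omega
    · intro hs
      exact disjoint_left.1 fr.disj (hs hgx) (h.zpow_J_mem' C.cov h0 hx)
  · simp
  · rw [if_pos]
    · omega
    · rintro _ ⟨y, hy, rfl⟩
      exact h.zpow_J_mem C.cov h0 hy

theorem ncard_levelsMet_eq (h : fr.IsShift g R) [T2Space T] [PreconnectedSpace C.Tot]
    [LocallyConnectedSpace C.Tot] (S : Set C.Tot) :
    (levelsMet D S).ncard = {d : C.Tot ≃ₜ C.Tot | (∀ x, C.p (d x) = C.p x) ∧
      (d '' hatSet D ∩ S).Nonempty}.ncard := by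
  wlog hpos : D.pos ∈ fr.E generalizing g R fr
  · refine this h.symm ?_
    have : D.pos ∈ fr.E ∪ fr.F := by
      have h3 := fr.union
      rw [h3]
      exact D.pos_notin
    exact this.resolve_left hpos
  have h1 : levelsMet D S = {n : ℤ | ((g ^ n) '' hatSet D ∩ S).Nonempty} := by
    ext k
    constructor
    · rintro ⟨A, rfl, hA⟩
      obtain ⟨n, rfl⟩ := h.elev_bijective.2 A
      rw [h.level_elev hpos]
      exact hA
    · intro hk
      exact ⟨h.elev k, h.level_elev hpos k, hk⟩
  have h2 : {d : C.Tot ≃ₜ C.Tot | (∀ x, C.p (d x) = C.p x) ∧ (d '' hatSet D ∩ S).Nonempty} =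
      (fun n : ℤ ↦ g ^ n) '' {n : ℤ | ((g ^ n) '' hatSet D ∩ S).Nonempty} := by
    ext d
    constructor
    · rintro ⟨hd, hd'⟩
      obtain ⟨n, rfl⟩ := h.exists_eq_zpow C.cov hd
      exact ⟨n, hd', rfl⟩
    · rintro ⟨n, hn, rfl⟩
      exact ⟨h.p_zpow n, hn⟩
  rw [h1, h2, ncard_image_of_injective _ (h.zpow_injective C.cov)]

end Frame.IsShift

end levels

section surface

variable {T : Type} [TopologicalSpace T]

theorem IsSCC.isClosed [T2Space T] {c : Set T} (h : IsSCC c) : IsClosed c := by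
  obtain ⟨f, -, rfl⟩ := h
  exact (isCompact_range f.continuous).isClosed

theorem IsSCC.nonempty {c : Set T} (h : IsSCC c) : c.Nonempty := by
  obtain ⟨f, -, rfl⟩ := h
  exact range_nonempty f

theorem twoCurvesSeparate [T2Space T] [PreconnectedSpace T]
    (h : ¬ ∃ F : Fin 2 → Set T, (∀ i, IsSCC (F i) ∧ Disjoint (F i) ∅) ∧
      Pairwise (Function.onFun Disjoint F) ∧ IsConnected (⋃ i, F i)ᶜ) : TwoCurvesSeparate T := by
  intro c₁ c₂ h₁ h₂ hd hc
  refine h ⟨![c₁, c₂], ?_, ?_, ?_⟩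
  · intro i
    fin_cases i
    · exact ⟨h₁, disjoint_bot_right⟩
    · exact ⟨h₂, disjoint_bot_right⟩
  · intro i j hij
    fin_cases i <;> fin_cases j
    · exact absurd rfl hij
    · exact hd
    · exact hd.symm
    · exact absurd rfl hij
  · have hU : ⋃ i, ![c₁, c₂] i = c₁ ∪ c₂ := by
      ext x
      simp [Fin.exists_fin_two]
    rw [hU]
    refine ⟨?_, hc⟩
    by_contra hne
    rw [not_nonempty_iff_eq_empty, compl_empty_iff] at hne
    have ho : IsOpen c₁ := by
      have : c₁ = c₂ᶜ := by
        ext x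
        refine ⟨fun hx ↦ disjoint_left.1 hd hx, fun hx ↦ ?_⟩
        exact (hne ▸ mem_univ x : x ∈ c₁ ∪ c₂).resolve_right hx
      rw [this]
      exact h₂.isClosed.isOpen_compl
    rcases isClopen_iff.1 ⟨h₁.isClosed, ho⟩ with h0 | h0
    · exact h₁.nonempty.ne_empty h0
    · obtain ⟨x, hx⟩ := h₂.nonempty
      exact disjoint_right.1 hd hx (h0 ▸ mem_univ x)

theorem TwoCurvesSeparate.jordanIn (h : TwoCurvesSeparate T) {δ : Set T} (hδ : IsSCC δ) :
    JordanIn δᶜ := by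
  intro F hF hs hc
  refine h δ (range F) hδ ⟨F, hF, rfl⟩ (disjoint_right.2 fun x hx ↦ hs hx) ?_
  rwa [compl_union, ← sdiff_eq]

theorem hasPlanarCharts
    (h : ∀ x : T, x ∉ (∅ : Set T) → ∃ U : Set T, IsOpen U ∧ x ∈ U ∧ Nonempty (U ≃ₜ (ℝ × ℝ))) :
    HasPlanarCharts T := by
  intro x
  obtain ⟨U, oU, hx, ⟨φ⟩⟩ := h x id
  let ψ : ℂ ≃ₜ U := Complex.equivRealProdCLM.toHomeomorph.trans φ.symm
  let τ : ℂ ≃ₜ ℂ := Homeomorph.addLeft (ψ.symm ⟨x, hx⟩)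
  refine ⟨fun z ↦ ψ (τ z), ?_, ?_⟩
  · exact oU.isOpenEmbedding_subtypeVal.comp (τ.trans ψ).isOpenEmbedding
  · simp [τ]

theorem HasPlanarCharts.locallyConnectedSpace (h : HasPlanarCharts T) :
    LocallyConnectedSpace T := by
  rw [locallyConnectedSpace_iff_subsets_isOpen_isConnected]
  intro x U hU
  obtain ⟨φ, hφ, rfl⟩ := h x
  obtain ⟨V, hV, oV, h0, cV⟩ := locallyConnectedSpace_iff_subsets_isOpen_isConnected.1
    (inferInstance : LocallyConnectedSpace ℂ) 0 (φ ⁻¹' U) (hφ.continuous.continuousAt hU)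
  exact ⟨φ '' V, image_subset_iff.2 hV, hφ.isOpenMap _ oV, mem_image_of_mem _ h0,
    cV.image _ hφ.continuous.continuousOn⟩

/-- The deck transformations count the levels of `δ` met by a set. -/
theorem ncard_levelsMet (hT : IsOrientedSurface 1 0 T ∅) {δ : Set T} (hδ : IsEssentialSCC δ)
    {C : AnnCover T} (D : CurveLift C δ) (S : Set C.Tot) :
    (levelsMet D S).ncard = {d : C.Tot ≃ₜ C.Tot | (∀ x, C.p (d x) = C.p x) ∧
      (d '' hatSet D ∩ S).Nonempty}.ncard := by
  obtain ⟨_, _, _, _, -, ch, -, -, -, -, sep⟩ := hT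
  have hch := hasPlanarCharts ch
  have := hch.locallyConnectedSpace
  have hsep := twoCurvesSeparate sep
  obtain ⟨e₁⟩ := nonempty_puncturedPlane_homeomorph
  obtain ⟨e₂⟩ := C.annulus
  have : PreconnectedSpace C.Tot :=
    e₂.symm.surjective.denseRange.preconnectedSpace e₂.symm.continuous
  have : LocallyConnectedSpace PuncturedPlane :=
    (isOpen_compl_singleton (x := (0 : ℂ))).isOpenEmbedding_subtypeVal.locallyConnectedSpace
  have : LocallyConnectedSpace C.Tot :=
    (e₁.trans e₂.symm).symm.isOpenEmbedding.locallyConnectedSpace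
  obtain ⟨fr⟩ := nonempty_frame (e₁.trans e₂.symm) C.cov (J := hatSet D) D.compact D.bij hδ
  obtain ⟨g, R, h⟩ := fr.exists_isShift C.cov hch (fr.isPreconnected_compl C.cov hch hsep)
    (hsep.jordanIn hδ.1)
  exact h.ncard_levelsMet_eq S

end surface

/-- Let `T` be the torus, `α` an essential simple closed curve in `T`,
and `β`, `γ` essential simple closed curves in the isotopy class of `α`.  Then the
crossing number defined via the annular (cyclic) cover corresponding to `[α]` is
symmetric: `C_β(γ) = C_γ(β)`. -/
theorem stmt18 (T : Type) [TopologicalSpace T] (hT : IsOrientedSurface 1 0 T ∅)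
    (αc : Set T) (hα : IsEssentialCurve ∅ αc)
    (βc γc : Set T) (hβ : IsEssentialCurve ∅ βc) (hγ : IsEssentialCurve ∅ γc)
    (hβα : CurvesIsotopic βc αc) (hγα : CurvesIsotopic γc αc)
    (C : AnnCover T) (Dβ : CurveLift C βc) (Dγ : CurveLift C γc) :
    crossing Dβ Dγ = crossing Dγ Dβ := by
  by_cases hne : βc = γc
  · rw [crossing, crossing, if_pos hne, if_pos hne.symm]
  · rw [crossing, crossing, if_neg hne, if_neg (Ne.symm hne), ncard_levelsMet hT hβ.2.1,
      ncard_levelsMet hT hγ.2.1]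
    have hsymm : ∀ (S S' : Set C.Tot) (d : C.Tot ≃ₜ C.Tot),
        ((∀ x, C.p (d x) = C.p x) ∧ (d '' S ∩ S').Nonempty) →
        (∀ x, C.p (d.symm x) = C.p x) ∧ (d.symm '' S' ∩ S).Nonempty := by
      rintro S S' d ⟨hd, _, ⟨x, hx, rfl⟩, hx'⟩
      refine ⟨fun y ↦ ?_, x, ⟨d x, hx', d.symm_apply_apply x⟩, hx⟩
      rw [← hd, d.apply_symm_apply]
    rw [← ncard_image_of_injective (f := (Homeomorph.symm : (C.Tot ≃ₜ C.Tot) → _)) _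
      (Function.LeftInverse.injective fun d ↦ d.symm_symm)]
    congr 1
    ext d
    constructor
    · rintro ⟨d, hd, rfl⟩
      exact hsymm _ _ d hd
    · intro hd
      exact ⟨d.symm, hsymm _ _ d hd, d.symm_symm⟩
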